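/- Fix ν ∈ (0,1). There exists a sequence (a_n)_{n≥1} of real numbers with 0 ≤ a_n ≤ 2 which satisfies condition R(ν), satisfies the parity condition that for every B > 0 there is a constant C_B with |∑_{n≤x} a_n μ(n)| ≤ C_B · x·(log x)^{−B} for all x ≥ 2, satisfies S_1(x) ~ x as x → ∞, and such that for every integer k ≥ 2 the asymptotic formula S_k(x) ~ k·x·(log x)^{k−1} as x → ∞ fails. -/

import Mathlib

open Finset Filter

/-- The generalized von Mangoldt function `Λ_k(n) = ∑_{d ∣ n} μ(d) (log (n/d))^k`. -/
noncomputable def Lambdak (k : ℕ) (n : ℕ) : ℝ :=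
  ∑ d ∈ n.divisors, (ArithmeticFunction.moebius d : ℝ) * (Real.log ((n : ℝ) / (d : ℝ))) ^ k

/-- `S_k(x) = ∑_{n ≤ x} a_n Λ_k(n)`. -/
noncomputable def Ssum (a : ℕ → ℝ) (k : ℕ) (x : ℝ) : ℝ :=
  ∑ n ∈ Finset.Icc 1 ⌊x⌋₊, a n * Lambdak k n

/-- `T_k(x) = S_k(x)/(k x (log x)^{k−1})`. -/
noncomputable def Tquot (a : ℕ → ℝ) (k : ℕ) (x : ℝ) : ℝ :=
  Ssum a k x / (k * x * Real.log x ^ (k - 1))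

/-- Condition `R(ν)`: for every `B > 0` there is `C_B` with
`∑_{d ≤ x^ν} |∑_{n ≤ x, d ∣ n} a_n − x/d| ≤ C_B · x (log x)^{−B}` for all `x ≥ 2`. -/
noncomputable def Rcond (ν : ℝ) (a : ℕ → ℝ) : Prop :=
  ∀ B : ℝ, 0 < B → ∃ C : ℝ, ∀ x : ℝ, 2 ≤ x →
    ∑ d ∈ Finset.Icc 1 ⌊x ^ ν⌋₊,
      |(∑ n ∈ (Finset.Icc 1 ⌊x⌋₊).filter (fun n => d ∣ n), a n) - x / d|
      ≤ C * x * Real.log x ^ (-B)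


open Finset Filter

noncomputable def zterm (n : ℕ) (s : ℂ) : ℂ :=
  (s - 1) * ((n : ℂ) + 2) ^ (-s) - (((n : ℂ) + 1) ^ (1 - s) - ((n : ℂ) + 2) ^ (1 - s))

lemma rpow_neg_bd {n : ℕ} {s : ℂ} (hs : 0 ≤ s.re) {u : ℝ} (hu : (n : ℝ) + 1 ≤ u) :
    ‖(u : ℂ) ^ (-s)‖ ≤ ((n : ℝ) + 1) ^ (-s.re) := by
  have hn : (0 : ℝ) < (n : ℝ) + 1 := by positivity
  rw [Complex.norm_cpow_eq_rpow_re_of_pos (by linarith)]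
  simp only [Complex.neg_re]
  exact Real.rpow_le_rpow_of_nonpos hn hu (by linarith)

lemma hasDerivAt_cpow_real {u : ℝ} (hu : 0 < u) (s : ℂ) :
    HasDerivAt (fun v : ℝ => (v : ℂ) ^ s) (s * (u : ℂ) ^ (s - 1)) u := by
  have h := (hasDerivAt_id (u : ℂ)).cpow_const (c := s) (by left; simpa using hu)
  simp only [id, mul_one] at h
  exact h.comp_ofReal

lemma diff_bd {n : ℕ} {s : ℂ} (hs : 0 ≤ s.re) {u : ℝ} (hu : (n : ℝ) + 1 ≤ u)
    (hu2 : u ≤ (n : ℝ) + 2) :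
    ‖((n : ℂ) + 2) ^ (-s) - (u : ℂ) ^ (-s)‖ ≤ ‖s‖ * ((n : ℝ) + 1) ^ (-s.re - 1) := by
  have hn : (0 : ℝ) < (n : ℝ) + 1 := by positivity
  have h := Convex.norm_image_sub_le_of_norm_hasDerivWithin_le
    (f := fun v : ℝ => (v : ℂ) ^ (-s)) (f' := fun v : ℝ => (-s) * (v : ℂ) ^ (-s - 1))
    (s := Set.Icc ((n : ℝ) + 1) (n + 2)) (x := u) (y := (n : ℝ) + 2)
    (C := ‖s‖ * ((n : ℝ) + 1) ^ (-s.re - 1))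
    (fun v hv => (hasDerivAt_cpow_real (by linarith [hv.1]) (-s)).hasDerivWithinAt)
    (fun v hv => by
      rw [norm_mul, norm_neg, Complex.norm_cpow_eq_rpow_re_of_pos (by linarith [hv.1])]
      simp only [Complex.sub_re, Complex.neg_re, Complex.one_re]
      exact mul_le_mul_of_nonneg_left (Real.rpow_le_rpow_of_nonpos hn hv.1 (by linarith))
        (norm_nonneg _))
    (convex_Icc _ _) ⟨hu, hu2⟩ ⟨by linarith, le_refl _⟩
  push_cast at h
  refine h.trans ?_
  rw [Real.norm_eq_abs, abs_of_nonneg (by linarith)]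
  have : 0 ≤ ‖s‖ * ((n : ℝ) + 1) ^ (-s.re - 1) := by positivity
  nlinarith

lemma zterm_bd {n : ℕ} {s : ℂ} {K : ℝ}
    (hK : ∀ u : ℝ, (n : ℝ) + 1 ≤ u → u ≤ (n : ℝ) + 2 →
      ‖((n : ℂ) + 2) ^ (-s) - (u : ℂ) ^ (-s)‖ ≤ K) :
    ‖zterm n s‖ ≤ ‖s - 1‖ * K := by
  have hn : (0 : ℝ) < (n : ℝ) + 1 := by positivity
  have h := Convex.norm_image_sub_le_of_norm_hasDerivWithin_le
    (f := fun v : ℝ => (s - 1) * ((n : ℂ) + 2) ^ (-s) * (v : ℂ) + (v : ℂ) ^ (1 - s))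
    (f' := fun v : ℝ => (s - 1) * ((n : ℂ) + 2) ^ (-s) + (1 - s) * (v : ℂ) ^ (1 - s - 1))
    (s := Set.Icc ((n : ℝ) + 1) (n + 2)) (x := (n : ℝ) + 1) (y := (n : ℝ) + 2)
    (C := ‖s - 1‖ * K)
    (fun v hv => by
      refine HasDerivAt.hasDerivWithinAt ?_
      refine HasDerivAt.add ?_ (hasDerivAt_cpow_real (by linarith [hv.1]) (1 - s))
      simpa using ((hasDerivAt_id (v : ℂ)).const_mul ((s - 1) * ((n : ℂ) + 2) ^ (-s))).comp_ofReal)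
    (fun v hv => by
      have : (s - 1) * ((n : ℂ) + 2) ^ (-s) + (1 - s) * (v : ℂ) ^ (1 - s - 1)
        = (s - 1) * (((n : ℂ) + 2) ^ (-s) - (v : ℂ) ^ (-s)) := by
        rw [show 1 - s - 1 = -s by ring]; ring
      rw [this, norm_mul]
      exact mul_le_mul_of_nonneg_left (hK v hv.1 hv.2) (norm_nonneg _))
    (convex_Icc _ _) ⟨le_refl _, by linarith⟩ ⟨by linarith, le_refl _⟩
  push_cast at h
  have e : ((n : ℝ) + 2 - (n + 1)) = 1 := by ring
  rw [e, norm_one, mul_one] at h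
  refine le_trans (le_of_eq ?_) h
  congr 1
  unfold zterm
  ring

/-- interpolated bound -/
lemma zterm_bd' {n : ℕ} {s : ℂ} {θ : ℝ} (hθ0 : 0 ≤ θ) (hθ1 : θ ≤ 1) (hs : 0 ≤ s.re) :
    ‖zterm n s‖ ≤ ‖s - 1‖ * (2 * ‖s‖ ^ θ * ((n : ℝ) + 1) ^ (-s.re - θ)) := by
  have hn : (0 : ℝ) < (n : ℝ) + 1 := by positivity
  apply zterm_bd
  intro u hu hu2
  set q := ‖((n : ℂ) + 2) ^ (-s) - (u : ℂ) ^ (-s)‖ with hq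
  have h1 : q ≤ 2 * ((n : ℝ) + 1) ^ (-s.re) := by
    refine (norm_sub_le _ _).trans ?_
    have a := rpow_neg_bd (n := n) hs hu
    have b := rpow_neg_bd (n := n) hs (u := (n : ℝ) + 2) (by linarith)
    push_cast at b
    linarith
  have h2 := diff_bd (n := n) hs hu hu2
  have hq0 : 0 ≤ q := norm_nonneg _
  calc q = q ^ (1 - θ) * q ^ θ := by
        rcases hq0.eq_or_lt with h | h
        · rw [← h]
          by_cases h0 : θ = 0
          · simp [h0]
          · rw [Real.zero_rpow h0, mul_zero]
        · rw [← Real.rpow_add h]; simp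
    _ ≤ (2 * ((n : ℝ) + 1) ^ (-s.re)) ^ (1 - θ) * (‖s‖ * ((n : ℝ) + 1) ^ (-s.re - 1)) ^ θ := by
        gcongr
    _ = 2 ^ (1 - θ) * ‖s‖ ^ θ * ((n : ℝ) + 1) ^ (-s.re - θ) := by
        rw [Real.mul_rpow (by norm_num) (by positivity), Real.mul_rpow (by positivity) (by positivity),
          ← Real.rpow_mul hn.le, ← Real.rpow_mul hn.le]
        rw [show -s.re - θ = -s.re * (1 - θ) + (-s.re - 1) * θ by ring, Real.rpow_add hn]
        ring
    _ ≤ 2 * ‖s‖ ^ θ * ((n : ℝ) + 1) ^ (-s.re - θ) := by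
        gcongr
        calc (2 : ℝ) ^ (1 - θ) ≤ 2 ^ (1 : ℝ) :=
              Real.rpow_le_rpow_of_exponent_le (by norm_num) (by linarith)
          _ = 2 := by simp

lemma summable_shift {a : ℝ} (ha : 1 < a) : Summable (fun n : ℕ => ((n : ℝ) + 1) ^ (-a)) := by
  have := (summable_nat_add_iff 1).2 (Real.summable_nat_rpow.2 (by linarith : -a < -1))
  simpa using this

lemma zterm_norm_le {ε : ℝ} (hε : 0 < ε) (hε1 : ε ≤ 1 / 2) {s : ℂ} (hs : 1 - ε ≤ s.re) (n : ℕ) :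
    ‖zterm n s‖ ≤ ‖s - 1‖ * (2 * ‖s‖ ^ (2 * ε)) * ((n : ℝ) + 1) ^ (-(1 + ε)) := by
  refine (zterm_bd' (θ := 2 * ε) (by linarith) (by linarith) (by linarith)).trans ?_
  rw [← mul_assoc]
  gcongr
  · linarith [(Nat.cast_nonneg n : (0 : ℝ) ≤ n)]
  · linarith

lemma riemannZeta₁_eq_of_one_lt {s : ℂ} (hs : 1 < s.re) :
    riemannZeta₁ s = s + ∑' n : ℕ, zterm n s := by
  have hs1 : s ≠ 1 := by rintro rfl; simp at hs
  have hz := riemannZeta_eq_inv_sub_mul hs1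
  have hZ : riemannZeta₁ s = (s - 1) * riemannZeta s := by
    rw [hz, ← mul_assoc, mul_inv_cancel₀ (sub_ne_zero.2 hs1), one_mul]
  have hsum : HasSum (fun n : ℕ => ((n : ℂ) + 1) ^ (-s)) (riemannZeta s) := by
    rw [zeta_eq_tsum_one_div_nat_add_one_cpow hs]
    have h0 : Summable (fun n : ℕ => 1 / ((n : ℂ) + 1) ^ s) := by
      have := (summable_nat_add_iff 1).2 ((Complex.summable_one_div_nat_cpow (p := s)).2 hs)
      simpa using this
    convert h0.hasSum using 2 with n
    rw [Complex.cpow_neg, one_div]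
  have h1 : HasSum (fun n : ℕ => ((n : ℂ) + 2) ^ (-s)) (riemannZeta s - 1) := by
    have := (hasSum_nat_add_iff' 1).2 hsum
    simp only [Finset.range_one, Finset.sum_singleton, Nat.cast_zero, zero_add, Complex.one_cpow] at this
    have e : (fun n : ℕ => ((n : ℂ) + 2) ^ (-s)) = (fun n : ℕ => (((n + 1 : ℕ) : ℂ) + 1) ^ (-s)) := by
      funext n
      congr 1
      push_cast; ring
    rw [e]
    exact this
  have h2 : HasSum (fun n : ℕ => (((n : ℂ) + 1) ^ (1 - s) - ((n : ℂ) + 2) ^ (1 - s))) 1 := by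
    have hsm : Summable (fun n : ℕ => (((n : ℂ) + 1) ^ (1 - s) - ((n : ℂ) + 2) ^ (1 - s))) := by
      have hb : Summable (fun n => zterm n s) := by
        refine Summable.of_norm_bounded ((summable_shift (a := 1 + 1/2) (by norm_num)).mul_left
          (‖s - 1‖ * (2 * ‖s‖ ^ (2 * (1/2 : ℝ))))) ?_
        intro n
        exact zterm_norm_le (by norm_num) (by norm_num) (by linarith) n
      have := (h1.summable.mul_left (s - 1)).sub hb
      refine this.congr ?_
      intro n; unfold zterm; ring
    refine (hsm.hasSum_iff_tendsto_nat).2 ?_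
    have : ∀ N : ℕ, ∑ n ∈ range N, (((n : ℂ) + 1) ^ (1 - s) - ((n : ℂ) + 2) ^ (1 - s))
        = 1 - ((N : ℂ) + 1) ^ (1 - s) := by
      intro N
      induction N with
      | zero => simp
      | succ N ih => rw [Finset.sum_range_succ, ih]; push_cast; ring_nf
    simp_rw [this]
    have ht : Tendsto (fun N : ℕ => ((N : ℂ) + 1) ^ (1 - s)) atTop (nhds 0) := by
      rw [tendsto_zero_iff_norm_tendsto_zero]
      have : ∀ N : ℕ, ‖((N : ℂ) + 1) ^ (1 - s)‖ = ((N : ℝ) + 1) ^ (-(s.re - 1)) := by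
        intro N
        have := Complex.norm_cpow_eq_rpow_re_of_pos (x := (N : ℝ) + 1) (by positivity) (1 - s)
        push_cast at this
        rw [this]; simp
      simp_rw [this]
      exact (tendsto_rpow_neg_atTop (by linarith)).comp
        (tendsto_atTop_add_const_right _ _ tendsto_natCast_atTop_atTop)
    simpa using tendsto_const_nhds.sub ht
  have h3 := (h1.mul_left (s - 1)).sub h2
  have h4 : ∑' n : ℕ, zterm n s = (s - 1) * (riemannZeta s - 1) - 1 := h3.tsum_eq
  rw [h4, hZ]; ring

lemma riemannZeta₁_eq {s : ℂ} (hs : 1 / 2 < s.re) :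
    riemannZeta₁ s = s + ∑' n : ℕ, zterm n s := by
  have hU : IsOpen {s : ℂ | 1 / 2 < s.re} := isOpen_lt continuous_const Complex.continuous_re
  have hpre : IsPreconnected {s : ℂ | 1 / 2 < s.re} :=
    (convex_halfSpace_re_gt (1/2)).isPreconnected
  have hd : DifferentiableOn ℂ (fun s => s + ∑' n : ℕ, zterm n s) {s : ℂ | 1 / 2 < s.re} := by
    refine differentiableOn_id.add ?_
    intro z hz
    -- local ball
    have hz' : 1 / 2 < z.re := hz
    have hopen : IsOpen ({s : ℂ | 1 / 2 < s.re} ∩ Metric.ball z 1) := hU.inter Metric.isOpen_ball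
    have hD := Complex.differentiableOn_tsum_of_summable_norm (F := zterm)
      (u := fun n : ℕ => ((‖z‖ + 2) * (2 * (‖z‖ + 1) ^ (2 * (1/2 : ℝ)))) * ((n : ℝ) + 1) ^ (-(1 + 1/2 : ℝ)))
      (U := {s : ℂ | 1 / 2 < s.re} ∩ Metric.ball z 1)
      ((summable_shift (by norm_num)).mul_left _)
      (fun n w hw => by
        unfold zterm
        have h1 : ((n : ℂ) + 2) ≠ 0 := by
          have : ((n : ℂ) + 2) = ((n + 2 : ℕ) : ℂ) := by push_cast; ring
          rw [this]; exact_mod_cast (by omega : n + 2 ≠ 0)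
        have h2 : ((n : ℂ) + 1) ≠ 0 := Nat.cast_add_one_ne_zero n
        refine DifferentiableAt.differentiableWithinAt ?_
        refine DifferentiableAt.sub ?_ (DifferentiableAt.sub ?_ ?_)
        · exact (by fun_prop : DifferentiableAt ℂ (fun s : ℂ => s - 1) w).mul
            ((by fun_prop : DifferentiableAt ℂ (fun s : ℂ => -s) w).const_cpow (Or.inl h1))
        · exact (by fun_prop : DifferentiableAt ℂ (fun s : ℂ => 1 - s) w).const_cpow (Or.inl h2)
        · exact (by fun_prop : DifferentiableAt ℂ (fun s : ℂ => 1 - s) w).const_cpow (Or.inl h1))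
      hopen
      (fun n w hw => by
        have hw1 : 1/2 < w.re := hw.1
        refine (zterm_norm_le (ε := 1/2) (by norm_num) (by norm_num) (by linarith) n).trans ?_
        have hwz : ‖w - z‖ < 1 := by simpa [dist_eq_norm] using hw.2
        have e1 : ‖w‖ ≤ ‖z‖ + 1 := by
          calc ‖w‖ = ‖(w - z) + z‖ := by ring_nf
            _ ≤ ‖w - z‖ + ‖z‖ := norm_add_le _ _
            _ ≤ _ := by linarith
        have e2 : ‖w - 1‖ ≤ ‖z‖ + 2 := by
          calc ‖w - 1‖ ≤ ‖w‖ + ‖(1 : ℂ)‖ := norm_sub_le _ _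
            _ ≤ _ := by rw [norm_one]; linarith
        gcongr)
    exact (hD.differentiableAt (hopen.mem_nhds ⟨hz, Metric.mem_ball_self (by norm_num)⟩)).differentiableWithinAt
  have h1 : AnalyticOnNhd ℂ riemannZeta₁ {s : ℂ | 1 / 2 < s.re} :=
    differentiable_riemannZeta₁.differentiableOn.analyticOnNhd hU
  have h2 := hd.analyticOnNhd hU
  have h3 : riemannZeta₁ =ᶠ[nhds 2] (fun s => s + ∑' n : ℕ, zterm n s) := by
    have : {s : ℂ | 1 < s.re} ∈ nhds (2 : ℂ) :=
      (isOpen_lt continuous_const Complex.continuous_re).mem_nhds (by simp)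
    filter_upwards [this] with s hs
    exact riemannZeta₁_eq_of_one_lt hs
  exact h1.eqOn_of_preconnected_of_eventuallyEq h2 hpre (z₀ := 2) (by simp; norm_num) h3 hs

lemma norm_le_of_re {s : ℂ} (h0 : 0 ≤ s.re) (h1 : s.re ≤ 4) : ‖s‖ ≤ 4 * (1 + |s.im|) := by
  have := Complex.norm_le_abs_re_add_abs_im s
  rw [abs_of_nonneg h0] at this
  nlinarith [abs_nonneg s.im]

/-- Upper bound for Z near Re s = 1. -/
lemma Z_upper {ε : ℝ} (hε : 0 < ε) (hε1 : ε < 1 / 2) :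
    ∃ C : ℝ, 0 < C ∧ ∀ s : ℂ, 1 - ε ≤ s.re → s.re ≤ 4 →
      ‖riemannZeta₁ s‖ ≤ C * (1 + |s.im|) ^ (1 + 2 * ε) := by
  set A := ∑' n : ℕ, ((n : ℝ) + 1) ^ (-(1 + ε)) with hA
  have hA0 : 0 ≤ A := tsum_nonneg (fun n => by positivity)
  refine ⟨4 + 5 * (2 * 4 ^ (2 * ε)) * A, by positivity, ?_⟩
  intro s hs hs4
  rw [riemannZeta₁_eq (by linarith)]
  have hsn := norm_le_of_re (s := s) (by linarith) hs4
  have ht : 1 ≤ 1 + |s.im| := by linarith [abs_nonneg s.im]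
  have hs1 : ‖s - 1‖ ≤ 5 * (1 + |s.im|) := by
    refine (norm_sub_le _ _).trans ?_
    rw [norm_one]; linarith
  have hsum : ‖∑' n : ℕ, zterm n s‖ ≤ (‖s - 1‖ * (2 * ‖s‖ ^ (2 * ε))) * A := by
    rw [hA, ← tsum_mul_left]
    exact tsum_of_norm_bounded (((summable_shift (by linarith)).mul_left _).hasSum)
      (fun n => zterm_norm_le hε hε1.le hs n)
  set t := 1 + |s.im| with htd
  have ht0 : 0 < t := by linarith
  have e1 : t ≤ t ^ (1 + 2 * ε) := by
    nth_rewrite 1 [← Real.rpow_one t]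
    exact Real.rpow_le_rpow_of_exponent_le ht (by linarith)
  have e2 : t ^ (1 + 2 * ε) = t * t ^ (2 * ε) := by
    rw [Real.rpow_add ht0, Real.rpow_one]
  calc ‖s + ∑' n : ℕ, zterm n s‖ ≤ ‖s‖ + ‖∑' n : ℕ, zterm n s‖ := norm_add_le _ _
    _ ≤ 4 * t + (5 * t * (2 * (4 * t) ^ (2 * ε))) * A := by
        gcongr
        refine hsum.trans ?_
        gcongr
    _ ≤ 4 * t ^ (1 + 2 * ε) + (5 * t * (2 * (4 * t) ^ (2 * ε))) * A := by gcongr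
    _ = _ := by
        rw [Real.mul_rpow (by norm_num) ht0.le, e2]; ring


lemma Z_bounds {ε : ℝ} (hε : 0 < ε) (hε1 : ε < 1 / 4) :
    ∃ C : ℝ, 0 < C ∧ ∀ s : ℂ, 1 - ε ≤ s.re → s.re ≤ 3 →
      ‖riemannZeta₁ s‖ ≤ C * (1 + |s.im|) ^ (1 + 4 * ε) ∧
      ‖deriv riemannZeta₁ s‖ ≤ C * (1 + |s.im|) ^ (1 + 4 * ε) := by
  obtain ⟨C, hC, h⟩ := Z_upper (ε := 2 * ε) (by linarith) (by linarith)
  have e4 : 1 + 2 * (2 * ε) = 1 + 4 * ε := by ring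
  rw [e4] at h
  refine ⟨C + C * 2 ^ (1 + 4 * ε) / ε, by positivity, ?_⟩
  intro s hs hs3
  set t := 1 + |s.im| with ht
  have ht1 : 1 ≤ t := by rw [ht]; linarith [abs_nonneg s.im]
  have hp : 0 ≤ t ^ (1 + 4 * ε) := by positivity
  constructor
  · refine (h s (by linarith) (by linarith)).trans ?_
    have : 0 ≤ C * 2 ^ (1 + 4 * ε) / ε := by positivity
    nlinarith
  · have hd := Complex.norm_deriv_le_of_forall_mem_sphere_norm_le (c := s) (R := ε)
      (C := C * 2 ^ (1 + 4 * ε) * t ^ (1 + 4 * ε)) (f := riemannZeta₁) hε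
      differentiable_riemannZeta₁.diffContOnCl
      (fun w hw => by
        have hw' : ‖w - s‖ = ε := by simpa [dist_eq_norm] using hw
        have hre : |(w - s).re| ≤ ε := (Complex.abs_re_le_norm _).trans hw'.le
        have him : |(w - s).im| ≤ ε := (Complex.abs_im_le_norm _).trans hw'.le
        simp only [Complex.sub_re, Complex.sub_im] at hre him
        rw [abs_le] at hre
        have him2 : |w.im| ≤ |s.im| + ε := by
          have := abs_sub_abs_le_abs_sub w.im s.im
          linarith
        refine (h w (by linarith) (by linarith)).trans ?_
        rw [mul_assoc, ← Real.mul_rpow (by norm_num) (by linarith)]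
        gcongr
        rw [ht]; linarith [abs_nonneg s.im])
    refine hd.trans ?_
    rw [show C * 2 ^ (1 + 4 * ε) * t ^ (1 + 4 * ε) / ε = C * 2 ^ (1 + 4 * ε) / ε * t ^ (1 + 4 * ε) by ring]
    nlinarith

lemma zeta_341 {x : ℝ} (hx : 0 < x) (y : ℝ) :
    1 ≤ ‖riemannZeta (1 + x)‖ ^ 3 * ‖riemannZeta (1 + x + Complex.I * y)‖ ^ 4 *
      ‖riemannZeta (1 + x + 2 * Complex.I * y)‖ := by
  have h := DirichletCharacter.norm_LFunction_product_ge_one (N := 1) 1 hx y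
  simp only [DirichletCharacter.LFunctionTrivChar, DirichletCharacter.LFunction_modOne_eq, norm_mul,
    norm_pow] at h
  exact h

lemma norm_zeta_eq {s : ℂ} (hs : s ≠ 1) : ‖riemannZeta s‖ = ‖riemannZeta₁ s‖ / ‖s - 1‖ := by
  rw [riemannZeta_eq_inv_sub_mul hs, norm_mul, norm_inv, div_eq_inv_mul]

lemma Z_ne_zero {s : ℂ} (hs : 1 ≤ s.re) : riemannZeta₁ s ≠ 0 := by
  by_cases h : s = 1
  · rw [h]; simp
  · intro h0
    have := riemannZeta_eq_inv_sub_mul h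
    rw [h0, mul_zero] at this
    exact riemannZeta_ne_zero_of_one_le_re hs this

lemma Z_lower_341 {ε : ℝ} (hε : 0 < ε) (hε1 : ε < 1 / 4) :
    ∃ q : ℝ, 0 < q ∧ ∀ x y : ℝ, 0 < x → x ≤ 1 → 1 ≤ |y| →
      q ^ 4 * x ^ 3 * |y| ^ (4 - 4 * ε) ≤ ‖riemannZeta₁ (1 + x + Complex.I * y)‖ ^ 4 := by
  obtain ⟨C, hC, h⟩ := Z_bounds hε hε1
  set K := C ^ 3 * (C * 3 ^ (1 + 4 * ε)) with hK
  have hKp : 0 < K := by positivity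
  refine ⟨(K⁻¹) ^ (1 / 4 : ℝ), by positivity, ?_⟩
  intro x y hx hx1 hy
  have hq : ((K⁻¹) ^ (1 / 4 : ℝ)) ^ 4 = K⁻¹ := by
    rw [← Real.rpow_natCast, ← Real.rpow_mul (by positivity)]; norm_num
  rw [hq]
  have hy0 : 0 < |y| := by linarith
  have hyne : y ≠ 0 := abs_pos.1 hy0
  set s0 : ℂ := 1 + x with hs0
  set s1 : ℂ := 1 + x + Complex.I * y with hs1
  set s2 : ℂ := 1 + x + 2 * Complex.I * y with hs2
  have h0 : ‖riemannZeta s0‖ ≤ C / x := by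
    have hne : s0 ≠ 1 := by
      rw [hs0]; simpa using hx.ne'
    rw [norm_zeta_eq hne]
    have : ‖s0 - 1‖ = x := by rw [hs0]; simp [abs_of_pos hx]
    rw [this]
    gcongr
    have := (h s0 (by simp [hs0]; linarith) (by simp [hs0]; linarith)).1
    simpa [hs0] using this
  have h1 : ‖riemannZeta s1‖ ≤ ‖riemannZeta₁ s1‖ / |y| := by
    have hne : s1 ≠ 1 := by
      intro e
      have := congrArg Complex.im e
      simp [hs1] at this
      exact hyne this
    rw [norm_zeta_eq hne]
    gcongr
    have := Complex.abs_im_le_norm (s1 - 1)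
    simpa [hs1] using this
  have h2 : ‖riemannZeta s2‖ ≤ C * 3 ^ (1 + 4 * ε) * |y| ^ (4 * ε) := by
    have hne : s2 ≠ 1 := by
      intro e
      have := congrArg Complex.im e
      simp [hs2] at this
      exact hyne this
    rw [norm_zeta_eq hne]
    have hn : |y| ≤ ‖s2 - 1‖ := by
      have := Complex.abs_im_le_norm (s2 - 1)
      simp [hs2] at this
      refine le_trans ?_ this
      linarith
    rw [div_le_iff₀ (lt_of_lt_of_le hy0 hn)]
    have hb := (h s2 (by simp [hs2]; linarith) (by simp [hs2]; linarith)).1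
    have him : |s2.im| = 2 * |y| := by simp [hs2]
    rw [him] at hb
    calc _ ≤ C * (1 + 2 * |y|) ^ (1 + 4 * ε) := hb
      _ ≤ C * (3 * |y|) ^ (1 + 4 * ε) := by gcongr; linarith
      _ = C * 3 ^ (1 + 4 * ε) * |y| ^ (4 * ε) * |y| := by
          rw [Real.mul_rpow (by norm_num) hy0.le, Real.rpow_add hy0, Real.rpow_one]; ring
      _ ≤ _ := by gcongr
  have hm := zeta_341 hx y
  have hfin : 1 ≤ (C / x) ^ 3 * (‖riemannZeta₁ s1‖ / |y|) ^ 4 * (C * 3 ^ (1 + 4 * ε) * |y| ^ (4 * ε)) := by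
    refine hm.trans ?_
    gcongr
  have e : |y| ^ (4 - 4 * ε) * |y| ^ (4 * ε) = |y| ^ 4 := by
    rw [← Real.rpow_add hy0]; norm_num
  have hyp : 0 < |y| ^ (4 * ε) := by positivity
  have e3 : (C / x) ^ 3 * (‖riemannZeta₁ s1‖ / |y|) ^ 4 * (C * 3 ^ (1 + 4 * ε) * |y| ^ (4 * ε))
      = K * ‖riemannZeta₁ s1‖ ^ 4 * |y| ^ (4 * ε) / (x ^ 3 * |y| ^ 4) := by
    rw [hK]; field_simp
  rw [e3, le_div_iff₀ (by positivity), one_mul, ← e, ← mul_assoc] at hfin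
  have := le_of_mul_le_mul_right hfin hyp
  rw [mul_assoc, inv_mul_le_iff₀ hKp]
  exact this

lemma Z_lower_large {ε : ℝ} (hε : 0 < ε) (hε1 : ε < 1 / 4) :
    ∃ b : ℝ, 0 < b ∧ ∀ x y : ℝ, 0 < x → x ≤ 1 → 1 ≤ |y| →
      b * |y| ^ (1 - 16 * ε) ≤ ‖riemannZeta₁ (1 + x + Complex.I * y)‖ := by
  obtain ⟨C, hC, h⟩ := Z_bounds hε hε1
  obtain ⟨q, hq, hl⟩ := Z_lower_341 hε hε1
  set C2 := C * 2 ^ (1 + 4 * ε) with hC2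
  have hC2p : 0 < C2 := by positivity
  set r := min 1 (q / (2 * C2)) with hr
  have hr0 : 0 < r := by rw [hr]; positivity
  have hr1 : r ≤ 1 := min_le_left _ _
  have hr2 : C2 * r ≤ q / 2 := by
    have : r ≤ q / (2 * C2) := min_le_right _ _
    calc C2 * r ≤ C2 * (q / (2 * C2)) := by gcongr
      _ = q / 2 := by field_simp
  refine ⟨q * r ^ 3 / 2, by positivity, ?_⟩
  intro x y hx hx1 hy
  have hy0 : 0 < |y| := by linarith
  -- bound for x ≥ x0
  set x0 := r ^ 4 * |y| ^ (-20 * ε) with hx0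
  have hx00 : 0 < x0 := by positivity
  have hx01 : x0 ≤ 1 := by
    have h1 : |y| ^ (-20 * ε) ≤ 1 := Real.rpow_le_one_of_one_le_of_nonpos hy (by linarith)
    have h2 : r ^ 4 ≤ 1 := pow_le_one₀ hr0.le hr1
    calc x0 ≤ 1 * 1 := by rw [hx0]; gcongr
      _ = 1 := by norm_num
  have key : ∀ x' : ℝ, x0 ≤ x' → x' ≤ 1 →
      q * r ^ 3 * |y| ^ (1 - 16 * ε) ≤ ‖riemannZeta₁ (1 + x' + Complex.I * y)‖ := by
    intro x' h0 h1
    have := hl x' y (by linarith) h1 hy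
    refine le_of_pow_le_pow_left₀ (n := 4) (by norm_num) (norm_nonneg _) (le_trans ?_ this)
    calc (q * r ^ 3 * |y| ^ (1 - 16 * ε)) ^ 4 = q ^ 4 * x0 ^ 3 * |y| ^ (4 - 4 * ε) := by
          have e1 : (|y| ^ (1 - 16 * ε)) ^ 4 = |y| ^ (4 - 64 * ε) := by
            rw [← Real.rpow_natCast, ← Real.rpow_mul hy0.le]; congr 1; push_cast; ring
          have e2 : (|y| ^ (-20 * ε)) ^ 3 = |y| ^ (-60 * ε) := by
            rw [← Real.rpow_natCast, ← Real.rpow_mul hy0.le]; congr 1; push_cast; ring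
          rw [hx0, mul_pow, mul_pow, mul_pow, e1, e2,
            show 4 - 64 * ε = -60 * ε + (4 - 4 * ε) by ring, Real.rpow_add hy0]
          ring
      _ ≤ q ^ 4 * x' ^ 3 * |y| ^ (4 - 4 * ε) := by gcongr
  have hyp : 0 < |y| ^ (1 - 16 * ε) := by positivity
  by_cases hxx : x0 ≤ x
  · have := key x hxx hx1
    have : 0 < q * r ^ 3 * |y| ^ (1 - 16 * ε) := by positivity
    linarith
  · push Not at hxx
    have hk := key x0 le_rfl hx01
    -- mean value
    have hmv := Convex.norm_image_sub_le_of_norm_deriv_le (f := riemannZeta₁) (𝕜 := ℂ)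
      (s := {s : ℂ | 1 ≤ s.re ∧ s.re ≤ 3 ∧ s.im = y}) (x := 1 + x + Complex.I * y)
      (y := 1 + x0 + Complex.I * y) (C := C * (1 + |y|) ^ (1 + 4 * ε))
      (fun w _ => differentiable_riemannZeta₁ w)
      (fun w hw => by
        have := (h w (by linarith [hw.1]) hw.2.1).2
        rwa [hw.2.2] at this)
      (by
        intro a ha b hb u v hu hv huv
        obtain ⟨a1, a2, a3⟩ := ha
        obtain ⟨b1, b2, b3⟩ := hb
        refine ⟨?_, ?_, ?_⟩
        · simp only [Complex.add_re, Complex.real_smul, Complex.mul_re, Complex.ofReal_re,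
            Complex.ofReal_im, zero_mul, sub_zero]
          nlinarith
        · simp only [Complex.add_re, Complex.real_smul, Complex.mul_re, Complex.ofReal_re,
            Complex.ofReal_im, zero_mul, sub_zero]
          nlinarith
        · simp only [Complex.add_im, Complex.real_smul, Complex.mul_im, Complex.ofReal_re,
            Complex.ofReal_im, zero_mul, add_zero, a3, b3]
          rw [← add_mul, huv, one_mul])
      ⟨by simp; linarith, by simp; linarith, by simp⟩
      ⟨by simp; linarith, by simp; linarith, by simp⟩
    have e1 : ‖(1 + x0 + Complex.I * y) - (1 + x + Complex.I * y : ℂ)‖ = x0 - x := by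
      have : (1 + x0 + Complex.I * y) - (1 + x + Complex.I * y : ℂ) = ((x0 - x : ℝ) : ℂ) := by
        push_cast; ring
      rw [this, Complex.norm_real, Real.norm_eq_abs, abs_of_pos (by linarith)]
    rw [e1] at hmv
    have e2 : C * (1 + |y|) ^ (1 + 4 * ε) * (x0 - x) ≤ q * r ^ 3 / 2 * |y| ^ (1 - 16 * ε) := by
      calc C * (1 + |y|) ^ (1 + 4 * ε) * (x0 - x) ≤ C * (2 * |y|) ^ (1 + 4 * ε) * x0 := by
            gcongr <;> linarith
        _ = (C2 * r) * r ^ 3 * |y| ^ (1 - 16 * ε) := by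
            have e : |y| ^ (1 - 16 * ε) = |y| ^ (1 + 4 * ε) * |y| ^ (-20 * ε) := by
              rw [← Real.rpow_add hy0]; congr 1; ring
            rw [Real.mul_rpow (by norm_num) hy0.le, hx0, hC2, e]
            ring
        _ ≤ (q / 2) * r ^ 3 * |y| ^ (1 - 16 * ε) := by gcongr
        _ = _ := by ring
    have e3 := norm_sub_norm_le (riemannZeta₁ (1 + x0 + Complex.I * y))
      (riemannZeta₁ (1 + x + Complex.I * y))
    linarith

lemma Z_lower {ε : ℝ} (hε : 0 < ε) (hε1 : ε < 1 / 16) :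
    ∃ b : ℝ, 0 < b ∧ ∀ s : ℂ, 1 < s.re → s.re ≤ 2 →
      b * (1 + |s.im|) ^ (1 - 16 * ε) ≤ ‖riemannZeta₁ s‖ := by
  obtain ⟨b, hb, h⟩ := Z_lower_large hε (by linarith)
  have hcomp : IsCompact (Set.Icc (1 : ℝ) 2 ×ℂ Set.Icc (-1 : ℝ) 1) :=
    isCompact_Icc.reProdIm isCompact_Icc
  obtain ⟨z, hz, hmin⟩ := hcomp.exists_isMinOn
    ⟨1, by simp [Complex.mem_reProdIm]⟩
    (differentiable_riemannZeta₁.continuous.norm.continuousOn)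
  have hzp : 0 < ‖riemannZeta₁ z‖ := norm_pos_iff.2 (Z_ne_zero hz.1.1)
  refine ⟨min (b / 2) (‖riemannZeta₁ z‖ / 2), by positivity, ?_⟩
  intro s hs hs2
  have hsplit : s = 1 + ((s.re - 1 : ℝ) : ℂ) + Complex.I * (s.im : ℂ) := by
    apply Complex.ext <;> simp
  by_cases hy : 1 ≤ |s.im|
  · have := h (s.re - 1) s.im (by linarith) (by linarith) hy
    rw [← hsplit] at this
    refine le_trans ?_ this
    have hy0 : 0 < |s.im| := by linarith
    calc min (b / 2) (‖riemannZeta₁ z‖ / 2) * (1 + |s.im|) ^ (1 - 16 * ε)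
        ≤ b / 2 * (2 * |s.im|) ^ (1 - 16 * ε) := by
          gcongr
          · exact min_le_left _ _
          · linarith
          · linarith
      _ = b / 2 * 2 ^ (1 - 16 * ε) * |s.im| ^ (1 - 16 * ε) := by
          rw [Real.mul_rpow (by norm_num) hy0.le]; ring
      _ ≤ b / 2 * 2 * |s.im| ^ (1 - 16 * ε) := by
          gcongr
          calc (2 : ℝ) ^ (1 - 16 * ε) ≤ 2 ^ (1 : ℝ) :=
              Real.rpow_le_rpow_of_exponent_le (by norm_num) (by linarith)
          _ = 2 := by simp
      _ = _ := by ring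
  · push Not at hy
    have hm : ‖riemannZeta₁ z‖ ≤ ‖riemannZeta₁ s‖ := hmin (by
      rw [abs_lt] at hy
      exact ⟨⟨hs.le, hs2⟩, ⟨by linarith [hy.1], by linarith [hy.2]⟩⟩)
    refine le_trans ?_ hm
    calc min (b / 2) (‖riemannZeta₁ z‖ / 2) * (1 + |s.im|) ^ (1 - 16 * ε)
        ≤ ‖riemannZeta₁ z‖ / 2 * 2 ^ (1 : ℝ) := by
          gcongr
          · exact min_le_right _ _
          · calc (1 + |s.im|) ^ (1 - 16 * ε) ≤ 2 ^ (1 - 16 * ε) := by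
                  gcongr <;> linarith
              _ ≤ _ := Real.rpow_le_rpow_of_exponent_le (by norm_num) (by linarith)
      _ = _ := by simp


lemma one_add_im_le {s w : ℂ} (h : ‖w - s‖ ≤ 1) : 1 + |w.im| ≤ 2 * (1 + |s.im|) := by
  have h1 : |w.im - s.im| ≤ 1 := by
    have := Complex.abs_im_le_norm (w - s)
    rw [Complex.sub_im] at this
    linarith
  have h2 : |w.im| ≤ |w.im - s.im| + |s.im| := by
    have := abs_add_le (w.im - s.im) s.im
    simpa using this
  linarith [abs_nonneg s.im]

lemma re_near {s w : ℂ} {r : ℝ} (h : ‖w - s‖ ≤ r) : s.re - r ≤ w.re ∧ w.re ≤ s.re + r := by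
  have := Complex.abs_re_le_norm (w - s)
  rw [Complex.sub_re] at this
  have := abs_le.1 (this.trans h)
  constructor <;> linarith

lemma Z_disc {ε : ℝ} (hε : 0 < ε) (hε1 : ε < 1 / 16) :
    ∃ a b : ℝ, 0 < a ∧ a ≤ ε ∧ 0 < b ∧ ∀ s : ℂ, 1 < s.re → s.re ≤ 2 → ∀ w : ℂ,
      ‖w - s‖ ≤ a * (1 + |s.im|) ^ (-20 * ε) →
      b * (1 + |s.im|) ^ (1 - 16 * ε) ≤ ‖riemannZeta₁ w‖ := by
  obtain ⟨b, hb, hlow⟩ := Z_lower hε hε1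
  obtain ⟨C, hC, hup⟩ := Z_bounds hε (by linarith)
  set K := C * 2 ^ (1 + 4 * ε) with hK
  have hKp : 0 < K := by positivity
  refine ⟨min ε (b / (2 * K)), b / 2, by positivity, min_le_left _ _, by positivity, ?_⟩
  intro s hs hs2 w hw
  set a := min ε (b / (2 * K)) with ha
  have ha0 : 0 < a := by positivity
  have haε : a ≤ ε := min_le_left _ _
  have haK : K * a ≤ b / 2 := by
    have : a ≤ b / (2 * K) := min_le_right _ _
    rw [le_div_iff₀ (by positivity)] at this
    linarith
  set r := a * (1 + |s.im|) ^ (-20 * ε) with hr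
  have h1 : (1 : ℝ) ≤ 1 + |s.im| := by linarith [abs_nonneg s.im]
  have hra : r ≤ a := by
    have : (1 + |s.im|) ^ (-20 * ε) ≤ 1 := Real.rpow_le_one_of_one_le_of_nonpos h1 (by linarith)
    rw [hr]; nlinarith
  have hmv := Convex.norm_image_sub_le_of_norm_deriv_le (f := riemannZeta₁) (𝕜 := ℂ)
      (s := Metric.closedBall s r) (x := s)
      (y := w) (C := C * (2 * (1 + |s.im|)) ^ (1 + 4 * ε))
      (fun w _ => differentiable_riemannZeta₁ w)
      (fun v hv => by
        have hv' : ‖v - s‖ ≤ r := by simpa [dist_eq_norm] using hv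
        have hre := re_near hv'
        refine (hup v (by linarith) (by linarith)).2.trans ?_
        gcongr
        exact one_add_im_le (by linarith))
      (convex_closedBall _ _)
      (Metric.mem_closedBall_self (by positivity))
      (by simpa [dist_eq_norm] using hw)
  have e : C * (2 * (1 + |s.im|)) ^ (1 + 4 * ε) * ‖w - s‖ ≤ b / 2 * (1 + |s.im|) ^ (1 - 16 * ε) := by
    calc _ ≤ C * (2 * (1 + |s.im|)) ^ (1 + 4 * ε) * r := by gcongr
      _ = K * a * (1 + |s.im|) ^ (1 - 16 * ε) := by
        have e : (1 + |s.im|) ^ (1 - 16 * ε) = (1 + |s.im|) ^ (1 + 4 * ε) * (1 + |s.im|) ^ (-20 * ε) := by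
          rw [← Real.rpow_add (by linarith)]; congr 1; ring
        rw [Real.mul_rpow (by norm_num) (by linarith), hr, hK, e]
        ring
      _ ≤ _ := by gcongr
  have e3 := norm_sub_norm_le (riemannZeta₁ s) (riemannZeta₁ w)
  rw [norm_sub_rev] at e3
  have := hlow s hs hs2
  linarith

lemma cauchy_bd (g : ℂ → ℂ) (hg : ∀ w, riemannZeta₁ w ≠ 0 → DifferentiableAt ℂ g w)
    (hb : ∀ ε : ℝ, 0 < ε → ε < 1 / 16 → ∃ C : ℝ, 0 < C ∧ ∀ w : ℂ, 1 - ε ≤ w.re → w.re ≤ 3 →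
      riemannZeta₁ w ≠ 0 → ‖g w‖ ≤ C * (1 + |w.im|) ^ (1 + 8 * ε) / ‖riemannZeta₁ w‖) (k : ℕ) :
    ∃ C : ℝ, 0 < C ∧ ∀ s : ℂ, 1 < s.re → s.re ≤ 2 →
      ‖iteratedDeriv k g s‖ ≤ C * (1 + |s.im|) ^ (1 / 2 : ℝ) := by
  set ε : ℝ := 1 / (2 * (24 + 20 * k)) with hε
  have hε0 : 0 < ε := by positivity
  have hεe : ε * (24 + 20 * k) = 1 / 2 := by rw [hε]; field_simp
  have hε1 : ε < 1 / 16 := by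
    have : (0 : ℝ) ≤ ε * (20 * k) := by positivity
    linarith
  obtain ⟨a, b, ha, haε, hb0, hdisc⟩ := Z_disc hε0 hε1
  obtain ⟨C, hC, hgb⟩ := hb ε hε0 hε1
  refine ⟨k.factorial * (C * 2 ^ (1 + 8 * ε) / b) / a ^ k, by positivity, ?_⟩
  intro s hs hs2
  set T := 1 + |s.im| with hT
  have h1 : (1 : ℝ) ≤ T := by linarith [abs_nonneg s.im]
  have hT0 : 0 < T := by linarith
  set r := a * T ^ (-20 * ε) with hr
  have hr0 : 0 < r := by positivity
  have hra : r ≤ a := by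
    have : T ^ (-20 * ε) ≤ 1 := Real.rpow_le_one_of_one_le_of_nonpos h1 (by linarith)
    rw [hr]; nlinarith
  have hne : ∀ w : ℂ, ‖w - s‖ ≤ r → riemannZeta₁ w ≠ 0 := by
    intro w hw
    have := hdisc s hs hs2 w hw
    have h2 : 0 < b * (1 + |s.im|) ^ (1 - 16 * ε) := by positivity
    exact norm_pos_iff.1 (by linarith)
  have hd : DiffContOnCl ℂ g (Metric.ball s r) := by
    refine DifferentiableOn.diffContOnCl (fun w hw => (hg w (hne w ?_)).differentiableWithinAt)
    rw [closure_ball _ hr0.ne'] at hw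
    simpa [dist_eq_norm] using hw
  have := Complex.norm_iteratedDeriv_le_of_forall_mem_sphere_norm_le (c := s) (R := r)
    (C := C * 2 ^ (1 + 8 * ε) / b * T ^ (24 * ε)) k hr0 hd (by
      intro w hw
      have hw' : ‖w - s‖ ≤ r := by
        have : ‖w - s‖ = r := by simpa [dist_eq_norm] using hw
        exact this.le
      have hre := re_near hw'
      refine (hgb w (by linarith) (by linarith) (hne w hw')).trans ?_
      have hlow := hdisc s hs hs2 w hw'
      calc C * (1 + |w.im|) ^ (1 + 8 * ε) / ‖riemannZeta₁ w‖
          ≤ C * (2 * T) ^ (1 + 8 * ε) / (b * T ^ (1 - 16 * ε)) := by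
            gcongr
            exact one_add_im_le (by linarith)
        _ = _ := by
            have e : T ^ (1 + 8 * ε) = T ^ (24 * ε) * T ^ (1 - 16 * ε) := by
              rw [← Real.rpow_add hT0]; congr 1; ring
            rw [Real.mul_rpow (by norm_num) hT0.le, e]
            field_simp)
  refine this.trans (le_of_eq ?_)
  have e : (T ^ (-20 * ε)) ^ k * T ^ (1 / 2 : ℝ) = T ^ (24 * ε) := by
    rw [← Real.rpow_natCast, ← Real.rpow_mul hT0.le, ← Real.rpow_add hT0]
    congr 1
    linarith
  rw [← e, hr, mul_pow]
  field_simp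

lemma g1_bd (k : ℕ) : ∃ C : ℝ, 0 < C ∧ ∀ s : ℂ, 1 < s.re → s.re ≤ 2 →
      ‖iteratedDeriv k (fun w => (w - 1) / riemannZeta₁ w) s‖ ≤ C * (1 + |s.im|) ^ (1 / 2 : ℝ) := by
  apply cauchy_bd
  · intro w hw
    exact (differentiableAt_id.sub_const 1).div (differentiable_riemannZeta₁ w) hw
  · intro ε h0 h1
    refine ⟨4, by norm_num, ?_⟩
    intro w hw hw2 _
    rw [norm_div]
    gcongr
    have h3 : (1 : ℝ) ≤ 1 + |w.im| := by linarith [abs_nonneg w.im]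
    have h4 : (1 + |w.im|) ≤ (1 + |w.im|) ^ (1 + 8 * ε) := by
      conv_lhs => rw [← Real.rpow_one (1 + |w.im|)]
      exact Real.rpow_le_rpow_of_exponent_le h3 (by linarith)
    have h5 := Complex.norm_le_abs_re_add_abs_im (w - 1)
    simp only [Complex.sub_re, Complex.one_re, Complex.sub_im, Complex.one_im, sub_zero] at h5
    have : |w.re - 1| ≤ 2 := by rw [abs_le]; constructor <;> linarith
    linarith

lemma zeta0_bd {ε : ℝ} (h0 : 0 < ε) (h1 : ε < 1 / 16) : ∃ C : ℝ, 0 < C ∧ ∀ w : ℂ, 1 - ε ≤ w.re →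
    w.re ≤ 3 → ‖riemannZeta₀ w‖ ≤ C * (1 + |w.im|) ^ (4 * ε) := by
  obtain ⟨C, hC, hup⟩ := Z_bounds h0 (by linarith)
  have hcomp : IsCompact (Set.Icc (0 : ℝ) 3 ×ℂ Set.Icc (-1 : ℝ) 1) :=
    isCompact_Icc.reProdIm isCompact_Icc
  obtain ⟨D, hD⟩ := hcomp.exists_bound_of_continuousOn
    (differentiable_riemannZeta₀.continuous.continuousOn)
  refine ⟨max (2 * (C + 1)) D, by positivity, ?_⟩
  intro w hw hw2
  have h3 : (1 : ℝ) ≤ 1 + |w.im| := by linarith [abs_nonneg w.im]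
  by_cases him : |w.im| ≤ 1
  · have := hD w ⟨⟨by linarith, hw2⟩, abs_le.1 him⟩
    have h4 : 1 ≤ (1 + |w.im|) ^ (4 * ε) := Real.one_le_rpow h3 (by linarith)
    have h5 : D ≤ max (2 * (C + 1)) D := le_max_right _ _
    have h6 : 0 < max (2 * (C + 1)) D := by positivity
    nlinarith
  · push Not at him
    have hz : riemannZeta₁ w = 1 + (w - 1) * riemannZeta₀ w := by
      by_cases hw1 : w = 1
      · simp [hw1]
      have a1 := riemannZeta_eq_inv_sub_mul hw1
      have a2 := riemannZeta_eq_inv_sub_add hw1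
      have : w - 1 ≠ 0 := sub_ne_zero.2 hw1
      rw [a1] at a2
      field_simp at a2
      rw [a2]
    have hn : |w.im| ≤ ‖w - 1‖ := by
      have := Complex.abs_im_le_norm (w - 1)
      simpa using this
    have h7 : ‖w - 1‖ * ‖riemannZeta₀ w‖ ≤ (C + 1) * (1 + |w.im|) ^ (1 + 4 * ε) := by
      rw [← norm_mul, show (w - 1) * riemannZeta₀ w = riemannZeta₁ w - 1 by rw [hz]; ring]
      have := norm_sub_le (riemannZeta₁ w) 1
      have h8 := (hup w hw hw2).1
      have h4 : 1 ≤ (1 + |w.im|) ^ (1 + 4 * ε) := Real.one_le_rpow h3 (by linarith)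
      rw [norm_one] at this
      linarith
    have h9 : (1 + |w.im|) / 2 * ‖riemannZeta₀ w‖ ≤ (C + 1) * (1 + |w.im|) ^ (1 + 4 * ε) := by
      refine le_trans ?_ h7
      gcongr
      linarith
    rw [Real.rpow_add (by linarith), Real.rpow_one] at h9
    have h10 : ‖riemannZeta₀ w‖ ≤ 2 * (C + 1) * (1 + |w.im|) ^ (4 * ε) := by
      have : (1 + |w.im|) * ‖riemannZeta₀ w‖ ≤ (1 + |w.im|) * (2 * (C + 1) * (1 + |w.im|) ^ (4 * ε)) := by
        linarith
      exact le_of_mul_le_mul_left this (by linarith)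
    refine h10.trans ?_
    gcongr
    exact le_max_left _ _

lemma g2_bd (k : ℕ) : ∃ C : ℝ, 0 < C ∧ ∀ s : ℂ, 1 < s.re → s.re ≤ 2 →
      ‖iteratedDeriv k (fun w => - deriv riemannZeta₁ w / riemannZeta₁ w - riemannZeta₀ w) s‖
        ≤ C * (1 + |s.im|) ^ (1 / 2 : ℝ) := by
  apply cauchy_bd
  · intro w hw
    have h1 : DifferentiableAt ℂ (deriv riemannZeta₁) w :=
      (differentiable_riemannZeta₁.deriv) w
    exact ((h1.neg).div (differentiable_riemannZeta₁ w) hw).sub (differentiable_riemannZeta₀ w)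
  · intro ε h0 h1
    obtain ⟨C, hC, hup⟩ := Z_bounds h0 (by linarith)
    obtain ⟨D, hD, hz0⟩ := zeta0_bd h0 h1
    refine ⟨C + D * C, by positivity, ?_⟩
    intro w hw hw2 hne
    have hnp : 0 < ‖riemannZeta₁ w‖ := norm_pos_iff.2 hne
    have h3 : (1 : ℝ) ≤ 1 + |w.im| := by linarith [abs_nonneg w.im]
    obtain ⟨u1, u2⟩ := hup w hw hw2
    have u3 := hz0 w hw hw2
    rw [le_div_iff₀ hnp]
    refine (mul_le_mul_of_nonneg_right (norm_sub_le _ _) hnp.le).trans ?_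
    rw [norm_div, norm_neg, add_mul, div_mul_cancel₀ _ hnp.ne', add_mul]
    refine add_le_add (u2.trans ?_) ?_
    · gcongr
      norm_num
    · calc _ ≤ (D * (1 + |w.im|) ^ (4 * ε)) * (C * (1 + |w.im|) ^ (1 + 4 * ε)) := by gcongr
        _ = D * C * ((1 + |w.im|) ^ (4 * ε) * (1 + |w.im|) ^ (1 + 4 * ε)) := by ring
        _ = D * C * (1 + |w.im|) ^ (1 + 8 * ε) := by
          rw [← Real.rpow_add (by linarith)]; congr 2; ring
        _ ≤ _ := le_rfl


open MeasureTheory in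
lemma kern_bd {σ : ℝ} (hσ : 1 ≤ σ) (t : ℝ) :
    ‖(1 / ((σ + t * Complex.I) * (σ + t * Complex.I + 1)) : ℂ)‖ ≤ 2 * (1 + |t|) ^ (-2 : ℝ) := by
  have hn1 : ‖(σ + t * Complex.I : ℂ)‖ ^ 2 = σ ^ 2 + t ^ 2 := by
    rw [← Complex.normSq_eq_norm_sq, Complex.normSq_add_mul_I]
  have hn2 : ‖(σ + t * Complex.I + 1 : ℂ)‖ ^ 2 = (σ + 1) ^ 2 + t ^ 2 := by
    rw [← Complex.normSq_add_mul_I, Complex.normSq_eq_norm_sq]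
    congr 2; push_cast; ring
  set p := ‖(σ + t * Complex.I : ℂ)‖
  set q := ‖(σ + t * Complex.I + 1 : ℂ)‖
  have hp : 0 ≤ p := norm_nonneg _
  have hq : 0 ≤ q := norm_nonneg _
  have hpq : p ≤ q := by
    apply le_of_sq_le_sq _ hq |> fun h => h
    rw [hn1, hn2]; nlinarith
  have h1 : 1 + t ^ 2 ≤ p * q := by
    have : p ^ 2 ≤ p * q := by rw [sq]; gcongr
    nlinarith
  rw [norm_div, norm_one, norm_mul, Real.rpow_neg (by positivity),
    show (2 : ℝ) = ((2 : ℕ) : ℝ) by norm_num, Real.rpow_natCast, ← div_eq_mul_inv]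
  have h0 : 0 < p * q := by nlinarith [sq_nonneg t]
  rw [div_le_div_iff₀ h0 (by positivity)]
  push_cast
  have := sq_abs t
  nlinarith [sq_nonneg (1 - |t|)]

open MeasureTheory in
lemma kern_int {σ : ℝ} (hσ : 1 ≤ σ) :
    Integrable (fun t : ℝ => (1 / ((σ + t * Complex.I) * (σ + t * Complex.I + 1)) : ℂ)) := by
  refine Integrable.mono' (g := fun t : ℝ => 2 * (1 + |t|) ^ (-2 : ℝ)) ?_ ?_ ?_
  · have := integrable_one_add_norm (E := ℝ) (μ := volume) (r := 2) (by simp)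
    exact (this.const_mul 2)
  · apply Continuous.aestronglyMeasurable
    apply Continuous.div continuous_const (by fun_prop)
    intro t h
    rcases mul_eq_zero.1 h with h | h
    · have := congrArg Complex.re h
      simp at this; linarith
    · have := congrArg Complex.re h
      simp at this; linarith
  · exact Eventually.of_forall (fun t => kern_bd hσ t)

open MeasureTheory in
lemma perron {σ : ℝ} (hσ : 1 ≤ σ) {u : ℝ} (hu : 0 < u) :
    ∫ t : ℝ, (u : ℂ) ^ (-(σ + t * Complex.I)) * (1 / ((σ + t * Complex.I) * (σ + t * Complex.I + 1)) : ℂ)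
      = 2 * Real.pi * ((max (1 - u) 0 : ℝ) : ℂ) := by
  set f : ℝ → ℂ := fun t => (Set.Ioc (0 : ℝ) 1).indicator (fun _ => 1) t -
    (Set.Ioc (0 : ℝ) 1).indicator (fun t : ℝ => (t : ℂ) ^ (1 : ℂ)) t with hf
  have hM : ∀ s : ℂ, 1 ≤ s.re → HasMellin f s (1 / (s * (s + 1))) := by
    intro s hs
    have h1 := hasMellin_one_Ioc (s := s) (by linarith)
    have h2 := hasMellin_cpow_Ioc 1 (s := s) (by simp; linarith)
    have h3 := hasMellin_sub h1.1 h2.1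
    rw [h1.2, h2.2] at h3
    have a1 : s ≠ 0 := by rintro rfl; simp at hs; linarith
    have a2 : s + 1 ≠ 0 := by
      intro h
      have := congrArg Complex.re h
      simp at this; linarith
    have e : (1 : ℂ) / (s * (s + 1)) = 1 / s - 1 / (s + 1) := by
      rw [div_sub_div _ _ a1 a2]
      congr 1
      ring
    rw [e]
    exact h3
  have hmel : ∀ t : ℝ, mellin f (σ + t * Complex.I) = 1 / ((σ + t * Complex.I) * (σ + t * Complex.I + 1)) :=
    fun t => (hM _ (by simpa using hσ)).2
  have hfe : ∀ t : ℝ, 0 < t → f t = ((max (1 - t) 0 : ℝ) : ℂ) := by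
    intro t ht
    rw [hf]
    by_cases h : t ≤ 1
    · have hm : t ∈ Set.Ioc (0 : ℝ) 1 := ⟨ht, h⟩
      simp only [Set.indicator_of_mem hm]
      rw [max_eq_left (by linarith)]
      simp
    · have hm : t ∉ Set.Ioc (0 : ℝ) 1 := fun h' => h h'.2
      simp only [Set.indicator_of_notMem hm]
      rw [max_eq_right (by linarith)]
      simp
  have hinv := mellinInv_mellin_eq σ f hu ((hM σ (by simpa using hσ)).1) (by
      unfold Complex.VerticalIntegrable
      simp_rw [hmel]
      exact kern_int hσ) (by
      have : ContinuousAt (fun t : ℝ => ((max (1 - t) 0 : ℝ) : ℂ)) u := by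
        apply Continuous.continuousAt
        fun_prop
      refine this.congr ?_
      filter_upwards [lt_mem_nhds hu] with t ht using (hfe t ht).symm)
  rw [hfe u hu] at hinv
  unfold mellinInv at hinv
  simp_rw [hmel, smul_eq_mul] at hinv
  rw [← hinv]
  have : (Real.pi : ℂ) ≠ 0 := by exact_mod_cast Real.pi_ne_zero
  rw [Complex.real_smul]
  push_cast
  rw [← mul_assoc, mul_one_div_cancel (by simpa using this), one_mul]

open MeasureTheory in
lemma riesz {σ : ℝ} (hσ : 1 ≤ σ) (d : ℕ → ℂ) (hd : LSeriesSummable d σ) {C : ℝ}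
    (hC : ∀ t : ℝ, ‖LSeries d (σ + t * Complex.I)‖ ≤ C * (1 + |t|) ^ (1 / 2 : ℝ)) {x : ℝ} (hx : 0 < x) :
    ‖∑ n ∈ Icc 1 ⌊x⌋₊, d n * ((1 - n / x : ℝ) : ℂ)‖ ≤
      C * (∫ t : ℝ, (1 + ‖t‖) ^ (-(3 / 2 : ℝ))) * x ^ σ := by
  set s : ℝ → ℂ := fun t => σ + t * Complex.I with hs
  set K : ℝ → ℂ := fun t => 1 / ((σ + t * Complex.I) * (σ + t * Complex.I + 1)) with hK
  set F : ℕ → ℝ → ℂ := fun n t => LSeries.term d (s t) n * ((x : ℂ) ^ (s t)) * K t with hF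
  have hxn : ∀ t, ‖(x : ℂ) ^ (s t)‖ = x ^ σ := by
    intro t
    rw [Complex.norm_cpow_eq_rpow_re_of_pos hx]
    simp [hs]
  have htn : ∀ n t, ‖LSeries.term d (s t) n‖ = ‖LSeries.term d (σ : ℂ) n‖ := by
    intro n t
    rw [LSeries.norm_term_eq, LSeries.norm_term_eq]
    simp [hs]
  have hnorm : ∀ n t, ‖F n t‖ = ‖LSeries.term d (σ : ℂ) n‖ * x ^ σ * ‖K t‖ := by
    intro n t
    rw [hF]; simp only
    rw [norm_mul, norm_mul, hxn, htn]
  have hcont : ∀ n, Continuous (fun t => LSeries.term d (s t) n * ((x : ℂ) ^ (s t))) := by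
    intro n
    apply Continuous.mul
    · rcases Nat.eq_zero_or_pos n with h | h
      · simp [h, LSeries.term_zero, continuous_const]
      · have : (fun t => LSeries.term d (s t) n) = fun t => d n * (n : ℂ) ^ (-(s t)) := by
          ext t
          rw [LSeries.term_of_ne_zero h.ne', Complex.cpow_neg, div_eq_mul_inv]
        rw [this]
        apply continuous_const.mul
        have : (n : ℂ) ≠ 0 := by exact_mod_cast h.ne'
        refine Continuous.const_cpow (by fun_prop) (Or.inl this)
    · refine Continuous.const_cpow (by fun_prop) (Or.inl (by exact_mod_cast hx.ne'))
  have hKi : Integrable K := kern_int hσ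
  have hFi : ∀ n, Integrable (F n) := by
    intro n
    refine Integrable.mono' (g := fun t => ‖LSeries.term d (σ : ℂ) n‖ * x ^ σ * ‖K t‖)
      (hKi.norm.const_mul _) ?_ ?_
    · exact (hcont n).aestronglyMeasurable.mul hKi.aestronglyMeasurable
    · exact Eventually.of_forall (fun t => (hnorm n t).le)
  have hsum := hasSum_integral_of_summable_integral_norm hFi (by
    simp_rw [hnorm, integral_const_mul]
    exact (hd.norm.mul_right _).mul_right _)
  have hFint : ∀ n, ∫ t, F n t = if 1 ≤ n then d n * (2 * Real.pi * ((max (1 - n / x) 0 : ℝ) : ℂ)) else 0 := by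
    intro n
    split_ifs with h
    · have hn : (0 : ℝ) < n := by exact_mod_cast h
      rw [← perron hσ (div_pos hn hx), ← integral_const_mul]
      congr 1
      ext t
      rw [hF]; simp only
      rw [LSeries.term_of_ne_zero (by omega), ← mul_assoc]
      congr 1
      rw [show ((σ : ℂ) + t * Complex.I) = s t from rfl]
      rw [div_eq_mul_inv (n : ℝ) x, Complex.ofReal_mul,
        Complex.mul_cpow_ofReal_nonneg hn.le (by positivity), Complex.cpow_neg, Complex.ofReal_inv,
        Complex.inv_cpow _ _ (by rw [Complex.arg_ofReal_of_nonneg hx.le]; exact Real.pi_pos.ne),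
        Complex.cpow_neg, inv_inv]
      push_cast
      ring
    · have : n = 0 := by omega
      subst this
      simp [hF]
  simp_rw [hFint] at hsum
  have htsum : ∀ t, ∑' n, F n t = LSeries d (s t) * ((x : ℂ) ^ (s t)) * K t := by
    intro t
    rw [hF]; simp only
    rw [tsum_mul_right, tsum_mul_right]; rfl
  simp_rw [htsum] at hsum
  have hfin : HasSum (fun n : ℕ => if 1 ≤ n then d n * (2 * Real.pi * ((max (1 - n / x) 0 : ℝ) : ℂ)) else 0)
      (∑ n ∈ Icc 1 ⌊x⌋₊, d n * (2 * Real.pi * ((1 - n / x : ℝ) : ℂ))) := by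
    have := hasSum_sum_of_ne_finset_zero (L := SummationFilter.unconditional ℕ) (s := Icc 1 ⌊x⌋₊)
      (f := fun n : ℕ => if 1 ≤ n then d n * (2 * Real.pi * ((max (1 - n / x) 0 : ℝ) : ℂ)) else 0) (by
        intro n hn
        rw [Finset.mem_Icc, not_and] at hn
        split_ifs with h
        · have h2 := hn h
          have : x < n := by
            rw [not_le] at h2
            exact (Nat.floor_lt hx.le).1 h2
          rw [max_eq_right]
          · simp
          · rw [sub_nonpos, one_le_div hx]; exact this.le
        · rfl)
    convert this using 1
    apply Finset.sum_congr rfl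
    intro n hn
    rw [Finset.mem_Icc] at hn
    rw [if_pos hn.1, max_eq_left]
    rw [sub_nonneg, div_le_one hx]
    exact (Nat.le_floor_iff hx.le).1 hn.2
  have heq := hfin.unique hsum
  have hb : ‖∫ t, LSeries d (s t) * ((x : ℂ) ^ (s t)) * K t‖ ≤
      ∫ t : ℝ, (C * x ^ σ * 2) * (1 + ‖t‖) ^ (-(3 / 2 : ℝ)) := by
    apply norm_integral_le_of_norm_le
    · apply Integrable.const_mul
      exact integrable_one_add_norm (by simp; norm_num)
    · refine Eventually.of_forall (fun t => ?_)
      rw [norm_mul, norm_mul, hxn]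
      have e : (1 + ‖t‖) ^ (-(3 / 2 : ℝ)) = (1 + |t|) ^ (1 / 2 : ℝ) * (1 + |t|) ^ (-2 : ℝ) := by
        rw [← Real.rpow_add (by positivity), Real.norm_eq_abs]; norm_num
      rw [e]
      calc _ ≤ (C * (1 + |t|) ^ (1 / 2 : ℝ)) * x ^ σ * (2 * (1 + |t|) ^ (-2 : ℝ)) := by
            gcongr
            · exact mul_nonneg ((norm_nonneg _).trans (hC t)) (by positivity)
            · exact hC t
            · exact kern_bd hσ t
        _ = _ := by ring
  rw [← heq, integral_const_mul] at hb
  have e2 : ∑ n ∈ Icc 1 ⌊x⌋₊, d n * (2 * Real.pi * ((1 - n / x : ℝ) : ℂ)) =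
      ((2 * Real.pi : ℝ) : ℂ) * ∑ n ∈ Icc 1 ⌊x⌋₊, d n * ((1 - n / x : ℝ) : ℂ) := by
    rw [Finset.mul_sum]
    apply Finset.sum_congr rfl
    intro n _
    push_cast; ring
  rw [e2, norm_mul, Complex.norm_real, Real.norm_eq_abs, abs_of_pos (by positivity)] at hb
  have h3 := Real.pi_gt_three
  set S := ‖∑ n ∈ Icc 1 ⌊x⌋₊, d n * ((1 - n / x : ℝ) : ℂ)‖
  have hS : 0 ≤ S := norm_nonneg _
  nlinarith


lemma logMul_iter (f : ℕ → ℂ) (k n : ℕ) :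
    (LSeries.logMul^[k] f) n = (Complex.log n) ^ k * f n := by
  induction k generalizing f with
  | zero => simp
  | succ k ih =>
    rw [Function.iterate_succ_apply, ih]
    simp only [LSeries.logMul]
    ring

lemma riesz_good (c : ℕ → ℝ) (g : ℂ → ℂ)
    (hs : ∀ s : ℂ, 1 < s.re → LSeriesSummable (fun n => (c n : ℂ)) s)
    (hL : ∀ s : ℂ, 1 < s.re → LSeries (fun n => (c n : ℂ)) s = g s)
    (hg : ∀ k : ℕ, ∃ C : ℝ, 0 < C ∧ ∀ s : ℂ, 1 < s.re → s.re ≤ 2 →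
      ‖iteratedDeriv k g s‖ ≤ C * (1 + |s.im|) ^ (1 / 2 : ℝ)) (k : ℕ) :
    ∃ C : ℝ, 0 < C ∧ ∀ x : ℝ, 3 ≤ x →
      |∑ n ∈ Icc 1 ⌊x⌋₊, c n * Real.log n ^ k * (1 - n / x)| ≤ C * x := by
  obtain ⟨C, hC, hb⟩ := hg k
  set I : ℝ := ∫ t : ℝ, (1 + ‖t‖) ^ (-(3 / 2 : ℝ)) with hI
  have hI0 : 0 ≤ I := MeasureTheory.integral_nonneg (fun t => by positivity)
  refine ⟨C * I * Real.exp 1 + 1, by positivity, ?_⟩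
  intro x hx
  have hlog : 1 ≤ Real.log x := by
    rw [Real.le_log_iff_exp_le (by linarith)]
    have := Real.exp_one_lt_d9
    linarith
  set σ : ℝ := 1 + 1 / Real.log x with hσ
  have hσ1 : 1 < σ := by
    have : 0 < 1 / Real.log x := by positivity
    linarith
  have hσ2 : σ ≤ 2 := by
    have : 1 / Real.log x ≤ 1 := by rw [div_le_one (by linarith)]; exact hlog
    linarith
  have habs : ∀ s : ℂ, 1 < s.re → LSeries.abscissaOfAbsConv (fun n => (c n : ℂ)) < s.re := by
    intro s h1
    refine lt_of_le_of_lt (LSeries.abscissaOfAbsConv_le_of_forall_lt_LSeriesSummable' (x := 1) ?_)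
      (by exact_mod_cast h1)
    intro y hy
    exact hs y (by simpa using (by exact_mod_cast hy : 1 < y))
  have hder : ∀ s : ℂ, 1 < s.re →
      iteratedDeriv k g s = (-1) ^ k * LSeries (LSeries.logMul^[k] (fun n => (c n : ℂ))) s := by
    intro s h1
    rw [← LSeries_iteratedDeriv k (habs s h1)]
    apply Filter.EventuallyEq.iteratedDeriv_eq
    filter_upwards [(isOpen_lt continuous_const Complex.continuous_re).mem_nhds h1] with w hw
      using (hL w hw).symm
  have hσs : (1 : ℝ) < (σ : ℂ).re := by simpa using hσ1
  have hmain := riesz (σ := σ) hσ1.le (LSeries.logMul^[k] (fun n => (c n : ℂ)))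
    (by
      apply LSeriesSummable_of_abscissaOfAbsConv_lt_re
      rw [LSeries.absicssaOfAbsConv_logPowMul]
      exact habs σ hσs) (C := C)
    (by
      intro t
      have h1 : 1 < (σ + t * Complex.I : ℂ).re := by simpa using hσ1
      have := hb (σ + t * Complex.I) h1 (by simpa using hσ2)
      rw [hder _ h1, norm_mul, norm_pow, norm_neg, norm_one, one_pow, one_mul] at this
      simpa using this) (x := x) (by linarith)
  have e1 : ∑ n ∈ Icc 1 ⌊x⌋₊, (LSeries.logMul^[k] (fun n => (c n : ℂ))) n * ((1 - n / x : ℝ) : ℂ) =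
      ((∑ n ∈ Icc 1 ⌊x⌋₊, c n * Real.log n ^ k * (1 - n / x) : ℝ) : ℂ) := by
    rw [Complex.ofReal_sum]
    apply Finset.sum_congr rfl
    intro n _
    rw [logMul_iter, ← Complex.natCast_log]
    push_cast
    ring
  rw [e1, Complex.norm_real, Real.norm_eq_abs] at hmain
  have e2 : x ^ σ = Real.exp 1 * x := by
    rw [hσ, Real.rpow_add (by linarith), Real.rpow_one, Real.rpow_def_of_pos (by linarith),
      mul_one_div_cancel (by linarith)]
    ring
  rw [e2] at hmain
  linarith

lemma riesz_moebius (k : ℕ) : ∃ C : ℝ, 0 < C ∧ ∀ x : ℝ, 3 ≤ x →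
      |∑ n ∈ Icc 1 ⌊x⌋₊, (ArithmeticFunction.moebius n : ℝ) * Real.log n ^ k * (1 - n / x)| ≤ C * x := by
  apply riesz_good (fun n => (ArithmeticFunction.moebius n : ℝ)) _ _ _ g1_bd
  · intro s hs
    have := (ArithmeticFunction.LSeriesSummable_moebius_iff (s := s)).2 hs
    simpa using this
  · intro s hs
    have h1 := LSeries_one_mul_Lseries_moebius hs
    rw [LSeries_one_eq_riemannZeta hs] at h1
    have hs1 : s ≠ 1 := by rintro rfl; simp at hs
    have hz := riemannZeta_ne_zero_of_one_lt_re hs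
    have h2 := riemannZeta_eq_inv_sub_mul hs1
    have h3 : s - 1 ≠ 0 := sub_ne_zero.2 hs1
    have h4 := Z_ne_zero hs.le
    rw [h2] at h1
    have h5 : (s - 1) / riemannZeta₁ s = ((s - 1)⁻¹ * riemannZeta₁ s)⁻¹ := by
      field_simp
    rw [h5]
    rw [← eq_inv_of_mul_eq_one_right h1]
    congr 1

lemma riesz_mangoldt (k : ℕ) : ∃ C : ℝ, 0 < C ∧ ∀ x : ℝ, 3 ≤ x →
      |∑ n ∈ Icc 1 ⌊x⌋₊, (ArithmeticFunction.vonMangoldt n - 1) * Real.log n ^ k * (1 - n / x)| ≤ C * x := by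
  apply riesz_good (fun n => (ArithmeticFunction.vonMangoldt n - 1 : ℝ)) _ _ _ g2_bd
  · intro s hs
    have h1 := ArithmeticFunction.LSeriesSummable_vonMangoldt hs
    have h2 := LSeriesSummable_one_iff.2 hs
    convert! h1.sub h2 using 1
    ext n; simp
  · intro s hs
    have h1 := ArithmeticFunction.LSeriesSummable_vonMangoldt hs
    have h2 := LSeriesSummable_one_iff.2 hs
    have h3 := LSeries_sub h1 h2
    rw [LSeries_one_eq_riemannZeta hs, ArithmeticFunction.LSeries_vonMangoldt_eq_deriv_riemannZeta_div hs] at h3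
    have e : (fun n : ℕ => ((ArithmeticFunction.vonMangoldt n - 1 : ℝ) : ℂ)) =
        (fun n : ℕ => (ArithmeticFunction.vonMangoldt n : ℂ)) - 1 := by
      ext n; simp
    rw [e, h3]
    have hs1 : s ≠ 1 := by rintro rfl; simp at hs
    have h5 : s - 1 ≠ 0 := sub_ne_zero.2 hs1
    have h4 := Z_ne_zero hs.le
    have hd : deriv riemannZeta s = -(s - 1)⁻¹ ^ 2 * riemannZeta₁ s + (s - 1)⁻¹ * deriv riemannZeta₁ s := by
      have he : riemannZeta =ᶠ[nhds s] fun w => (w - 1)⁻¹ * riemannZeta₁ w := by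
        filter_upwards [isOpen_ne.mem_nhds hs1] with w hw using riemannZeta_eq_inv_sub_mul hw
      rw [he.deriv_eq]
      have a1 : HasDerivAt (fun w : ℂ => (w - 1)⁻¹) (-(s - 1)⁻¹ ^ 2) s := by
        have := ((hasDerivAt_id s).sub_const 1).inv h5
        have e9 : -(s - 1)⁻¹ ^ 2 = -1 / (id s - 1) ^ 2 := by
          simp [div_eq_mul_inv]
        rw [e9]
        exact this
      exact (a1.mul (differentiable_riemannZeta₁ s).hasDerivAt).deriv
    rw [hd]
    nth_rw 2 [riemannZeta_eq_inv_sub_add hs1]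
    rw [riemannZeta_eq_inv_sub_mul hs1]
    field_simp
    ring


lemma log_pow_le (m : ℕ) {x : ℝ} (hx : 1 ≤ x) : Real.log x ^ m ≤ m.factorial * x := by
  have h := Real.pow_div_factorial_le_exp (Real.log x) (Real.log_nonneg hx) m
  rw [Real.exp_log (by linarith), div_le_iff₀ (by positivity)] at h
  linarith

lemma log_pow_le_sqrt (m : ℕ) {x : ℝ} (hx : 1 ≤ x) :
    Real.log x ^ m ≤ (2 * m).factorial * √x := by
  have h := log_pow_le (2 * m) hx
  have h0 := Real.log_nonneg hx
  have h1 : (1 : ℝ) ≤ (2 * m).factorial := by exact_mod_cast Nat.factorial_pos _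
  apply le_of_sq_le_sq _ (by positivity)
  rw [mul_pow, Real.sq_sqrt (by linarith), ← pow_mul, mul_comm m 2]
  refine h.trans ?_
  gcongr
  nlinarith

lemma one_le_log {x : ℝ} (hx : 3 ≤ x) : 1 ≤ Real.log x := by
  rw [Real.le_log_iff_exp_le (by linarith)]
  have := Real.exp_one_lt_d9
  linarith

lemma abel_ineq (d w : ℕ → ℝ) (N M : ℕ) (hNM : N + 1 ≤ M) (K : ℝ)
    (hw : ∀ n, N + 1 ≤ n → w (n + 1) ≤ w n) (hw0 : ∀ n, N + 1 ≤ n → 0 ≤ w n)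
    (hE : ∀ m, N + 1 ≤ m → m ≤ M → |∑ n ∈ Ioc N m, d n| ≤ K) :
    |∑ n ∈ Ioc N M, d n * w n| ≤ K * w (N + 1) := by
  have key : |∑ n ∈ Ioc N M, d n * w n - (∑ n ∈ Ioc N M, d n) * w M| ≤ K * (w (N + 1) - w M) := by
    induction M, hNM using Nat.le_induction with
    | base => simp
    | succ M hM ih =>
      have ih' := ih (fun m h1 h2 => hE m h1 (by omega))
      rw [Finset.sum_Ioc_succ_top (by omega), Finset.sum_Ioc_succ_top (by omega)]
      have e : ∑ n ∈ Ioc N M, d n * w n + d (M + 1) * w (M + 1) -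
          (∑ n ∈ Ioc N M, d n + d (M + 1)) * w (M + 1) =
          (∑ n ∈ Ioc N M, d n * w n - (∑ n ∈ Ioc N M, d n) * w M) +
            (∑ n ∈ Ioc N M, d n) * (w M - w (M + 1)) := by ring
      rw [e]
      refine (abs_add_le _ _).trans ?_
      have h1 : 0 ≤ w M - w (M + 1) := by linarith [hw M hM]
      rw [abs_mul, abs_of_nonneg h1]
      have := mul_le_mul_of_nonneg_right (hE M hM (by omega)) h1
      linarith
  have h2 := mul_le_mul_of_nonneg_right (hE M hNM le_rfl) (hw0 M hNM)
  rw [← abs_of_nonneg (hw0 M hNM), ← abs_mul, abs_of_nonneg (hw0 M hNM)] at h2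
  have h3 := abs_add_le (∑ n ∈ Ioc N M, d n * w n - (∑ n ∈ Ioc N M, d n) * w M)
    ((∑ n ∈ Ioc N M, d n) * w M)
  rw [sub_add_cancel] at h3
  linarith

lemma unsmooth (c : ℕ → ℝ) (hc : ∀ n : ℕ, 1 ≤ n → |c n| ≤ 1 + Real.log n) (m : ℕ) {C : ℝ} (hC : 0 < C)
    (h : ∀ x : ℝ, 3 ≤ x →
      |∑ n ∈ Icc 1 ⌊x⌋₊, c n * Real.log n ^ (2 * m + 1) * (1 - n / x)| ≤ C * x) :
    ∃ K : ℝ, 0 < K ∧ ∀ x : ℝ, 3 ≤ x →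
      |∑ n ∈ Icc 1 ⌊x⌋₊, c n * Real.log n ^ (2 * m + 1)| ≤ K * x * Real.log x ^ (m + 1) := by
  refine ⟨5 * C + (1 + (m + 1).factorial) * (3 * 2 ^ (2 * m + 1)), by positivity, ?_⟩
  intro x hx
  set L := Real.log x with hL
  have hL1 : 1 ≤ L := one_le_log hx
  set k := 2 * m + 1 with hk
  set d : ℕ → ℝ := fun n => c n * Real.log n ^ k with hd
  set t := x / L ^ (m + 1) with ht
  have hLp : 1 ≤ L ^ (m + 1) := one_le_pow₀ hL1
  have ht0 : 0 < t := by positivity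
  have htx : t ≤ x := div_le_self (by linarith) hLp
  have hA : ∀ y : ℝ, 3 ≤ y → |∑ n ∈ Icc 1 ⌊y⌋₊, d n * (y - n)| ≤ C * y ^ 2 := by
    intro y hy
    have := h y hy
    have e : ∑ n ∈ Icc 1 ⌊y⌋₊, d n * (y - n) = y * ∑ n ∈ Icc 1 ⌊y⌋₊, c n * Real.log n ^ k * (1 - n / y) := by
      rw [Finset.mul_sum]
      apply Finset.sum_congr rfl
      intro n _
      simp only [hd]
      field_simp
    rw [e, abs_mul, abs_of_pos (by linarith)]
    nlinarith
  have h1 := hA x hx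
  have h2 := hA (x + t) (by linarith)
  have hfl : ⌊x⌋₊ ≤ ⌊x + t⌋₊ := Nat.floor_mono (by linarith)
  have hsplit : ∑ n ∈ Icc 1 ⌊x + t⌋₊, d n * (x + t - n) =
      ∑ n ∈ Icc 1 ⌊x⌋₊, d n * (x - n) + t * ∑ n ∈ Icc 1 ⌊x⌋₊, d n +
        ∑ n ∈ Ioc ⌊x⌋₊ ⌊x + t⌋₊, d n * (x + t - n) := by
    have : Icc 1 ⌊x + t⌋₊ = Icc 1 ⌊x⌋₊ ∪ Ioc ⌊x⌋₊ ⌊x + t⌋₊ := by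
      ext n; simp only [mem_Icc, mem_union, mem_Ioc]; omega
    rw [this, Finset.sum_union]
    · rw [Finset.mul_sum, ← Finset.sum_add_distrib]
      congr 1
      apply Finset.sum_congr rfl
      intro n _; ring
    · rw [Finset.disjoint_left]; intro n; simp only [mem_Icc, mem_Ioc]; omega
  have h3 : |∑ n ∈ Ioc ⌊x⌋₊ ⌊x + t⌋₊, d n * (x + t - n)| ≤ (t + 1) * ((3 * L) * (2 * L) ^ k * t) := by
    calc _ ≤ ∑ n ∈ Ioc ⌊x⌋₊ ⌊x + t⌋₊, ((3 * L) * (2 * L) ^ k * t) := by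
          refine (Finset.abs_sum_le_sum_abs _ _).trans (Finset.sum_le_sum ?_)
          intro n hn
          rw [mem_Ioc] at hn
          have hn1 : x < n := (Nat.floor_lt (by linarith)).1 hn.1
          have hn2 : (n : ℝ) ≤ x + t := (Nat.le_floor_iff (by linarith)).1 hn.2
          have hnn : 1 ≤ n := by omega
          have hlogn : Real.log n ≤ 2 * L := by
            have : Real.log n ≤ Real.log (x * x) :=
              Real.log_le_log (by linarith) (by nlinarith)
            rw [Real.log_mul (by linarith) (by linarith)] at this
            linarith
          have hlogn0 : 0 ≤ Real.log n := Real.log_natCast_nonneg n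
          simp only [hd]
          rw [abs_mul, abs_mul, abs_pow, abs_of_nonneg hlogn0, abs_of_nonneg (by linarith : 0 ≤ x + t - n)]
          gcongr
          · exact (hc n hnn).trans (by linarith)
          · linarith
      _ = (⌊x + t⌋₊ - ⌊x⌋₊ : ℕ) * ((3 * L) * (2 * L) ^ k * t) := by
          rw [Finset.sum_const, Nat.card_Ioc, nsmul_eq_mul]
      _ ≤ _ := by
          gcongr
          rw [Nat.cast_sub hfl]
          have a1 := Nat.floor_le (by linarith : 0 ≤ x + t)
          have a2 := Nat.lt_floor_add_one x
          linarith
  have h4 : t * |∑ n ∈ Icc 1 ⌊x⌋₊, d n| ≤ 5 * C * x ^ 2 + (t + 1) * ((3 * L) * (2 * L) ^ k * t) := by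
    rw [← abs_of_pos ht0, ← abs_mul, abs_of_pos ht0]
    have e : t * ∑ n ∈ Icc 1 ⌊x⌋₊, d n = ∑ n ∈ Icc 1 ⌊x + t⌋₊, d n * (x + t - n) -
        ∑ n ∈ Icc 1 ⌊x⌋₊, d n * (x - n) - ∑ n ∈ Ioc ⌊x⌋₊ ⌊x + t⌋₊, d n * (x + t - n) := by
      rw [hsplit]; ring
    rw [e]
    have b1 := abs_sub (∑ n ∈ Icc 1 ⌊x + t⌋₊, d n * (x + t - n) -
        ∑ n ∈ Icc 1 ⌊x⌋₊, d n * (x - n)) (∑ n ∈ Ioc ⌊x⌋₊ ⌊x + t⌋₊, d n * (x + t - n))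
    have b2 := abs_sub (∑ n ∈ Icc 1 ⌊x + t⌋₊, d n * (x + t - n))
        (∑ n ∈ Icc 1 ⌊x⌋₊, d n * (x - n))
    have b3 : C * (x + t) ^ 2 ≤ C * (2 * x) ^ 2 := by gcongr; linarith
    nlinarith
  have hxt : x = t * L ^ (m + 1) := by rw [ht]; field_simp
  have h5 : |∑ n ∈ Icc 1 ⌊x⌋₊, d n| ≤ 5 * C * (x * L ^ (m + 1)) + (t + 1) * ((3 * L) * (2 * L) ^ k) := by
    have : t * |∑ n ∈ Icc 1 ⌊x⌋₊, d n| ≤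
        t * (5 * C * (x * L ^ (m + 1)) + (t + 1) * ((3 * L) * (2 * L) ^ k)) := by
      refine h4.trans (le_of_eq ?_)
      have : x ^ 2 = t * (x * L ^ (m + 1)) := by
        rw [sq]; nth_rw 1 [hxt]; ring
      rw [this]; ring
    exact le_of_mul_le_mul_left this ht0
  refine h5.trans ?_
  have h6 : (t + 1) * ((3 * L) * (2 * L) ^ k) = (t + 1) * L ^ (m + 1) * L ^ (m + 1) * (3 * 2 ^ k) := by
    rw [mul_pow, hk]; ring
  have h7 : (t + 1) * L ^ (m + 1) ≤ (1 + (m + 1).factorial) * x := by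
    have := log_pow_le (m + 1) (by linarith : 1 ≤ x)
    rw [add_mul, ← hxt, one_mul]
    linarith
  rw [h6]
  have h8 : (t + 1) * L ^ (m + 1) * L ^ (m + 1) * (3 * 2 ^ k) ≤
      (1 + (m + 1).factorial) * x * L ^ (m + 1) * (3 * 2 ^ k) := by gcongr
  linarith

/-- Strong bound from Riesz means. -/
lemma strong_bound (c : ℕ → ℝ) (hc : ∀ n : ℕ, 1 ≤ n → |c n| ≤ 1 + Real.log n)
    (h : ∀ k : ℕ, ∃ C : ℝ, 0 < C ∧ ∀ x : ℝ, 3 ≤ x →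
      |∑ n ∈ Icc 1 ⌊x⌋₊, c n * Real.log n ^ k * (1 - n / x)| ≤ C * x) (m : ℕ) :
    ∃ K : ℝ, 0 < K ∧ ∀ x : ℝ, 2 ≤ x → |∑ n ∈ Icc 1 ⌊x⌋₊, c n| ≤ K * x / Real.log x ^ m := by
  obtain ⟨C, hC, hCb⟩ := h (2 * m + 1)
  obtain ⟨K, hK, hKb⟩ := unsmooth c hc m hC hCb
  set k := 2 * m + 1 with hk
  set d : ℕ → ℝ := fun n => c n * Real.log n ^ k with hd
  have htriv : ∀ x : ℝ, 2 ≤ x → |∑ n ∈ Icc 1 ⌊x⌋₊, c n| ≤ x * (1 + Real.log x) := by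
    intro x hx
    calc _ ≤ ∑ n ∈ Icc 1 ⌊x⌋₊, (1 + Real.log x) := by
          refine (Finset.abs_sum_le_sum_abs _ _).trans (Finset.sum_le_sum ?_)
          intro n hn
          rw [mem_Icc] at hn
          have hn2 : (n : ℝ) ≤ x := (Nat.le_floor_iff (by linarith)).1 hn.2
          have : Real.log n ≤ Real.log x := Real.log_le_log (by exact_mod_cast hn.1) hn2
          linarith [hc n hn.1]
      _ = ⌊x⌋₊ * (1 + Real.log x) := by rw [Finset.sum_const, Nat.card_Icc, nsmul_eq_mul]; simp
      _ ≤ _ := by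
          have : 0 ≤ Real.log x := Real.log_nonneg (by linarith)
          gcongr
          exact Nat.floor_le (by linarith)
  set K2 := 2 * (2 * (m + 1)).factorial + 2 * (K + 2) * 2 ^ k + 5 * 2 ^ m with hK2
  refine ⟨K2, by positivity, ?_⟩
  intro x hx
  have hlog0 : 0 < Real.log x := Real.log_pos (by linarith)
  rw [le_div_iff₀ (by positivity)]
  by_cases hx3 : x < 3
  · have h1 := htriv x hx
    have hl : Real.log x ≤ 2 := by
      have := Real.log_le_sub_one_of_pos (by linarith : 0 < x)
      linarith
    calc _ ≤ (x * (1 + Real.log x)) * 2 ^ m := by gcongr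
      _ ≤ x * 5 * 2 ^ m := by gcongr; linarith
      _ = 5 * 2 ^ m * x := by ring
      _ ≤ _ := by
        gcongr
        rw [hK2]
        have : 0 < 2 * ((2 * (m + 1)).factorial : ℝ) + 2 * (K + 2) * 2 ^ k := by positivity
        linarith
  push Not at hx3
  set L := Real.log x with hL
  have hL1 : 1 ≤ L := one_le_log hx3
  have hLp : 1 ≤ L ^ (m + 1) := one_le_pow₀ hL1
  have hD : ∀ n : ℕ, (n : ℝ) ≤ x → |∑ j ∈ Icc 1 n, d j| ≤ (K + 2) * x * L ^ (m + 1) := by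
    intro n hn
    by_cases hn3 : 3 ≤ n
    · have := hKb n (by exact_mod_cast hn3)
      rw [Nat.floor_natCast] at this
      refine this.trans ?_
      have hl : Real.log n ≤ L := Real.log_le_log (by exact_mod_cast (by omega : 0 < n)) hn
      have hl0 : 0 ≤ Real.log n := Real.log_natCast_nonneg n
      gcongr
      linarith
    · have h2 : |d 2| ≤ 2 := by
        simp only [hd]
        have h2 := hc 2 (by norm_num)
        have l2 : Real.log 2 ≤ 1 := by have := Real.log_two_lt_d9; linarith
        have l0 : 0 ≤ Real.log 2 := Real.log_nonneg (by norm_num)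
        push_cast at h2 ⊢
        rw [abs_mul, abs_pow, abs_of_nonneg l0]
        have : Real.log 2 ^ k ≤ 1 := pow_le_one₀ l0 l2
        have h3 : 0 ≤ Real.log 2 ^ k := by positivity
        have h4 := abs_nonneg (c 2)
        nlinarith
      have h1 : d 1 = 0 := by simp [hd, hk]
      have hb : |∑ j ∈ Icc 1 n, d j| ≤ 2 := by
        have : n = 0 ∨ n = 1 ∨ n = 2 := by omega
        rcases this with rfl | rfl | rfl
        · simp
        · simp [h1]
        · rw [Finset.sum_Icc_succ_top (by norm_num)]; simpa [h1] using h2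
      have : (K + 2) * x * 1 ≤ (K + 2) * x * L ^ (m + 1) := by gcongr
      nlinarith
  set N := ⌊√x⌋₊ with hN
  set M := ⌊x⌋₊ with hM
  have hsx : √x ≤ x := by
    rw [Real.sqrt_le_left (by linarith)]
    nlinarith
  have hsx1 : 1 ≤ √x := by rw [Real.one_le_sqrt]; linarith
  have hNM : N ≤ M := Nat.floor_mono hsx
  have hMx : (M : ℝ) ≤ x := Nat.floor_le (by linarith)
  have hNs : (N : ℝ) ≤ √x := Nat.floor_le (by linarith)
  have hN1 : 1 ≤ N := by rw [hN, Nat.one_le_floor_iff]; exact hsx1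
  have hsplit : Icc 1 M = Icc 1 N ∪ Ioc N M := by
    ext n; simp only [mem_Icc, mem_union, mem_Ioc]; omega
  have hdisj : Disjoint (Icc 1 N) (Ioc N M) := by
    rw [Finset.disjoint_left]; intro n; simp only [mem_Icc, mem_Ioc]; omega
  have hpart1 : |∑ n ∈ Icc 1 N, c n| ≤ √x * (2 * L) := by
    calc _ ≤ ∑ n ∈ Icc 1 N, (2 * L) := by
          refine (Finset.abs_sum_le_sum_abs _ _).trans (Finset.sum_le_sum ?_)
          intro n hn
          rw [mem_Icc] at hn
          have hn2 : (n : ℝ) ≤ x := by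
            have : (n : ℝ) ≤ N := by exact_mod_cast hn.2
            linarith
          have : Real.log n ≤ Real.log x := Real.log_le_log (by exact_mod_cast hn.1) hn2
          linarith [hc n hn.1]
      _ = N * (2 * L) := by simp
      _ ≤ _ := by gcongr
  have hpart2 : |∑ n ∈ Ioc N M, c n| * L ^ m ≤ 2 * (K + 2) * 2 ^ k * x := by
    by_cases hlt : N + 1 ≤ M
    · have hlogp : ∀ n : ℕ, N + 1 ≤ n → 0 < Real.log n := by
        intro n hn
        apply Real.log_pos
        exact_mod_cast (by omega : 1 < n)
      have := abel_ineq d (fun n => (Real.log n ^ k)⁻¹) N M hlt (2 * ((K + 2) * x * L ^ (m + 1)))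
        (by
          intro n hn
          have := hlogp n hn
          have hn0 : (0 : ℝ) < n := by exact_mod_cast (by omega : 0 < n)
          gcongr
          linarith)
        (by
          intro n hn
          have := hlogp n hn
          positivity)
        (by
          intro j hj1 hj2
          have e : ∑ n ∈ Ioc N j, d n = ∑ n ∈ Icc 1 j, d n - ∑ n ∈ Icc 1 N, d n := by
            have : Icc 1 j = Icc 1 N ∪ Ioc N j := by
              ext n; simp only [mem_Icc, mem_union, mem_Ioc]; omega
            rw [this, Finset.sum_union]
            · ring
            · rw [Finset.disjoint_left]; intro n; simp only [mem_Icc, mem_Ioc]; omega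
          rw [e]
          refine (abs_sub _ _).trans ?_
          have hjx : (j : ℝ) ≤ x := le_trans (by exact_mod_cast hj2) hMx
          linarith [hD j hjx, hD N (by linarith)])
      have e : ∑ n ∈ Ioc N M, d n * (Real.log n ^ k)⁻¹ = ∑ n ∈ Ioc N M, c n := by
        apply Finset.sum_congr rfl
        intro n hn
        rw [mem_Ioc] at hn
        have := hlogp n (by omega)
        simp only [hd]
        field_simp
      rw [e] at this
      have hlN : L / 2 ≤ Real.log ((N + 1 : ℕ) : ℝ) := by
        have h1 : Real.log (√x) ≤ Real.log ((N + 1 : ℕ) : ℝ) := by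
          apply Real.log_le_log (by linarith)
          push_cast
          exact (Nat.lt_floor_add_one _).le
        rwa [Real.log_sqrt (by linarith)] at h1
      have hinv : (Real.log ((N + 1 : ℕ) : ℝ) ^ k)⁻¹ ≤ ((L / 2) ^ k)⁻¹ := by gcongr
      calc _ ≤ (2 * ((K + 2) * x * L ^ (m + 1))) * ((L / 2) ^ k)⁻¹ * L ^ m := by
            gcongr
            exact this.trans (by gcongr)
        _ = 2 * (K + 2) * 2 ^ k * x := by
            have e7 : L ^ k = L ^ (m + 1) * L ^ m := by rw [hk, ← pow_add]; congr 1; ring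
            rw [div_pow, e7]
            field_simp
    · have : Ioc N M = ∅ := by apply Finset.Ioc_eq_empty; omega
      rw [this]; simp; positivity
  rw [hsplit, Finset.sum_union hdisj]
  have h9 := log_pow_le_sqrt (m + 1) (by linarith : 1 ≤ x)
  have h10 : √x * √x = x := Real.mul_self_sqrt (by linarith)
  calc _ ≤ (√x * (2 * L) + |∑ n ∈ Ioc N M, c n|) * L ^ m := by
        gcongr
        exact (abs_add_le _ _).trans (by gcongr)
    _ = 2 * √x * L ^ (m + 1) + |∑ n ∈ Ioc N M, c n| * L ^ m := by ring
    _ ≤ 2 * √x * ((2 * (m + 1)).factorial * √x) + 2 * (K + 2) * 2 ^ k * x := by gcongr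
    _ = 2 * (2 * (m + 1)).factorial * (√x * √x) + 2 * (K + 2) * 2 ^ k * x := by ring
    _ ≤ K2 * x := by
        rw [h10, hK2]
        have : 0 < (5 * 2 ^ m : ℝ) * x := by positivity
        nlinarith

lemma M_bound (m : ℕ) : ∃ K : ℝ, 0 < K ∧ ∀ x : ℝ, 2 ≤ x →
    |∑ n ∈ Icc 1 ⌊x⌋₊, (ArithmeticFunction.moebius n : ℝ)| ≤ K * x / Real.log x ^ m := by
  refine strong_bound _ ?_ riesz_moebius m
  intro n hn
  have h1 : |(ArithmeticFunction.moebius n : ℝ)| ≤ 1 := by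
    exact_mod_cast ArithmeticFunction.abs_moebius_le_one (n := n)
  have := Real.log_natCast_nonneg n
  linarith

lemma psi_bound (m : ℕ) : ∃ K : ℝ, 0 < K ∧ ∀ x : ℝ, 2 ≤ x →
    |∑ n ∈ Icc 1 ⌊x⌋₊, (ArithmeticFunction.vonMangoldt n - 1)| ≤ K * x / Real.log x ^ m := by
  refine strong_bound (fun n => ArithmeticFunction.vonMangoldt n - 1) ?_ riesz_mangoldt m
  intro n hn
  have h1 := ArithmeticFunction.vonMangoldt_nonneg (n := n)
  have h2 := ArithmeticFunction.vonMangoldt_le_log (n := n)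
  rw [abs_le]
  constructor <;> linarith [Real.log_natCast_nonneg n]


lemma sum_dvd_Icc {M : Type*} [AddCommMonoid M] (f : ℕ → M) (N d : ℕ) (hd : 1 ≤ d) :
    ∑ n ∈ (Icc 1 N).filter (d ∣ ·), f n = ∑ m ∈ Icc 1 (N / d), f (d * m) := by
  symm
  apply Finset.sum_bij (fun m _ => d * m)
  · intro m hm
    rw [mem_Icc] at hm
    rw [mem_filter, mem_Icc]
    refine ⟨⟨Nat.mul_pos hd hm.1, ?_⟩, dvd_mul_right _ _⟩
    have := Nat.mul_le_mul_left d hm.2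
    exact this.trans (Nat.mul_div_le N d)
  · intro a _ b _ h
    exact Nat.eq_of_mul_eq_mul_left hd h
  · intro n hn
    rw [mem_filter, mem_Icc] at hn
    obtain ⟨⟨h1, h2⟩, m, rfl⟩ := hn
    refine ⟨m, ?_, rfl⟩
    rw [mem_Icc]
    refine ⟨Nat.pos_of_mul_pos_left h1, ?_⟩
    rw [Nat.le_div_iff_mul_le hd]
    linarith
  · intro m _; rfl

lemma one_add_log_pow_le (m : ℕ) : ∃ C : ℝ, 0 < C ∧ ∀ z : ℝ, 1 ≤ z →
    (1 + Real.log z) ^ m ≤ C * z ^ (1 / 4 : ℝ) := by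
  refine ⟨4 ^ m * m.factorial * Real.exp (1 / 4), by positivity, ?_⟩
  intro z hz
  have h0 := Real.log_nonneg hz
  have h := Real.pow_div_factorial_le_exp ((1 + Real.log z) / 4) (by positivity) m
  rw [div_le_iff₀ (by positivity), div_pow, div_le_iff₀ (by positivity)] at h
  refine h.trans (le_of_eq ?_)
  rw [Real.rpow_def_of_pos (by linarith), add_div, Real.exp_add]
  ring_nf

/-- comparison of log savings -/
lemma log_saving (m : ℕ) : ∃ C : ℝ, 0 < C ∧ ∀ y N : ℝ, 1 ≤ y → y ≤ N →
    y / (1 + Real.log y) ^ m ≤ C * (N / y) ^ (1 / 4 : ℝ) * y / (1 + Real.log N) ^ m := by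
  obtain ⟨C, hC, h⟩ := one_add_log_pow_le m
  refine ⟨C, hC, ?_⟩
  intro y N hy hN
  have h1 : 0 ≤ Real.log y := Real.log_nonneg hy
  have hz : 1 ≤ N / y := by rw [one_le_div (by linarith)]; exact hN
  have h2 : 0 ≤ Real.log N := Real.log_nonneg (by linarith)
  have h3 := h (N / y) hz
  have h4 : 0 ≤ Real.log (N / y) := Real.log_nonneg hz
  rw [div_le_div_iff₀ (by positivity) (by positivity)]
  have h5 : (1 + Real.log N) ≤ (1 + Real.log y) * (1 + Real.log (N / y)) := by
    have : Real.log N = Real.log y + Real.log (N / y) := by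
      rw [Real.log_div (by linarith) (by linarith)]; ring
    nlinarith
  calc y * (1 + Real.log N) ^ m ≤ y * ((1 + Real.log y) * (1 + Real.log (N / y))) ^ m := by
        gcongr
    _ = y * (1 + Real.log y) ^ m * (1 + Real.log (N / y)) ^ m := by rw [mul_pow]; ring
    _ ≤ y * (1 + Real.log y) ^ m * (C * (N / y) ^ (1 / 4 : ℝ)) := by gcongr
    _ = _ := by ring

lemma M_nat (m : ℕ) : ∃ K : ℝ, 0 < K ∧ ∀ N : ℕ, 
    |∑ n ∈ Icc 1 N, (ArithmeticFunction.moebius n : ℝ)| ≤ K * N / (1 + Real.log N) ^ m := by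
  obtain ⟨K, hK, h⟩ := M_bound m
  refine ⟨K * 3 ^ m + 1, by positivity, ?_⟩
  intro N
  by_cases hN : 2 ≤ N
  · have h2 : (2 : ℝ) ≤ N := by exact_mod_cast hN
    have := h N h2
    rw [Nat.floor_natCast] at this
    have hl : 0 < Real.log N := Real.log_pos (by linarith)
    have hl2 : 1 + Real.log N ≤ 3 * Real.log N := by
      have a1 := Real.log_two_gt_d9
      have a2 : Real.log 2 ≤ Real.log N := Real.log_le_log (by norm_num) h2
      linarith
    refine this.trans ?_
    rw [div_le_div_iff₀ (by positivity) (by positivity)]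
    calc _ ≤ K * N * (3 * Real.log N) ^ m := by gcongr
      _ = K * 3 ^ m * N * Real.log N ^ m := by rw [mul_pow]; ring
      _ ≤ _ := by gcongr; linarith
  · have : N = 0 ∨ N = 1 := by omega
    rcases this with rfl | rfl
    · simp
    · simp; positivity

lemma sq_dvd_sq_mul {a b c : ℕ} (ha : Squarefree a) (hb : b ≠ 0) (h : c ^ 2 ∣ b ^ 2 * a) : c ∣ b := by
  have ha0 : a ≠ 0 := ha.ne_zero
  have hc0 : c ≠ 0 := by
    rintro rfl
    simp at h
    omega
  rw [← Nat.factorization_le_iff_dvd hc0 hb]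
  rw [← Nat.factorization_le_iff_dvd (by positivity) (by positivity)] at h
  intro p
  have := h p
  rw [Nat.factorization_mul (by positivity) ha0, Nat.factorization_pow, Nat.factorization_pow] at this
  simp only [Finsupp.coe_add, Pi.add_apply, Finsupp.smul_apply, smul_eq_mul] at this
  have h1 := ha.natFactorization_le_one p
  omega

open ArithmeticFunction in
lemma mu_sq_eq (n N : ℕ) (hn : 1 ≤ n) (hN : n ≤ N) :
    ((moebius n : ℝ)) ^ 2 = ∑ c ∈ (Icc 1 N).filter (fun c => c ^ 2 ∣ n), (moebius c : ℝ) := by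
  obtain ⟨a, b, ha, hb, hab, hsq⟩ := Nat.sq_mul_squarefree_of_pos hn
  have hset : (Icc 1 N).filter (fun c => c ^ 2 ∣ n) = b.divisors := by
    ext c
    rw [mem_filter, mem_Icc, Nat.mem_divisors]
    constructor
    · rintro ⟨_, h2⟩
      rw [← hab] at h2
      exact ⟨sq_dvd_sq_mul hsq hb.ne' h2, hb.ne'⟩
    · rintro ⟨h1, h2⟩
      have h3 : c ^ 2 ∣ n := by
        rw [← hab]; exact (pow_dvd_pow_of_dvd h1 2).mul_right a
      have h4 : 1 ≤ c := Nat.pos_of_dvd_of_pos h1 hb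
      refine ⟨⟨h4, ?_⟩, h3⟩
      have := Nat.le_of_dvd hn h3
      nlinarith
  rw [hset]
  have h5 : ∑ c ∈ b.divisors, (moebius c : ℝ) = if b = 1 then 1 else 0 := by
    have h6 := congrArg (fun f => f b) moebius_mul_coe_zeta
    simp only [coe_mul_zeta_apply, one_apply] at h6
    exact_mod_cast h6
  rw [h5]
  split_ifs with hb1
  · have : Squarefree n := by rw [← hab, hb1]; simpa using hsq
    have := moebius_sq_eq_one_of_squarefree this
    exact_mod_cast this
  · have : ¬ Squarefree n := by
      intro hs
      rw [← hab] at hs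
      have : IsUnit b := hs b ⟨a, by ring⟩
      exact hb1 (Nat.isUnit_iff.1 this)
    rw [moebius_eq_zero_of_not_squarefree this]; simp

open ArithmeticFunction in
lemma liouville_eq (n N : ℕ) (hn : 1 ≤ n) (hN : n ≤ N) :
    (liouville n : ℝ) = ∑ c ∈ (Icc 1 N).filter (fun c => c ^ 2 ∣ n), (moebius (n / c ^ 2) : ℝ) := by
  obtain ⟨a, b, ha, hb, hab, hsq⟩ := Nat.sq_mul_squarefree_of_pos hn
  rw [Finset.sum_eq_single_of_mem b]
  · have : n / b ^ 2 = a := by rw [← hab]; exact Nat.mul_div_cancel_left a (by positivity)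
    rw [this, ← hab, pow_two, liouville_apply_mul, liouville_apply_mul, liouville_apply hb.ne',
      liouville_apply ha.ne', moebius_apply_of_squarefree hsq]
    push_cast
    rw [← pow_add, ← two_mul, pow_mul]; simp
  · rw [mem_filter, mem_Icc]
    refine ⟨⟨hb, ?_⟩, ⟨a, hab.symm⟩⟩
    nlinarith
  · intro c hc hcb
    rw [mem_filter, mem_Icc] at hc
    obtain ⟨⟨h1, _⟩, h2⟩ := hc
    have h3 := sq_dvd_sq_mul hsq hb.ne' (hab ▸ h2)
    obtain ⟨t, rfl⟩ := h3
    have : n / c ^ 2 = t ^ 2 * a := by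
      rw [← hab, mul_pow, mul_assoc]; exact Nat.mul_div_cancel_left _ (by positivity)
    rw [this]
    have : ¬ Squarefree (t ^ 2 * a) := by
      intro hs
      have : IsUnit t := hs t ⟨a, by ring⟩
      have := Nat.isUnit_iff.1 this
      subst this; simp at hcb
    rw [moebius_eq_zero_of_not_squarefree this]; simp

open ArithmeticFunction in
lemma L_eq (N : ℕ) : ∑ n ∈ Icc 1 N, (liouville n : ℝ) =
    ∑ c ∈ Icc 1 N, ∑ m ∈ Icc 1 (N / c ^ 2), (moebius m : ℝ) := by
  have h1 : ∑ n ∈ Icc 1 N, (liouville n : ℝ) =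
      ∑ n ∈ Icc 1 N, ∑ c ∈ Icc 1 N, if c ^ 2 ∣ n then (moebius (n / c ^ 2) : ℝ) else 0 := by
    apply Finset.sum_congr rfl
    intro n hn
    rw [mem_Icc] at hn
    rw [liouville_eq n N hn.1 hn.2, Finset.sum_filter]
  rw [h1, Finset.sum_comm]
  apply Finset.sum_congr rfl
  intro c hc
  rw [mem_Icc] at hc
  have hc2 : 1 ≤ c ^ 2 := Nat.one_le_pow _ _ hc.1
  rw [← Finset.sum_filter, sum_dvd_Icc _ _ _ hc2]
  apply Finset.sum_congr rfl
  intro m _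
  rw [Nat.mul_div_cancel_left _ hc2]

open ArithmeticFunction in
lemma L_nat (m : ℕ) : ∃ K : ℝ, 0 < K ∧ ∀ N : ℕ, 
    |∑ n ∈ Icc 1 N, (liouville n : ℝ)| ≤ K * N / (1 + Real.log N) ^ m := by
  obtain ⟨K, hK, h⟩ := M_nat m
  obtain ⟨C, hC, hs⟩ := log_saving m
  have hsum : Summable (fun n : ℕ => 1 / (n : ℝ) ^ (3 / 2 : ℝ)) :=
    Real.summable_one_div_nat_rpow.2 (by norm_num)
  set T := ∑' n : ℕ, 1 / (n : ℝ) ^ (3 / 2 : ℝ) with hT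
  have hT0 : 0 ≤ T := tsum_nonneg (fun n => by positivity)
  refine ⟨K * C * (T + 1), by positivity, ?_⟩
  intro N
  rw [L_eq]
  rcases Nat.eq_zero_or_pos N with h0 | hN
  · subst h0; simp
  have hN1 : (1 : ℝ) ≤ N := by exact_mod_cast hN
  have hl : 0 ≤ Real.log N := Real.log_nonneg hN1
  calc _ ≤ ∑ c ∈ Icc 1 N, K * C * N / (1 + Real.log N) ^ m * (1 / (c : ℝ) ^ (3 / 2 : ℝ)) := by
        refine (Finset.abs_sum_le_sum_abs _ _).trans (Finset.sum_le_sum ?_)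
        intro c hc
        rw [mem_Icc] at hc
        have hc0 : (0 : ℝ) < c := by exact_mod_cast hc.1
        rcases Nat.eq_zero_or_pos (N / c ^ 2) with h0 | hy
        · rw [h0]; simp; positivity
        · set y := N / c ^ 2 with hyd
          have hy1 : (1 : ℝ) ≤ y := by exact_mod_cast hy
          have hyN : (y : ℝ) ≤ N / (c : ℝ) ^ 2 := by
            have := Nat.cast_div_le (α := ℝ) (m := N) (n := c ^ 2)
            push_cast at this
            exact this
          have hyN' : (y : ℝ) ≤ N := by exact_mod_cast Nat.div_le_self _ _
          have a1 := h y
          have a2 := hs y N hy1 hyN'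
          refine a1.trans ?_
          rw [mul_div_assoc]
          refine (mul_le_mul_of_nonneg_left a2 hK.le).trans ?_
          have a3 : (N / y : ℝ) ^ (1 / 4 : ℝ) * y = (N : ℝ) ^ (1 / 4 : ℝ) * (y : ℝ) ^ (3 / 4 : ℝ) := by
            rw [Real.div_rpow (by linarith) (by linarith)]
            have : (y : ℝ) = (y : ℝ) ^ (1 / 4 : ℝ) * (y : ℝ) ^ (3 / 4 : ℝ) := by
              rw [← Real.rpow_add (by linarith)]; norm_num
            nth_rw 2 [this]
            field_simp
          have a4 : (y : ℝ) ^ (3 / 4 : ℝ) ≤ (N : ℝ) ^ (3 / 4 : ℝ) * (1 / (c : ℝ) ^ (3 / 2 : ℝ)) := by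
            calc (y : ℝ) ^ (3 / 4 : ℝ) ≤ (N / (c : ℝ) ^ 2) ^ (3 / 4 : ℝ) := by gcongr
              _ = _ := by
                rw [Real.div_rpow (by linarith) (by positivity), ← Real.rpow_natCast,
                  ← Real.rpow_mul hc0.le]
                norm_num
                rfl
          have a5 : (N : ℝ) ^ (1 / 4 : ℝ) * (N : ℝ) ^ (3 / 4 : ℝ) = N := by
            rw [← Real.rpow_add (by linarith)]; norm_num
          calc K * (C * (N / y : ℝ) ^ (1 / 4 : ℝ) * y / (1 + Real.log N) ^ m)
              = K * C * ((N / y : ℝ) ^ (1 / 4 : ℝ) * y) / (1 + Real.log N) ^ m := by ring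
            _ ≤ K * C * ((N : ℝ) ^ (1 / 4 : ℝ) * ((N : ℝ) ^ (3 / 4 : ℝ) * (1 / (c : ℝ) ^ (3 / 2 : ℝ)))) /
                (1 + Real.log N) ^ m := by rw [a3]; gcongr
            _ = K * C * (((N : ℝ) ^ (1 / 4 : ℝ) * (N : ℝ) ^ (3 / 4 : ℝ)) * (1 / (c : ℝ) ^ (3 / 2 : ℝ))) /
                (1 + Real.log N) ^ m := by ring
            _ = _ := by rw [a5]; ring
    _ = K * C * N / (1 + Real.log N) ^ m * ∑ c ∈ Icc 1 N, (1 / (c : ℝ) ^ (3 / 2 : ℝ)) := by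
        rw [Finset.mul_sum]
    _ ≤ K * C * N / (1 + Real.log N) ^ m * (T + 1) := by
        gcongr
        have := hsum.sum_le_tsum (Icc 1 N) (fun n _ => by positivity)
        linarith
    _ = _ := by ring


open ArithmeticFunction in
noncomputable def logpow (k : ℕ) : ArithmeticFunction ℝ :=
  ⟨fun n => if n = 0 then 0 else Real.log n ^ k, by simp⟩

open ArithmeticFunction in
lemma logpow_apply (k n : ℕ) (hn : n ≠ 0) : logpow k n = Real.log n ^ k := by
  simp [logpow, hn]

open ArithmeticFunction in
noncomputable def Lk (k : ℕ) : ArithmeticFunction ℝ := (moebius : ArithmeticFunction ℝ) * logpow k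

open ArithmeticFunction in
lemma Lambdak_eq (k n : ℕ) : Lambdak k n = Lk k n := by
  unfold Lambdak Lk
  rw [mul_apply, Nat.sum_divisorsAntidiagonal (fun a b => (moebius : ArithmeticFunction ℝ) a * logpow k b)]
  apply Finset.sum_congr rfl
  intro d hd
  rw [Nat.mem_divisors] at hd
  obtain ⟨⟨e, rfl⟩, h0⟩ := hd
  have hd0 : d ≠ 0 := by rintro rfl; simp at h0
  have he0 : e ≠ 0 := by rintro rfl; simp at h0
  rw [Nat.mul_div_cancel_left _ (Nat.pos_of_ne_zero hd0), logpow_apply _ _ he0]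
  have : (d : ℝ) ≠ 0 := by exact_mod_cast hd0
  rw [intCoe_apply, Nat.cast_mul, mul_div_cancel_left₀ _ this]

open ArithmeticFunction in
lemma Lk_zero : Lk 0 = 1 := by
  unfold Lk
  have : logpow 0 = (zeta : ArithmeticFunction ℝ) := by
    ext n
    by_cases hn : n = 0
    · simp [hn]
    · rw [logpow_apply _ _ hn]; simp [hn]
  rw [this, coe_moebius_mul_coe_zeta]

open ArithmeticFunction in
lemma mulog : ((moebius : ArithmeticFunction ℝ).pmul ArithmeticFunction.log) =
    - (vonMangoldt * (moebius : ArithmeticFunction ℝ)) := by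
  have h1 : ((moebius : ArithmeticFunction ℝ).pmul ArithmeticFunction.log) * (zeta : ArithmeticFunction ℝ)
      = - vonMangoldt := by
    ext n
    rw [coe_mul_zeta_apply]
    simp only [pmul_apply, intCoe_apply]
    rw [sum_moebius_mul_log_eq]; rfl
  calc _ = ((moebius : ArithmeticFunction ℝ).pmul ArithmeticFunction.log) *
        ((zeta : ArithmeticFunction ℝ) * (moebius : ArithmeticFunction ℝ)) := by
        rw [coe_zeta_mul_coe_moebius, mul_one]
    _ = _ := by rw [← mul_assoc, h1, neg_mul]

open ArithmeticFunction in
lemma Lk_succ (k n : ℕ) : Lk (k + 1) n = Real.log n * Lk k n + (vonMangoldt * Lk k) n := by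
  have h1 : (vonMangoldt * Lk k) = - (((moebius : ArithmeticFunction ℝ).pmul ArithmeticFunction.log) * logpow k) := by
    rw [mulog, neg_mul, neg_neg, mul_assoc]; rfl
  rw [h1]
  unfold Lk
  rw [ArithmeticFunction.neg_apply, mul_apply, mul_apply, mul_apply, Finset.mul_sum, ← Finset.sum_neg_distrib, ← Finset.sum_add_distrib]
  apply Finset.sum_congr rfl
  rintro ⟨a, b⟩ hab
  rw [Nat.mem_divisorsAntidiagonal] at hab
  obtain ⟨rfl, h0⟩ := hab
  have ha : a ≠ 0 := by rintro rfl; simp at h0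
  have hb : b ≠ 0 := by rintro rfl; simp at h0
  have ha' : (a : ℝ) ≠ 0 := by exact_mod_cast ha
  have hb' : (b : ℝ) ≠ 0 := by exact_mod_cast hb
  simp only [pmul_apply, intCoe_apply, log_apply]
  rw [logpow_apply _ _ hb, logpow_apply _ _ hb, Nat.cast_mul, Real.log_mul ha' hb']
  ring

open ArithmeticFunction in
lemma Lk_nonneg (k n : ℕ) : 0 ≤ Lk k n := by
  induction k generalizing n with
  | zero => rw [Lk_zero, one_apply]; split_ifs <;> norm_num
  | succ k ih =>
    rw [Lk_succ, mul_apply]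
    have h1 : 0 ≤ Real.log n := Real.log_natCast_nonneg n
    have h2 := ih n
    have h3 : 0 ≤ ∑ x ∈ n.divisorsAntidiagonal, vonMangoldt x.1 * Lk k x.2 :=
      Finset.sum_nonneg (fun x _ => mul_nonneg vonMangoldt_nonneg (ih _))
    positivity

open ArithmeticFunction in
lemma Lk_one (n : ℕ) : Lk 1 n = vonMangoldt n := by
  rw [Lk_succ, Lk_zero, mul_one, one_apply]
  split_ifs with h
  · simp [h]
  · simp

open ArithmeticFunction in
lemma Lk_le (k n : ℕ) (hn : n ≠ 0) : Lk k n ≤ Real.log n ^ k := by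
  have h : (Lk k * (zeta : ArithmeticFunction ℝ)) n = logpow k n := by
    unfold Lk
    rw [mul_assoc, mul_comm (logpow k), ← mul_assoc, coe_moebius_mul_coe_zeta, one_mul]
  rw [coe_mul_zeta_apply, logpow_apply _ _ hn] at h
  rw [← h]
  exact Finset.single_le_sum (f := fun d => Lk k d) (fun d _ => Lk_nonneg k d) (by simp [hn])

open ArithmeticFunction in
lemma Lk_prod (S : Finset ℕ) (hS : ∀ p ∈ S, p.Prime) :
    ∏ p ∈ S, Real.log p ≤ Lk S.card (∏ p ∈ S, p) := by
  induction S using Finset.induction_on with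
  | empty => simp [Lk_zero]
  | insert p S hp ih =>
    have hpp := hS p (mem_insert_self _ _)
    have ih := ih (fun q hq => hS q (mem_insert_of_mem hq))
    rw [card_insert_of_notMem hp, prod_insert hp, prod_insert hp, Lk_succ, mul_apply]
    have h0 : 0 ≤ Real.log ((p * ∏ x ∈ S, x : ℕ)) * Lk S.card (p * ∏ x ∈ S, x) :=
      mul_nonneg (Real.log_natCast_nonneg _) (Lk_nonneg _ _)
    have h1 : vonMangoldt p * Lk S.card (∏ x ∈ S, x) ≤
        ∑ x ∈ (p * ∏ x ∈ S, x).divisorsAntidiagonal, vonMangoldt x.1 * Lk S.card x.2 := by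
      refine Finset.single_le_sum (f := fun x : ℕ × ℕ => vonMangoldt x.1 * Lk S.card x.2)
        (a := (p, ∏ x ∈ S, x))
        (fun x _ => mul_nonneg vonMangoldt_nonneg (Lk_nonneg _ _)) ?_
      rw [Nat.mem_divisorsAntidiagonal]
      refine ⟨rfl, mul_ne_zero hpp.ne_zero ?_⟩
      rw [Finset.prod_ne_zero_iff]
      exact fun q hq => (hS q (mem_insert_of_mem hq)).ne_zero
    rw [vonMangoldt_apply_prime hpp] at h1
    have h2 : Real.log p * ∏ x ∈ S, Real.log x ≤ Real.log p * Lk S.card (∏ x ∈ S, x) :=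
      mul_le_mul_of_nonneg_left ih (Real.log_natCast_nonneg _)
    linarith

open ArithmeticFunction in
lemma Lk_supp (k n : ℕ) (h : Lk k n ≠ 0) : n.primeFactors.card ≤ k := by
  induction k generalizing n with
  | zero =>
    rw [Lk_zero, one_apply] at h
    have : n = 1 := by by_contra h1; simp [h1] at h
    simp [this]
  | succ k ih =>
    rw [Lk_succ] at h
    by_cases h1 : Lk k n = 0
    · rw [h1, mul_zero, zero_add, mul_apply] at h
      obtain ⟨x, hx, hx0⟩ := Finset.exists_ne_zero_of_sum_ne_zero h
      rw [Nat.mem_divisorsAntidiagonal] at hx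
      have h2 := left_ne_zero_of_mul hx0
      have h3 := ih _ (right_ne_zero_of_mul hx0)
      rw [vonMangoldt_ne_zero_iff] at h2
      rw [← hx.1]
      have h4 := isPrimePow_iff_card_primeFactors_eq_one.1 h2
      rw [Nat.primeFactors_mul (by rintro h; simp [h] at hx; omega) (by rintro h; simp [h] at hx; omega)]
      have := card_union_le x.1.primeFactors x.2.primeFactors
      omega
    · have := ih n h1; omega


lemma harm_le (M : ℕ) : ∑ n ∈ Icc 1 M, 1 / (n : ℝ) ≤ 1 + Real.log M := by
  have := harmonic_le_one_add_log M
  rw [harmonic_eq_sum_Icc] at this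
  push_cast at this
  simpa [one_div] using this

lemma lcm_sum (D Z M : ℕ) (hD : D ≤ M) (hZ : Z ≤ M) :
    ∑ d ∈ Icc 1 D, ∑ e ∈ Icc 1 Z, 1 / (Nat.lcm d e : ℝ) ≤ (1 + Real.log M) ^ 3 := by
  set Hs := ∑ n ∈ Icc 1 M, 1 / (n : ℝ) with hHs
  have h1 : Hs ^ 3 = ∑ x ∈ (Icc 1 M) ×ˢ ((Icc 1 M) ×ˢ (Icc 1 M)),
      1 / (x.1 : ℝ) * (1 / (x.2.1 : ℝ) * (1 / (x.2.2 : ℝ))) := by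
    rw [Finset.sum_product, pow_succ, pow_two, mul_assoc, hHs, Finset.sum_mul]
    apply Finset.sum_congr rfl
    intro x _
    rw [Finset.sum_product, Finset.sum_mul_sum]
    simp only [Finset.mul_sum]
  have h0 : 0 ≤ Hs := Finset.sum_nonneg (fun i _ => by positivity)
  refine le_trans ?_ (pow_le_pow_left₀ h0 (harm_le M) 3)
  rw [h1, ← Finset.sum_product (s := Icc 1 D) (t := Icc 1 Z) (f := fun x => 1 / (Nat.lcm x.1 x.2 : ℝ))]
  set φ : ℕ × ℕ → ℕ × (ℕ × ℕ) := fun x =>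
    (Nat.gcd x.1 x.2, (x.1 / Nat.gcd x.1 x.2, x.2 / Nat.gcd x.1 x.2)) with hφ
  have hinj : Set.InjOn φ ((Icc 1 D) ×ˢ (Icc 1 Z) : Finset (ℕ × ℕ)) := by
    rintro ⟨a, b⟩ _ ⟨c, d⟩ _ h
    simp only [hφ, Prod.mk.injEq] at h
    obtain ⟨h1, h2, h3⟩ := h
    have e1 := Nat.mul_div_cancel' (Nat.gcd_dvd_left a b)
    have e2 := Nat.mul_div_cancel' (Nat.gcd_dvd_right a b)
    have e3 := Nat.mul_div_cancel' (Nat.gcd_dvd_left c d)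
    have e4 := Nat.mul_div_cancel' (Nat.gcd_dvd_right c d)
    rw [h2, h1, e3] at e1
    rw [h3, h1, e4] at e2
    rw [e1, e2]
  have hle : ∀ x ∈ ((Icc 1 D) ×ˢ (Icc 1 Z) : Finset (ℕ × ℕ)), 1 / (Nat.lcm x.1 x.2 : ℝ) =
      (fun x : ℕ × (ℕ × ℕ) => 1 / (x.1 : ℝ) * (1 / (x.2.1 : ℝ) * (1 / (x.2.2 : ℝ)))) (φ x) := by
    rintro ⟨a, b⟩ h
    rw [mem_product, mem_Icc, mem_Icc] at h
    simp only [hφ]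
    have hg : 0 < Nat.gcd a b := Nat.gcd_pos_of_pos_left _ h.1.1
    obtain ⟨a', ha⟩ := Nat.gcd_dvd_left a b
    obtain ⟨b', hb⟩ := Nat.gcd_dvd_right a b
    have hl := Nat.gcd_mul_lcm a b
    set g := Nat.gcd a b with hgd
    have hl2 : Nat.lcm a b = g * a' * b' := by
      apply Nat.eq_of_mul_eq_mul_left hg
      rw [hl, ha, hb]; ring
    rw [hl2, ha, hb, Nat.mul_div_cancel_left _ hg, Nat.mul_div_cancel_left _ hg]
    push_cast
    rw [one_div_mul_one_div, one_div_mul_one_div]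
    ring_nf
  rw [Finset.sum_congr rfl hle, ← Finset.sum_image (f := fun x : ℕ × (ℕ × ℕ) => 1 / (x.1 : ℝ) * (1 / (x.2.1 : ℝ) * (1 / (x.2.2 : ℝ)))) hinj]
  apply Finset.sum_le_sum_of_subset_of_nonneg
  · intro y hy
    rw [mem_image] at hy
    obtain ⟨⟨a, b⟩, h, rfl⟩ := hy
    rw [mem_product, mem_Icc, mem_Icc] at h
    simp only [hφ, mem_product, mem_Icc]
    have hg : 0 < Nat.gcd a b := Nat.gcd_pos_of_pos_left _ h.1.1
    have g1 := Nat.le_of_dvd h.1.1 (Nat.gcd_dvd_left a b)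
    have g2 := Nat.le_of_dvd h.2.1 (Nat.gcd_dvd_right a b)
    have g3 := Nat.div_pos g1 hg
    have g4 := Nat.div_pos g2 hg
    have g5 := Nat.div_le_self a (Nat.gcd a b)
    have g6 := Nat.div_le_self b (Nat.gcd a b)
    simp only at h g3 g4
    refine ⟨⟨?_, ?_⟩, ⟨?_, ?_⟩, ⟨?_, ?_⟩⟩ <;> first | assumption | omega
  · intros; positivity

open ArithmeticFunction in
lemma L_mono (m : ℕ) : ∃ K : ℝ, 0 < K ∧ ∀ (N : ℕ) (z : ℝ), 1 ≤ z → (N : ℝ) ≤ z →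
    |∑ n ∈ Icc 1 N, (liouville n : ℝ)| ≤ K * z / (1 + Real.log z) ^ m := by
  obtain ⟨K, hK, h⟩ := L_nat m
  obtain ⟨C, hC, hs⟩ := log_saving m
  refine ⟨K * C, by positivity, ?_⟩
  intro N z hz hN
  have hlz : 0 ≤ Real.log z := Real.log_nonneg hz
  rcases Nat.eq_zero_or_pos N with h0 | hp
  · subst h0; simp; positivity
  have h1 : (1 : ℝ) ≤ N := by exact_mod_cast hp
  refine (h N).trans ?_
  rw [mul_div_assoc, mul_assoc, mul_div_assoc]
  refine mul_le_mul_of_nonneg_left ((hs N z h1 hN).trans ?_) hK.le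
  rw [mul_assoc]
  refine div_le_div_of_nonneg_right (mul_le_mul_of_nonneg_left ?_ hC.le) (by positivity)
  have h2 : 1 ≤ z / N := by rw [one_le_div (by linarith)]; exact hN
  calc (z / N) ^ (1 / 4 : ℝ) * N ≤ (z / N) ^ (1 : ℝ) * N := by
        gcongr
        · norm_num
    _ = z := by rw [Real.rpow_one]; field_simp

open ArithmeticFunction in
lemma Lsum_dvd (X N r : ℕ) (hr : 1 ≤ r) (hX : X ≤ N) :
    ∑ n ∈ (Ioc X N).filter (r ∣ ·), (liouville n : ℝ) = (liouville r : ℝ) *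
      (∑ n ∈ Icc 1 (N / r), (liouville n : ℝ) - ∑ n ∈ Icc 1 (X / r), (liouville n : ℝ)) := by
  have hu : (Icc 1 N).filter (r ∣ ·) = (Icc 1 X).filter (r ∣ ·) ∪ (Ioc X N).filter (r ∣ ·) := by
    rw [← filter_union]; congr 1; ext n; simp only [mem_union, mem_Icc, mem_Ioc]; omega
  have hd : Disjoint ((Icc 1 X).filter (r ∣ ·)) ((Ioc X N).filter (r ∣ ·)) := by
    rw [Finset.disjoint_left]; intro n; simp only [mem_filter, mem_Icc, mem_Ioc]; omega
  have h1 := Finset.sum_union hd (f := fun n => (liouville n : ℝ))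
  rw [← hu, sum_dvd_Icc _ _ _ hr, sum_dvd_Icc _ _ _ hr] at h1
  simp only [liouville_apply_mul, Int.cast_mul] at h1
  rw [← Finset.mul_sum, ← Finset.mul_sum] at h1
  linarith

open ArithmeticFunction in
noncomputable def wt (n : ℕ) : ℝ := (liouville n : ℝ) * (1 - 3 * if 2 ∣ n then 1 else 0)

noncomputable def hE (E : Finset ℕ) (n : ℕ) : ℝ := ((E.filter (· ∣ n)).card : ℝ)

lemma hE_sum (E s : Finset ℕ) (F : ℕ → ℝ) :
    ∑ n ∈ s, hE E n * F n = ∑ e ∈ E, ∑ n ∈ s.filter (e ∣ ·), F n := by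
  have : ∀ n ∈ s, hE E n * F n = ∑ e ∈ E, if e ∣ n then F n else 0 := by
    intro n _
    rw [← Finset.sum_filter, Finset.sum_const, nsmul_eq_mul]; rfl
  rw [Finset.sum_congr rfl this, Finset.sum_comm]
  apply Finset.sum_congr rfl
  intro e _
  rw [Finset.sum_filter]

open ArithmeticFunction in
lemma abs_liouville (n : ℕ) : |(liouville n : ℝ)| ≤ 1 := by
  by_cases hn : n = 0
  · subst hn; simp
  · rw [liouville_apply hn]; push_cast; rw [abs_pow]; simp

open ArithmeticFunction in
lemma R_mid (c : ℝ) (hc : 0 < c) (hc1 : c < 1) (m : ℕ) : ∃ K : ℝ, 0 < K ∧ ∀ (X D Z N : ℕ) (E : Finset ℕ),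
    3 ≤ X → ((D * Z : ℕ) : ℝ) ≤ (X : ℝ) ^ (1 - c) → E ⊆ Icc 1 Z → X ≤ N → N ≤ 2 * X →
    ∑ d ∈ Icc 1 D, |∑ n ∈ (Ioc X N).filter (d ∣ ·), hE E n * wt n| ≤ K * X / Real.log X ^ m := by
  obtain ⟨K, hK, h⟩ := L_mono (m + 3)
  refine ⟨128 * K / c ^ (m + 3), by positivity, ?_⟩
  intro X D Z N E hX hDZ hEs hXN hN
  have hX3 : (3 : ℝ) ≤ X := by exact_mod_cast hX
  have hl1 : 1 ≤ Real.log X := one_le_log hX3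
  have hlX : 0 < Real.log X := by linarith
  rcases Nat.eq_zero_or_pos Z with hZ0 | hZ0
  · have : E = ∅ := by subst hZ0; simpa using hEs
    subst this
    simp [hE]; positivity
  rcases Nat.eq_zero_or_pos D with hD0 | hD0
  · subst hD0; simp; positivity
  have hXc : (X : ℝ) ^ (1 - c) ≤ X := by
    calc (X : ℝ) ^ (1 - c) ≤ (X : ℝ) ^ (1 : ℝ) := by
          apply Real.rpow_le_rpow_of_exponent_le <;> linarith
      _ = X := Real.rpow_one _
  have hDZX : D * Z ≤ X := by exact_mod_cast hDZ.trans hXc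
  have hDX : D ≤ X := (Nat.le_mul_of_pos_right D hZ0).trans hDZX
  have hZX : Z ≤ X := (Nat.le_mul_of_pos_left Z hD0).trans hDZX
  -- single divisor bound
  have key : ∀ r : ℕ, 1 ≤ r → r ≤ 2 * (D * Z) →
      |∑ n ∈ (Ioc X N).filter (r ∣ ·), (liouville n : ℝ)| ≤ 4 * K * X / (c * Real.log X) ^ (m + 3) * (1 / r) := by
    intro r hr hr2
    rw [Lsum_dvd X N r hr hXN, abs_mul]
    have hr0 : (0 : ℝ) < r := by exact_mod_cast hr
    have hr2' : (r : ℝ) ≤ 2 * (X : ℝ) ^ (1 - c) := by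
      have : (r : ℝ) ≤ 2 * ((D * Z : ℕ) : ℝ) := by exact_mod_cast hr2
      linarith
    set z : ℝ := 2 * X / r with hz
    have hzX : (X : ℝ) ^ c ≤ z := by
      rw [hz, le_div_iff₀ hr0]
      calc (X : ℝ) ^ c * r ≤ (X : ℝ) ^ c * (2 * (X : ℝ) ^ (1 - c)) := by gcongr
        _ = 2 * ((X : ℝ) ^ c * (X : ℝ) ^ (1 - c)) := by ring
        _ = 2 * X := by rw [← Real.rpow_add (by linarith)]; simp
    have hz1 : 1 ≤ z := le_trans (Real.one_le_rpow (by linarith) hc.le) hzX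
    have hlog : c * Real.log X ≤ 1 + Real.log z := by
      rw [← Real.log_rpow (by linarith)]
      have := Real.log_le_log (by positivity) hzX
      linarith
    have hb : ∀ M : ℕ, M ≤ 2 * X → |∑ n ∈ Icc 1 (M / r), (liouville n : ℝ)| ≤
        K * z / (c * Real.log X) ^ (m + 3) := by
      intro M hM
      refine (h (M / r) z hz1 ?_).trans ?_
      · refine Nat.cast_div_le.trans ?_
        rw [hz]
        gcongr
        exact_mod_cast hM
      · gcongr
    have b1 := hb N hN
    have b2 := hb X (by omega)
    calc _ ≤ 1 * |∑ n ∈ Icc 1 (N / r), (liouville n : ℝ) - ∑ n ∈ Icc 1 (X / r), (liouville n : ℝ)| := by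
          gcongr; exact abs_liouville r
      _ ≤ 1 * (|∑ n ∈ Icc 1 (N / r), (liouville n : ℝ)| + |∑ n ∈ Icc 1 (X / r), (liouville n : ℝ)|) := by
          gcongr; exact abs_sub _ _
      _ ≤ K * z / (c * Real.log X) ^ (m + 3) + K * z / (c * Real.log X) ^ (m + 3) := by linarith
      _ = _ := by rw [hz]; ring
  have key2 : ∀ d ∈ Icc 1 D, |∑ n ∈ (Ioc X N).filter (d ∣ ·), hE E n * wt n| ≤
      ∑ e ∈ Icc 1 Z, 16 * K * X / (c * Real.log X) ^ (m + 3) * (1 / (Nat.lcm d e : ℝ)) := by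
    intro d hd
    rw [mem_Icc] at hd
    rw [hE_sum]
    refine (Finset.abs_sum_le_sum_abs _ _).trans ?_
    refine le_trans ?_ (Finset.sum_le_sum_of_subset_of_nonneg hEs (fun i _ _ => by positivity))
    apply Finset.sum_le_sum
    intro e he
    have he' := hEs he
    rw [mem_Icc] at he'
    set r := Nat.lcm d e with hr
    have hr1 : 1 ≤ r := Nat.lcm_pos hd.1 he'.1
    have hr2 : r ≤ D * Z := by
      have := Nat.gcd_mul_lcm d e
      have hg := Nat.gcd_pos_of_pos_left e hd.1
      calc r ≤ Nat.gcd d e * r := Nat.le_mul_of_pos_left r hg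
        _ = d * e := this
        _ ≤ D * Z := Nat.mul_le_mul hd.2 he'.2
    set r' := Nat.lcm r 2 with hr'
    have hr'1 : 1 ≤ r' := Nat.lcm_pos hr1 (by norm_num)
    have hrr : r ≤ r' := Nat.le_of_dvd hr'1 (Nat.dvd_lcm_left r 2)
    have hr'2 : r' ≤ 2 * (D * Z) := by
      have : r' ≤ r * 2 := Nat.le_of_dvd (by omega) (Nat.lcm_dvd_mul r 2)
      omega
    have e1 : ((Ioc X N).filter (d ∣ ·)).filter (e ∣ ·) = (Ioc X N).filter (r ∣ ·) := by
      rw [filter_filter]; apply filter_congr; intro n _; rw [hr, Nat.lcm_dvd_iff]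
    have e2 : ∑ n ∈ (Ioc X N).filter (r ∣ ·), wt n = ∑ n ∈ (Ioc X N).filter (r ∣ ·), (liouville n : ℝ)
        - 3 * ∑ n ∈ (Ioc X N).filter (r' ∣ ·), (liouville n : ℝ) := by
      have : (Ioc X N).filter (r' ∣ ·) = ((Ioc X N).filter (r ∣ ·)).filter (2 ∣ ·) := by
        rw [filter_filter]; apply filter_congr; intro n _; rw [hr', Nat.lcm_dvd_iff]
      rw [this, Finset.sum_filter (p := (2 ∣ ·)), Finset.mul_sum, ← Finset.sum_sub_distrib]
      apply Finset.sum_congr rfl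
      intro n _
      unfold wt
      split_ifs <;> ring
    rw [e1, e2]
    have k1 := key r hr1 (by omega)
    have k2 := key r' hr'1 hr'2
    have hr0 : (0 : ℝ) < r := by exact_mod_cast hr1
    have k3 : 4 * K * X / (c * Real.log X) ^ (m + 3) * (1 / (r' : ℝ)) ≤
        4 * K * X / (c * Real.log X) ^ (m + 3) * (1 / (r : ℝ)) := by
      gcongr
    have k4 := abs_sub (∑ n ∈ (Ioc X N).filter (r ∣ ·), (liouville n : ℝ))
      (3 * ∑ n ∈ (Ioc X N).filter (r' ∣ ·), (liouville n : ℝ))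
    rw [abs_mul, abs_of_pos (by norm_num : (0 : ℝ) < 3)] at k4
    calc _ ≤ _ := k4
      _ ≤ 4 * K * X / (c * Real.log X) ^ (m + 3) * (1 / (r : ℝ)) +
          3 * (4 * K * X / (c * Real.log X) ^ (m + 3) * (1 / (r : ℝ))) := by linarith
      _ = _ := by ring
  refine (Finset.sum_le_sum key2).trans ?_
  simp_rw [← Finset.mul_sum]
  calc _ ≤ 16 * K * X / (c * Real.log X) ^ (m + 3) * (1 + Real.log X) ^ 3 := by
        gcongr; exact lcm_sum D Z X hDX hZX
    _ ≤ 16 * K * X / (c * Real.log X) ^ (m + 3) * (2 * Real.log X) ^ 3 := by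
        gcongr; linarith
    _ = _ := by
        field_simp; ring


lemma odd_card (K : ℕ) : ∑ n ∈ Icc 1 K, (if 2 ∣ n then 0 else 1 : ℤ) = ((K + 1) / 2 : ℕ) := by
  induction K with
  | zero => simp
  | succ K ih =>
    rw [Finset.sum_Icc_succ_top (by omega), ih]
    split_ifs <;> omega

noncomputable def cnt (M r : ℕ) : ℤ := ∑ n ∈ (Icc 1 M).filter (r ∣ ·), (if 2 ∣ n then 0 else 1 : ℤ)

lemma cnt_diff (N r : ℕ) (hr : 1 ≤ r) : |cnt N r - 2 * cnt (N / 2) r| ≤ 1 := by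
  unfold cnt
  rw [sum_dvd_Icc _ _ _ hr, sum_dvd_Icc _ _ _ hr]
  by_cases h2 : 2 ∣ r
  · have : ∀ m, 2 ∣ r * m := fun m => h2.mul_right m
    simp [this]
  · have : ∀ m, (2 ∣ r * m ↔ 2 ∣ m) := fun m => by
      rw [Nat.prime_two.dvd_mul]; tauto
    simp only [this]
    rw [odd_card, odd_card, Nat.div_right_comm]
    rw [abs_le]
    omega

lemma cnt_zero (N r : ℕ) (hr : N < r) : cnt N r = 0 := by
  unfold cnt
  have hr0 : 1 ≤ r := by omega
  rw [sum_dvd_Icc _ _ _ hr0, Nat.div_eq_of_lt hr]; simp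

open ArithmeticFunction in
lemma wt_mu (n : ℕ) : wt n * (moebius n : ℝ) = (moebius n : ℝ) ^ 2 * (1 - 3 * if 2 ∣ n then 1 else 0) := by
  unfold wt
  by_cases h : Squarefree n
  · have : (liouville n : ℝ) = (moebius n : ℝ) := by
      rw [liouville_apply h.ne_zero, moebius_apply_of_squarefree h]
    rw [this]; ring
  · rw [moebius_eq_zero_of_not_squarefree h]; simp

open ArithmeticFunction in
lemma mu_two_mul (m : ℕ) : (moebius (2 * m) : ℝ) ^ 2 = if 2 ∣ m then 0 else (moebius m : ℝ) ^ 2 := by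
  split_ifs with h
  · have : ¬ Squarefree (2 * m) := by
      intro hs
      obtain ⟨t, rfl⟩ := h
      have := hs 2 ⟨t, by ring⟩
      simp at this
    rw [moebius_eq_zero_of_not_squarefree this]; simp
  · have hc : Nat.Coprime 2 m := (Nat.Prime.coprime_iff_not_dvd Nat.prime_two).2 h
    rw [isMultiplicative_moebius.map_mul_of_coprime hc, moebius_apply_prime Nat.prime_two]
    push_cast; ring

open ArithmeticFunction in
noncomputable def Sodd (e M : ℕ) : ℝ := ∑ n ∈ (Icc 1 M).filter (e ∣ ·), (if 2 ∣ n then 0 else (moebius n : ℝ) ^ 2)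

open ArithmeticFunction in
lemma Sodd_eq (e M N : ℕ) (hMN : M ≤ N) : Sodd e M = ∑ c ∈ Icc 1 N, (moebius c : ℝ) * (cnt M (Nat.lcm e (c ^ 2)) : ℝ) := by
  unfold Sodd cnt
  have h1 : ∀ n ∈ (Icc 1 M).filter (e ∣ ·), (if 2 ∣ n then 0 else (moebius n : ℝ) ^ 2) =
      ∑ c ∈ Icc 1 N, if c ^ 2 ∣ n then (moebius c : ℝ) * (if 2 ∣ n then 0 else 1) else 0 := by
    intro n hn
    rw [mem_filter, mem_Icc] at hn
    rw [mu_sq_eq n N hn.1.1 (hn.1.2.trans hMN), Finset.sum_filter]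
    split_ifs with h
    · simp
    · simp
  rw [Finset.sum_congr rfl h1, Finset.sum_comm]
  apply Finset.sum_congr rfl
  intro c _
  rw [← Finset.sum_filter, filter_filter, ← Finset.mul_sum]
  push_cast
  congr 1
  apply Finset.sum_congr
  · apply filter_congr; intro n _; rw [Nat.lcm_dvd_iff]
  · intros; rfl

open ArithmeticFunction in
lemma par_e (e N : ℕ) (he : 1 ≤ e) (h2 : ¬ 2 ∣ e) :
    |∑ n ∈ (Icc 1 N).filter (e ∣ ·), wt n * (moebius n : ℝ)| ≤ Nat.sqrt N := by
  have h1 : ∑ n ∈ (Icc 1 N).filter (e ∣ ·), wt n * (moebius n : ℝ) = Sodd e N - 2 * Sodd e (N / 2) := by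
    have hev : Sodd e (N / 2) = ∑ n ∈ ((Icc 1 N).filter (e ∣ ·)).filter (2 ∣ ·), (moebius n : ℝ) ^ 2 := by
      rw [filter_comm, Finset.sum_filter, sum_dvd_Icc _ _ _ (by norm_num)]
      unfold Sodd
      rw [Finset.sum_filter]
      apply Finset.sum_congr rfl
      intro m _
      have : e ∣ 2 * m ↔ e ∣ m := by
        have hc : Nat.Coprime e 2 := ((Nat.Prime.coprime_iff_not_dvd Nat.prime_two).2 h2).symm
        exact hc.dvd_mul_left
      rw [mu_two_mul]
      simp only [this]
    rw [hev, Finset.sum_filter (p := (2 ∣ ·)), Finset.mul_sum]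
    unfold Sodd
    rw [← Finset.sum_sub_distrib]
    apply Finset.sum_congr rfl
    intro n _
    rw [wt_mu]
    split_ifs <;> ring
  rw [h1, Sodd_eq e N N le_rfl, Sodd_eq e (N / 2) N (Nat.div_le_self _ _), Finset.mul_sum, ← Finset.sum_sub_distrib]
  have hs : Icc 1 (Nat.sqrt N) ⊆ Icc 1 N := Icc_subset_Icc le_rfl (Nat.sqrt_le_self N)
  rw [← Finset.sum_subset hs]
  · refine (Finset.abs_sum_le_sum_abs _ _).trans ?_
    calc _ ≤ ∑ c ∈ Icc 1 (Nat.sqrt N), (1 : ℝ) := by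
          apply Finset.sum_le_sum
          intro c hc
          rw [mem_Icc] at hc
          have : (moebius c : ℝ) * (cnt N (Nat.lcm e (c ^ 2)) : ℝ) - 2 * ((moebius c : ℝ) * (cnt (N / 2) (Nat.lcm e (c ^ 2)) : ℝ))
            = (moebius c : ℝ) * ((cnt N (Nat.lcm e (c ^ 2)) - 2 * cnt (N / 2) (Nat.lcm e (c ^ 2)) : ℤ) : ℝ) := by
            push_cast; ring
          rw [this, abs_mul]
          have a1 : |(moebius c : ℝ)| ≤ 1 := by exact_mod_cast abs_moebius_le_one
          have a2 : |((cnt N (Nat.lcm e (c ^ 2)) - 2 * cnt (N / 2) (Nat.lcm e (c ^ 2)) : ℤ) : ℝ)| ≤ 1 := by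
            exact_mod_cast cnt_diff N _ (Nat.lcm_pos he (Nat.one_le_pow _ _ hc.1))
          exact mul_le_one₀ a1 (abs_nonneg _) a2
      _ = _ := by simp
  · intro c hc hc2
    rw [mem_Icc] at hc hc2
    have h3 : N.sqrt < c := by omega
    have h4 : N < c ^ 2 := by rw [pow_two]; exact Nat.sqrt_lt.1 h3
    have h5 : c ^ 2 ≤ Nat.lcm e (c ^ 2) := Nat.le_of_dvd (Nat.lcm_pos he (Nat.one_le_pow _ _ hc.1)) (Nat.dvd_lcm_right _ _)
    rw [cnt_zero _ _ (by omega), cnt_zero _ _ (by have := Nat.div_le_self N 2; omega)]; simp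

open ArithmeticFunction in
lemma par_mid (X Z N : ℕ) (E : Finset ℕ) (hX : X ≤ N) (hN : N ≤ 2 * X) (hZ : E ⊆ Icc 1 Z) (h2 : ∀ e ∈ E, ¬ 2 ∣ e) :
    |∑ n ∈ Ioc X N, hE E n * wt n * (moebius n : ℝ)| ≤ 2 * Z * Nat.sqrt (2 * X) := by
  have h1 : ∑ n ∈ Ioc X N, hE E n * wt n * (moebius n : ℝ) = ∑ n ∈ Ioc X N, hE E n * (wt n * (moebius n : ℝ)) := by
    apply Finset.sum_congr rfl; intros; ring
  rw [h1, hE_sum]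
  refine (Finset.abs_sum_le_sum_abs _ _).trans ?_
  calc _ ≤ ∑ e ∈ E, 2 * (Nat.sqrt (2 * X) : ℝ) := by
        apply Finset.sum_le_sum
        intro e he
        have he1 := (mem_Icc.1 (hZ he)).1
        have hu : (Icc 1 N).filter (e ∣ ·) = (Icc 1 X).filter (e ∣ ·) ∪ (Ioc X N).filter (e ∣ ·) := by
          rw [← filter_union]; congr 1; ext n; simp only [mem_union, mem_Icc, mem_Ioc]; omega
        have hd : Disjoint ((Icc 1 X).filter (e ∣ ·)) ((Ioc X N).filter (e ∣ ·)) := by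
          rw [Finset.disjoint_left]; intro n; simp only [mem_filter, mem_Icc, mem_Ioc]; omega
        have h3 := Finset.sum_union hd (f := fun n => wt n * (moebius n : ℝ))
        rw [← hu] at h3
        have p1 := par_e e N he1 (h2 e he)
        have p2 := par_e e X he1 (h2 e he)
        have q1 : (Nat.sqrt N : ℝ) ≤ Nat.sqrt (2 * X) := by exact_mod_cast Nat.sqrt_le_sqrt hN
        have q2 : (Nat.sqrt X : ℝ) ≤ Nat.sqrt (2 * X) := by
          exact_mod_cast Nat.sqrt_le_sqrt (by omega : X ≤ 2 * X)
        rw [abs_le] at *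
        constructor <;> linarith
    _ = E.card * (2 * (Nat.sqrt (2 * X) : ℝ)) := by rw [sum_const, nsmul_eq_mul]
    _ ≤ Z * (2 * (Nat.sqrt (2 * X) : ℝ)) := by
        gcongr
        have := card_le_card hZ
        simpa using this
    _ = _ := by ring


lemma theta_dyadic : ∃ y0 : ℕ, 2 ≤ y0 ∧ ∀ y : ℕ, y0 ≤ y →
    (y : ℝ) / 2 ≤ ∑ p ∈ (Ioc y (2 * y)).filter Nat.Prime, Real.log p := by
  obtain ⟨K, hK, h⟩ := psi_bound 1
  refine ⟨max 2 ⌈Real.exp (max (16 * K) (24 * 32))⌉₊, le_max_left _ _, ?_⟩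
  intro y hy
  have hy2 : 2 ≤ y := (le_max_left _ _).trans hy
  have hy2' : (2 : ℝ) ≤ y := by exact_mod_cast hy2
  have hl : max (16 * K) (24 * 32) ≤ Real.log y := by
    rw [Real.le_log_iff_exp_le (by linarith)]
    exact (Nat.le_ceil _).trans (by exact_mod_cast (le_max_right _ _).trans hy)
  have hl1 := (le_max_left _ _).trans hl
  have hl2 := (le_max_right _ _).trans hl
  have hlog2 : Real.log y ≤ Real.log (2 * y) := Real.log_le_log (by linarith) (by linarith)
  have hpsi : ∀ N : ℕ, 2 ≤ N → Real.log y ≤ Real.log N → |Chebyshev.psi N - N| ≤ N / 16 := by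
    intro N hN hlN
    have h1 := h N (by exact_mod_cast hN)
    rw [Nat.floor_natCast, Finset.sum_sub_distrib] at h1
    simp only [sum_const, Nat.card_Icc, nsmul_eq_mul, mul_one, pow_one] at h1
    have h2 : Chebyshev.psi N = ∑ n ∈ Icc 1 N, ArithmeticFunction.vonMangoldt n := by
      unfold Chebyshev.psi; rw [Nat.floor_natCast]; rfl
    rw [h2]
    simp only [Nat.add_sub_cancel] at h1
    refine h1.trans ?_
    have h3 : 16 * K ≤ Real.log N := by linarith
    have hp : 0 < Real.log N := by linarith
    rw [div_le_div_iff₀ hp (by norm_num)]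
    have : (0 : ℝ) ≤ N := by positivity
    nlinarith
  have p1 := hpsi y hy2 le_rfl
  have p2 := hpsi (2 * y) (by omega) (by push_cast; exact hlog2)
  have p3 := Chebyshev.psi_sub_theta_le (x := 2 * y) (by linarith)
  have p4 := Chebyshev.theta_le_psi y
  push_cast at p2
  have hsq : 2 * √(2 * (y : ℝ)) * Real.log (2 * y) ≤ y / 8 := by
    have a1 := log_pow_le_sqrt 2 (x := 2 * y) (by linarith)
    have a2 : ((2 * 2).factorial : ℝ) = 24 := by norm_num [Nat.factorial]
    rw [a2] at a1
    set s := √(2 * (y : ℝ)) with hs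
    have hs2 : s * s = 2 * y := Real.mul_self_sqrt (by linarith)
    have hs0 : 0 ≤ s := Real.sqrt_nonneg _
    have hL : 24 * 32 ≤ Real.log (2 * y) := by linarith
    set L := Real.log (2 * (y : ℝ))
    have hL2 : 32 * L ≤ s := by nlinarith
    nlinarith
  have hdiff : Chebyshev.theta (2 * y) - Chebyshev.theta y = ∑ p ∈ (Ioc y (2 * y)).filter Nat.Prime, Real.log p := by
    unfold Chebyshev.theta
    rw [Nat.floor_natCast]
    have : ⌊2 * (y : ℝ)⌋₊ = 2 * y := by
      have := Nat.floor_natCast (R := ℝ) (2 * y)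
      push_cast at this; exact this
    rw [this]
    have hu : (Ioc 0 (2 * y)).filter Nat.Prime = (Ioc 0 y).filter Nat.Prime ∪ (Ioc y (2 * y)).filter Nat.Prime := by
      rw [← filter_union]; congr 1; ext n; simp only [mem_union, mem_Ioc]; omega
    have hd : Disjoint ((Ioc 0 y).filter Nat.Prime) ((Ioc y (2 * y)).filter Nat.Prime) := by
      rw [Finset.disjoint_left]; intro n; simp only [mem_filter, mem_Ioc]; omega
    rw [hu, Finset.sum_union hd]; ring
  rw [← hdiff]
  rw [abs_le] at p1 p2
  linarith

def PP (Y : ℕ) : Finset ℕ := (Ioc Y (Y ^ 2)).filter Nat.Prime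

lemma sum_log_div : ∃ J0 : ℕ, ∀ J : ℕ, J0 ≤ J → (1 / 6 : ℝ) ≤ ∑ p ∈ PP (2 ^ J), 1 / (p : ℝ) := by
  obtain ⟨y0, hy0, h⟩ := theta_dyadic
  refine ⟨y0, ?_⟩
  intro J hJ
  have hJ1 : 1 ≤ J := by omega
  have hind : ∀ t : ℕ, (t : ℝ) / 4 ≤ ∑ p ∈ (Ioc (2 ^ J) (2 ^ (J + t))).filter Nat.Prime, Real.log p / p := by
    intro t
    induction t with
    | zero => simp
    | succ t ih =>
      have hu : (Ioc (2 ^ J) (2 ^ (J + (t + 1)))).filter Nat.Prime =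
          (Ioc (2 ^ J) (2 ^ (J + t))).filter Nat.Prime ∪ (Ioc (2 ^ (J + t)) (2 * 2 ^ (J + t))).filter Nat.Prime := by
        rw [← filter_union]; congr 1; ext n; simp only [mem_union, mem_Ioc]
        have e1 : 2 ^ (J + (t + 1)) = 2 * 2 ^ (J + t) := by ring
        have e2 : 2 ^ J ≤ 2 ^ (J + t) := Nat.pow_le_pow_right (by norm_num) (by omega)
        rw [e1]; omega
      have hd : Disjoint ((Ioc (2 ^ J) (2 ^ (J + t))).filter Nat.Prime) ((Ioc (2 ^ (J + t)) (2 * 2 ^ (J + t))).filter Nat.Prime) := by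
        rw [Finset.disjoint_left]; intro n; simp only [mem_filter, mem_Ioc]; omega
      rw [hu, Finset.sum_union hd]
      have hy : y0 ≤ 2 ^ (J + t) := by
        have : J + t < 2 ^ (J + t) := Nat.lt_two_pow_self
        omega
      have h1 := h _ hy
      set y := 2 ^ (J + t) with hyd
      have hyp : (0 : ℝ) < y := by rw [hyd]; positivity
      have h2 : (1 / 4 : ℝ) ≤ ∑ p ∈ (Ioc y (2 * y)).filter Nat.Prime, Real.log p / p := by
        calc (1 / 4 : ℝ) = (y / 2) / (2 * y) := by field_simp; norm_num
          _ ≤ (∑ p ∈ (Ioc y (2 * y)).filter Nat.Prime, Real.log p) / (2 * y) := by gcongr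
          _ = ∑ p ∈ (Ioc y (2 * y)).filter Nat.Prime, Real.log p / (2 * y) := by rw [Finset.sum_div]
          _ ≤ _ := by
            apply Finset.sum_le_sum
            intro p hp
            rw [mem_filter, mem_Ioc] at hp
            have : (p : ℝ) ≤ 2 * y := by exact_mod_cast hp.1.2
            have hp0 : (0 : ℝ) < p := by exact_mod_cast hp.2.pos
            have := Real.log_natCast_nonneg p
            gcongr
      push_cast
      linarith
  have h1 := hind J
  have hPP : (Ioc (2 ^ J) (2 ^ (J + J))).filter Nat.Prime = PP (2 ^ J) := by
    unfold PP; rw [← pow_mul]; congr 3; ring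
  rw [hPP] at h1
  have hJp : (0 : ℝ) < J := by exact_mod_cast hJ1
  have hb : ∑ p ∈ PP (2 ^ J), Real.log p / p ≤ ∑ p ∈ PP (2 ^ J), (2 * J * Real.log 2) * (1 / (p : ℝ)) := by
    apply Finset.sum_le_sum
    intro p hp
    unfold PP at hp
    rw [mem_filter, mem_Ioc] at hp
    have hp0 : (0 : ℝ) < p := by exact_mod_cast hp.2.pos
    have : Real.log p ≤ 2 * J * Real.log 2 := by
      have e : (p : ℝ) ≤ 2 ^ (2 * J) := by
        have := hp.1.2
        rw [← pow_mul, mul_comm] at this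
        exact_mod_cast this
      have := Real.log_le_log hp0 e
      rw [Real.log_pow] at this
      push_cast at this
      exact this
    rw [mul_one_div]
    gcongr
  rw [← Finset.mul_sum] at hb
  have hl2 := Real.log_two_lt_d9
  have hl3 := Real.log_two_gt_d9
  set S := ∑ p ∈ PP (2 ^ J), 1 / (p : ℝ)
  by_contra hlt
  push Not at hlt
  have : (2 * J * Real.log 2) * S ≤ (2 * J * Real.log 2) * (1 / 6) := by gcongr
  nlinarith

/-- elementary symmetric recursion -/
lemma esymm_rec (P : Finset ℕ) (x : ℕ → ℝ) (j : ℕ) :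
    ∑ S ∈ powersetCard j P, ∑ p ∈ P \ S, (∏ q ∈ S, x q) * x p =
      (j + 1) * ∑ T ∈ powersetCard (j + 1) P, ∏ q ∈ T, x q := by
  have h1 : (j + 1 : ℝ) * ∑ T ∈ powersetCard (j + 1) P, ∏ q ∈ T, x q =
      ∑ T ∈ powersetCard (j + 1) P, ∑ p ∈ T, ∏ q ∈ T, x q := by
    rw [Finset.mul_sum]
    apply Finset.sum_congr rfl
    intro T hT
    rw [mem_powersetCard] at hT
    rw [sum_const, hT.2, nsmul_eq_mul]; push_cast; ring
  rw [h1, Finset.sum_sigma', Finset.sum_sigma']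
  refine Finset.sum_bij' (fun a _ => ⟨insert a.2 a.1, a.2⟩) (fun a _ => ⟨a.1.erase a.2, a.2⟩) ?_ ?_ ?_ ?_ ?_
  · rintro ⟨S, p⟩ h
    simp only [mem_sigma, mem_powersetCard, Finset.mem_sdiff] at h ⊢
    refine ⟨⟨insert_subset h.2.1 h.1.1, ?_⟩, mem_insert_self _ _⟩
    rw [card_insert_of_notMem h.2.2, h.1.2]
  · rintro ⟨S, p⟩ h
    simp only [mem_sigma, mem_powersetCard, Finset.mem_sdiff] at h ⊢
    refine ⟨⟨(erase_subset _ _).trans h.1.1, ?_⟩, h.1.1 h.2, notMem_erase _ _⟩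
    rw [card_erase_of_mem h.2, h.1.2]; rfl
  · rintro ⟨S, p⟩ h
    simp only [mem_sigma, mem_powersetCard, Finset.mem_sdiff] at h ⊢
    rw [erase_insert h.2.2]
  · rintro ⟨S, p⟩ h
    simp only [mem_sigma, mem_powersetCard, Finset.mem_sdiff] at h ⊢
    rw [insert_erase h.2]
  · rintro ⟨S, p⟩ h
    simp only [mem_sigma, mem_powersetCard, Finset.mem_sdiff] at h ⊢
    rw [prod_insert h.2.2, mul_comm]

lemma esymm_lower (r : ℕ) : ∃ c : ℝ, 0 < c ∧ ∃ J0 : ℕ, ∀ J : ℕ, J0 ≤ J →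
    c ≤ ∑ S ∈ powersetCard r (PP (2 ^ J)), ∏ p ∈ S, 1 / (p : ℝ) := by
  obtain ⟨J1, hJ1⟩ := sum_log_div
  induction r with
  | zero => exact ⟨1, one_pos, 0, fun J _ => by simp⟩
  | succ j ih =>
    obtain ⟨c, hc, J0, h⟩ := ih
    refine ⟨c / (12 * (j + 1)), by positivity, max (max J0 J1) (12 * j), ?_⟩
    intro J hJ
    have a1 : J0 ≤ J := ((le_max_left _ _).trans (le_max_left _ _)).trans hJ
    have a2 : J1 ≤ J := ((le_max_right _ _).trans (le_max_left _ _)).trans hJ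
    have a3 : 12 * j ≤ J := (le_max_right _ _).trans hJ
    have h1 := h J a1
    have h2 := hJ1 J a2
    have h3 := esymm_rec (PP (2 ^ J)) (fun p => 1 / (p : ℝ)) j
    have h4 : ∑ S ∈ powersetCard j (PP (2 ^ J)), (∏ q ∈ S, 1 / (q : ℝ)) * (1 / 12) ≤
        ∑ S ∈ powersetCard j (PP (2 ^ J)), ∑ p ∈ PP (2 ^ J) \ S, (∏ q ∈ S, 1 / (q : ℝ)) * (1 / (p : ℝ)) := by
      apply Finset.sum_le_sum
      intro S hS
      rw [mem_powersetCard] at hS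
      rw [← Finset.mul_sum]
      apply mul_le_mul_of_nonneg_left _ (Finset.prod_nonneg (fun i _ => by positivity))
      have h5 := Finset.sum_sdiff hS.1 (f := fun p : ℕ => 1 / (p : ℝ))
      have h6 : ∑ p ∈ S, 1 / (p : ℝ) ≤ 1 / 12 := by
        have hJ2 : (J : ℝ) < 2 ^ J := by exact_mod_cast Nat.lt_two_pow_self
        have a3' : (12 : ℝ) * j ≤ J := by exact_mod_cast a3
        calc ∑ p ∈ S, 1 / (p : ℝ) ≤ ∑ p ∈ S, 1 / (2 : ℝ) ^ J := by
              apply Finset.sum_le_sum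
              intro p hp
              have := hS.1 hp
              unfold PP at this
              rw [mem_filter, mem_Ioc] at this
              have : (2 : ℝ) ^ J ≤ p := by exact_mod_cast this.1.1.le
              gcongr
          _ = j / 2 ^ J := by rw [sum_const, hS.2, nsmul_eq_mul]; ring
          _ ≤ 1 / 12 := by
              rw [div_le_div_iff₀ (by positivity) (by norm_num)]; linarith
      linarith
    rw [h3, ← Finset.sum_mul] at h4
    rw [div_le_iff₀ (by positivity)]
    nlinarith


def EE (Y r : ℕ) : Finset ℕ := (powersetCard r (PP Y)).image (fun S => ∏ p ∈ S, p)

lemma PP_mem {Y p : ℕ} (h : p ∈ PP Y) : Y < p ∧ p ≤ Y ^ 2 ∧ p.Prime := by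
  unfold PP at h; rw [mem_filter, mem_Ioc] at h; exact ⟨h.1.1, h.1.2, h.2⟩

lemma EE_mem {Y r e : ℕ} (he : e ∈ EE Y r) : e.primeFactors ⊆ PP Y ∧ e.primeFactors.card = r ∧
    ∏ p ∈ e.primeFactors, p = e := by
  unfold EE at he
  rw [mem_image] at he
  obtain ⟨S, hS, rfl⟩ := he
  rw [mem_powersetCard] at hS
  have : (∏ p ∈ S, p).primeFactors = S := Nat.primeFactors_prod (fun p hp => (PP_mem (hS.1 hp)).2.2)
  rw [this]
  exact ⟨hS.1, hS.2, rfl⟩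

lemma EE_pos {Y r e : ℕ} (he : e ∈ EE Y r) : 1 ≤ e := by
  rw [← (EE_mem he).2.2]
  exact Finset.prod_pos (fun p hp => (Nat.prime_of_mem_primeFactors hp).pos)

lemma EE_le {Y r e : ℕ} (he : e ∈ EE Y r) : e ≤ Y ^ (2 * r) := by
  obtain ⟨h1, h2, h3⟩ := EE_mem he
  have := Finset.prod_le_pow_card e.primeFactors (fun p => p) (Y ^ 2) (fun p hp => (PP_mem (h1 hp)).2.1)
  rw [h3, h2, ← pow_mul] at this
  exact this

lemma EE_sub (Y r : ℕ) : EE Y r ⊆ Icc 1 (Y ^ (2 * r)) := fun e he =>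
  mem_Icc.2 ⟨EE_pos he, EE_le he⟩

lemma EE_odd {Y r e : ℕ} (hY : 2 ≤ Y) (he : e ∈ EE Y r) : ¬ 2 ∣ e := by
  intro h
  have h2 : 2 ∈ e.primeFactors := by
    rw [Nat.mem_primeFactors]; exact ⟨Nat.prime_two, h, by have := EE_pos he; omega⟩
  have := (PP_mem ((EE_mem he).1 h2)).1
  omega

lemma EE_sum (Y r : ℕ) (F : ℕ → ℝ) : ∑ e ∈ EE Y r, F e = ∑ S ∈ powersetCard r (PP Y), F (∏ p ∈ S, p) := by
  unfold EE
  rw [Finset.sum_image]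
  intro S hS T hT h
  simp only [mem_coe, mem_powersetCard] at hS hT
  have h1 := Nat.primeFactors_prod (fun p hp => (PP_mem (hS.1 hp)).2.2)
  have h2 := Nat.primeFactors_prod (fun p hp => (PP_mem (hT.1 hp)).2.2)
  simp only at h
  rw [← h1, ← h2, h]

lemma hE_nonneg (E : Finset ℕ) (n : ℕ) : 0 ≤ hE E n := by unfold hE; positivity

lemma hE_le (Y q r n : ℕ) (hY : 2 ≤ Y) (hn : 1 ≤ n) (hnX : n ≤ 2 * Y ^ q) : hE (EE Y r) n ≤ 2 ^ (q + 1) := by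
  set A := (PP Y).filter (· ∣ n) with hA
  have hcard : A.card ≤ q + 1 := by
    have h1 : ∏ p ∈ A, p ∣ n := by
      apply Finset.prod_primes_dvd
      · intro p hp
        rw [hA, mem_filter] at hp
        exact (PP_mem hp.1).2.2.prime
      · intro p hp
        rw [hA, mem_filter] at hp
        exact hp.2
    have h2 := Finset.pow_card_le_prod A (fun p => p) Y (fun p hp => by
      rw [hA, mem_filter] at hp
      exact (PP_mem hp.1).1.le)
    have h3 := Nat.le_of_dvd hn h1
    have h4 : Y ^ A.card ≤ Y ^ (q + 1) := by
      calc Y ^ A.card ≤ 2 * Y ^ q := by omega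
        _ ≤ Y * Y ^ q := Nat.mul_le_mul_right _ hY
        _ = _ := by ring
    exact (Nat.pow_le_pow_iff_right (by omega)).1 h4
  have h : ((EE Y r).filter (· ∣ n)).card ≤ A.powerset.card := by
    apply Finset.card_le_card_of_injOn (fun e => e.primeFactors)
    · intro e he
      simp only [coe_filter, Set.mem_setOf_eq] at he
      simp only [coe_powerset, Set.mem_preimage, Set.mem_powerset_iff, coe_subset]
      intro p hp
      rw [hA, mem_filter]
      exact ⟨(EE_mem he.1).1 hp, (Nat.dvd_of_mem_primeFactors hp).trans he.2⟩
    · intro e he e' he' hee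
      simp only [coe_filter, Set.mem_setOf_eq] at he he'
      simp only at hee
      rw [← (EE_mem he.1).2.2, ← (EE_mem he'.1).2.2, hee]
  rw [card_powerset] at h
  have h5 : ((EE Y r).filter (· ∣ n)).card ≤ 2 ^ (q + 1) := h.trans (Nat.pow_le_pow_right (by norm_num) hcard)
  unfold hE
  exact_mod_cast h5

/-- classification -/
lemma classify (Y q r n e : ℕ) (hY : 2 ≤ Y) (hq : 2 * r + 3 ≤ q) (he : e ∈ EE Y r) (hen : e ∣ n)
    (hn : Y ^ q < n) (hw : n.primeFactors.card ≤ r + 1) :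
    (Squarefree n ∧ ¬ 2 ∣ n ∧ n.primeFactors.card = r + 1) ∨ ∃ s, Y < s ∧ s ^ 2 ∣ n := by
  by_contra hcon
  push Not at hcon
  obtain ⟨h1, h2⟩ := hcon
  obtain ⟨hm1, hm2, hm3⟩ := EE_mem he
  have he0 := EE_pos he
  obtain ⟨m, rfl⟩ := hen
  have hm0 : m ≠ 0 := by rintro rfl; simp at hn
  have hcop : Nat.Coprime e m := by
    apply Nat.Coprime.symm
    rw [← hm3]
    apply Nat.Coprime.prod_right
    intro p hp
    have hpp := Nat.prime_of_mem_primeFactors hp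
    rw [Nat.coprime_comm, Nat.Prime.coprime_iff_not_dvd hpp]
    intro hpm
    apply h2 p (PP_mem (hm1 hp)).1
    rw [pow_two]
    exact Nat.mul_dvd_mul (Nat.dvd_of_mem_primeFactors hp) hpm
  have hcard : (e * m).primeFactors.card = r + m.primeFactors.card := by
    rw [hcop.primeFactors_mul, card_union_of_disjoint hcop.disjoint_primeFactors, hm2]
  -- m is large
  have hmbig : Y ^ 3 < m := by
    by_contra hle
    push Not at hle
    have : e * m ≤ Y ^ q := by
      calc e * m ≤ Y ^ (2 * r) * Y ^ 3 := Nat.mul_le_mul (EE_le he) hle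
        _ = Y ^ (2 * r + 3) := by ring
        _ ≤ Y ^ q := Nat.pow_le_pow_right (by omega) hq
    omega
  have hY3 : 2 ^ 3 ≤ Y ^ 3 := Nat.pow_le_pow_left hY 3
  have hm1' : m.primeFactors.card = 1 := by
    have : m.primeFactors.card ≠ 0 := by
      rw [Finset.card_ne_zero, Nat.nonempty_primeFactors]; omega
    omega
  rw [← isPrimePow_iff_card_primeFactors_eq_one, isPrimePow_nat_iff] at hm1'
  obtain ⟨p, b, hp, hb, rfl⟩ := hm1'
  by_cases hb1 : b = 1
  · subst hb1
    rw [pow_one] at *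
    apply h1
    · rw [Nat.squarefree_mul hcop]
      refine ⟨?_, hp.squarefree⟩
      rw [← hm3]
      apply Finset.squarefree_prod_of_pairwise_isCoprime
      · intro a ha b hb hab
        have ha' := Nat.prime_of_mem_primeFactors ha
        have hb' := Nat.prime_of_mem_primeFactors hb
        exact Nat.coprime_iff_isRelPrime.1 ((Nat.coprime_primes ha' hb').2 hab)
      · intro a ha
        exact (Nat.prime_of_mem_primeFactors ha).squarefree
    · rw [Nat.prime_two.dvd_mul]
      rintro (h | h)
      · exact EE_odd hY he h
      · rw [Nat.prime_dvd_prime_iff_eq Nat.prime_two hp] at h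
        omega
    · rw [hcard, hp.primeFactors, card_singleton]
  · have hb2 : 2 ≤ b := by omega
    refine h2 (p ^ (b / 2)) ?_ ?_
    · have : Y ^ 3 < (p ^ (b / 2)) ^ 3 := by
        refine hmbig.trans_le ?_
        rw [← pow_mul]
        exact Nat.pow_le_pow_right hp.pos (by omega)
      exact lt_of_pow_lt_pow_left₀ 3 (by omega) this
    · rw [← pow_mul]
      exact (pow_dvd_pow p (by omega)).mul_left e


open Classical in
lemma bad_count (X Y : ℕ) (hY : 1 ≤ Y) (hYX : Y ≤ 2 * X) :
    (((Ioc X (2 * X)).filter (fun n => ∃ s, Y < s ∧ s ^ 2 ∣ n)).card : ℝ) ≤ 2 * X / Y := by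
  have hsub : (Ioc X (2 * X)).filter (fun n => ∃ s, Y < s ∧ s ^ 2 ∣ n) ⊆
      (Ioc Y (2 * X)).biUnion (fun s => (Icc 1 (2 * X)).filter (s ^ 2 ∣ ·)) := by
    intro n hn
    rw [mem_filter, mem_Ioc] at hn
    obtain ⟨hn1, s, hs, hsn⟩ := hn
    rw [mem_biUnion]
    refine ⟨s, ?_, ?_⟩
    · rw [mem_Ioc]
      refine ⟨hs, ?_⟩
      have h1 := Nat.le_of_dvd (by omega) hsn
      have h2 : s ≤ s ^ 2 := Nat.le_self_pow (by norm_num) s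
      omega
    · rw [mem_filter, mem_Icc]
      exact ⟨⟨by omega, hn1.2⟩, hsn⟩
  have h1 := (card_le_card hsub).trans card_biUnion_le
  have h2 : ∀ s ∈ Ioc Y (2 * X), ((((Icc 1 (2 * X)).filter (s ^ 2 ∣ ·)).card : ℕ) : ℝ) ≤ 2 * X * ((s : ℝ) ^ 2)⁻¹ := by
    intro s hs
    rw [mem_Ioc] at hs
    have hs2 : 1 ≤ s ^ 2 := Nat.one_le_pow _ _ (by omega)
    rw [card_eq_sum_ones, sum_dvd_Icc _ _ _ hs2]
    simp only [sum_const, Nat.card_Icc, smul_eq_mul, mul_one, Nat.add_sub_cancel]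
    refine Nat.cast_div_le.trans ?_
    push_cast
    rw [div_eq_mul_inv]
  calc _ ≤ ((∑ s ∈ Ioc Y (2 * X), ((Icc 1 (2 * X)).filter (s ^ 2 ∣ ·)).card : ℕ) : ℝ) := by exact_mod_cast h1
    _ ≤ ∑ s ∈ Ioc Y (2 * X), 2 * (X : ℝ) * ((s : ℝ) ^ 2)⁻¹ := by
        push_cast; exact Finset.sum_le_sum h2
    _ = 2 * X * ∑ s ∈ Ioc Y (2 * X), ((s : ℝ) ^ 2)⁻¹ := by rw [Finset.mul_sum]
    _ ≤ 2 * X * ((Y : ℝ)⁻¹ - ((2 * X : ℕ) : ℝ)⁻¹) := by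
        gcongr; exact sum_Ioc_inv_sq_le_sub (by omega) hYX
    _ ≤ 2 * X * (Y : ℝ)⁻¹ := by
        gcongr
        have : (0 : ℝ) ≤ ((2 * X : ℕ) : ℝ)⁻¹ := by positivity
        linarith
    _ = _ := by rw [div_eq_mul_inv]

def Gd (k n : ℕ) : Prop := Squarefree n ∧ ¬ 2 ∣ n ∧ n.primeFactors.card = k

lemma abs_wt (n : ℕ) : |wt n| ≤ 2 := by
  unfold wt
  rw [abs_mul]
  have h1 := abs_liouville n
  have h2 : |(1 - 3 * if 2 ∣ n then 1 else 0 : ℝ)| ≤ 2 := by split_ifs <;> norm_num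
  nlinarith [abs_nonneg (ArithmeticFunction.liouville n : ℝ), abs_nonneg (1 - 3 * if 2 ∣ n then 1 else 0 : ℝ)]

open ArithmeticFunction in
lemma wt_good {k n : ℕ} (h : Gd k n) : wt n = (-1) ^ k := by
  obtain ⟨h1, h2, h3⟩ := h
  unfold wt
  rw [liouville_apply h1.ne_zero, if_neg h2, ← (cardDistinctFactors_eq_cardFactors_iff_squarefree h1.ne_zero).2 h1,
    ← h3]
  have h4 : cardDistinctFactors n = n.primeFactors.card := rfl
  rw [h4]
  push_cast
  ring

open Classical in
lemma good_lower (r q : ℕ) (hq : 2 * r + 3 ≤ q) (y0 J : ℕ) (hy0 : y0 ≤ J) (hJ : 1 ≤ J)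
    (hth : ∀ y : ℕ, y0 ≤ y → (y : ℝ) / 2 ≤ ∑ p ∈ (Ioc y (2 * y)).filter Nat.Prime, Real.log p) :
    Real.log (2 ^ J) ^ r * (((2 ^ J) ^ q : ℕ) / 4) * (∑ S ∈ powersetCard r (PP (2 ^ J)), ∏ p ∈ S, 1 / (p : ℝ)) ≤
    ∑ n ∈ Ioc ((2 ^ J) ^ q) (2 * (2 ^ J) ^ q), hE (EE (2 ^ J) r) n * (if Gd (r + 1) n then Lk (r + 1) n else 0) := by
  set Y := 2 ^ J with hY
  have hY2 : 2 ≤ Y := by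
    rw [hY]; calc 2 = 2 ^ 1 := by norm_num
      _ ≤ 2 ^ J := Nat.pow_le_pow_right (by norm_num) hJ
  have hYJ : J < Y := Nat.lt_two_pow_self
  set X := Y ^ q with hX
  have hYr : Real.log (2 ^ J) = Real.log Y := by rw [hY]; push_cast; rfl
  have hlY : 0 ≤ Real.log Y := Real.log_natCast_nonneg _
  rw [hE_sum]
  have hsum : ∑ S ∈ powersetCard r (PP Y), ∏ p ∈ S, 1 / (p : ℝ) = ∑ e ∈ EE Y r, 1 / (e : ℝ) := by
    rw [EE_sum Y r (fun e => 1 / (e : ℝ))]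
    apply Finset.sum_congr rfl
    intro S _
    push_cast
    simp
  rw [hsum, Finset.mul_sum, hYr]
  apply Finset.sum_le_sum
  intro e he
  obtain ⟨hm1, hm2, hm3⟩ := EE_mem he
  have he0 := EE_pos he
  have he0' : (0 : ℝ) < e := by exact_mod_cast he0
  set M := X / e with hM
  have hMbig : Y ^ 3 ≤ M := by
    rw [hM, Nat.le_div_iff_mul_le he0]
    calc Y ^ 3 * e ≤ Y ^ 3 * Y ^ (2 * r) := Nat.mul_le_mul_left _ (EE_le he)
      _ = Y ^ (2 * r + 3) := by ring
      _ ≤ Y ^ q := Nat.pow_le_pow_right (by omega) hq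
  have hY23 : Y ^ 2 < Y ^ 3 := Nat.pow_lt_pow_right (by omega) (by norm_num)
  have hYY : Y ≤ Y ^ 2 := Nat.le_self_pow (by norm_num) Y
  have hth' := hth M (by omega)
  have hMX : (X : ℝ) / (2 * e) ≤ M := by
    rw [div_le_iff₀ (by positivity)]
    have h1 : X < e * (M + 1) := Nat.lt_mul_div_succ X he0
    have h2 : X ≤ M * (2 * e) := by nlinarith
    exact_mod_cast h2
  have hinj : Set.InjOn (fun p => e * p) ((Ioc M (2 * M)).filter Nat.Prime : Finset ℕ) := by
    intro a _ b _ hab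
    exact Nat.eq_of_mul_eq_mul_left he0 hab
  have hfacts : ∀ p ∈ (Ioc M (2 * M)).filter Nat.Prime,
      e * p ∈ (Ioc X (2 * X)).filter (e ∣ ·) ∧ Gd (r + 1) (e * p) ∧ Real.log Y ^ r * Real.log p ≤ Lk (r + 1) (e * p) := by
    intro p hp
    rw [mem_filter, mem_Ioc] at hp
    obtain ⟨⟨hp1, hp2⟩, hpp⟩ := hp
    have hpe : p ∉ e.primeFactors := by
      intro h
      have := (PP_mem (hm1 h)).2.1
      omega
    have hnp : ¬ p ∣ e := fun h => hpe (Nat.mem_primeFactors.2 ⟨hpp, h, by omega⟩)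
    set T := insert p e.primeFactors with hT
    have hTp : ∀ a ∈ T, Nat.Prime a := by
      intro a ha
      rw [hT, mem_insert] at ha
      rcases ha with rfl | ha
      · exact hpp
      · exact Nat.prime_of_mem_primeFactors ha
    have hTprod : ∏ a ∈ T, a = e * p := by
      rw [hT, prod_insert hpe, hm3, mul_comm]
    have hTc : T.card = r + 1 := by rw [hT, card_insert_of_notMem hpe, hm2]
    have hTf : (e * p).primeFactors = T := by rw [← hTprod]; exact Nat.primeFactors_prod hTp
    refine ⟨?_, ⟨?_, ?_, ?_⟩, ?_⟩
    · rw [mem_filter, mem_Ioc]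
      refine ⟨⟨?_, ?_⟩, dvd_mul_right _ _⟩
      · have h1 : X < e * (M + 1) := Nat.lt_mul_div_succ X he0
        exact h1.trans_le (Nat.mul_le_mul_left e hp1)
      · have h1 : e * M ≤ X := Nat.mul_div_le X e
        calc e * p ≤ e * (2 * M) := Nat.mul_le_mul_left e hp2
          _ = 2 * (e * M) := by ring
          _ ≤ 2 * X := by omega
    · rw [← hTprod]
      apply Finset.squarefree_prod_of_pairwise_isCoprime
      · intro a ha b hb hab
        exact Nat.coprime_iff_isRelPrime.1 ((Nat.coprime_primes (hTp a ha) (hTp b hb)).2 hab)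
      · intro a ha
        exact (hTp a ha).squarefree
    · rw [Nat.prime_two.dvd_mul]
      rintro (h | h)
      · exact EE_odd hY2 he h
      · rw [Nat.prime_dvd_prime_iff_eq Nat.prime_two hpp] at h
        omega
    · rw [hTf, hTc]
    · have h1 := Lk_prod T hTp
      rw [hTc, hTprod] at h1
      refine le_trans ?_ h1
      rw [hT, prod_insert hpe, mul_comm]
      gcongr
      · rw [← hm2, ← Finset.prod_const]
        apply Finset.prod_le_prod
        · intros; exact hlY
        · intro a ha
          have := (PP_mem (hm1 ha)).1
          apply Real.log_le_log
          · have : 0 < Y := by omega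
            exact_mod_cast this
          · exact_mod_cast this.le
  calc Real.log Y ^ r * ((X : ℝ) / 4) * (1 / e) = Real.log Y ^ r * ((X : ℝ) / (2 * e) / 2) := by
        field_simp; ring
    _ ≤ Real.log Y ^ r * ∑ p ∈ (Ioc M (2 * M)).filter Nat.Prime, Real.log p := by
        gcongr
        refine le_trans ?_ hth'
        gcongr
    _ = ∑ p ∈ (Ioc M (2 * M)).filter Nat.Prime, Real.log Y ^ r * Real.log p := by rw [Finset.mul_sum]
    _ ≤ ∑ p ∈ (Ioc M (2 * M)).filter Nat.Prime, (fun n => if Gd (r + 1) n then Lk (r + 1) n else 0) (e * p) := by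
        apply Finset.sum_le_sum
        intro p hp
        obtain ⟨_, h2, h3⟩ := hfacts p hp
        simp only [if_pos h2]
        exact h3
    _ = ∑ n ∈ ((Ioc M (2 * M)).filter Nat.Prime).image (fun p => e * p), (if Gd (r + 1) n then Lk (r + 1) n else 0) := by
        rw [Finset.sum_image hinj]
    _ ≤ _ := by
        apply Finset.sum_le_sum_of_subset_of_nonneg
        · intro n hn
          rw [mem_image] at hn
          obtain ⟨p, hp, rfl⟩ := hn
          exact (hfacts p hp).1
        · intro n _ _
          split_ifs
          · exact Lk_nonneg _ _
          · exact le_rfl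

open Classical in
lemma Sk_main (r q : ℕ) (hq : 2 * r + 3 ≤ q) : ∃ δ : ℝ, 0 < δ ∧ ∃ J0 : ℕ, ∀ J : ℕ, J0 ≤ J →
    δ * ((2 ^ J) ^ q : ℕ) * Real.log ((2 ^ J) ^ q : ℕ) ^ r ≤
    (-1) ^ (r + 1) * ∑ n ∈ Ioc ((2 ^ J) ^ q) (2 * (2 ^ J) ^ q), hE (EE (2 ^ J) r) n * wt n * Lk (r + 1) n := by
  obtain ⟨y0, _, hth⟩ := theta_dyadic
  obtain ⟨c, hc, J1, hes⟩ := esymm_lower r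
  have hq0 : (0 : ℝ) < q := by have : 0 < q := by omega
                               exact_mod_cast this
  set A : ℝ := 32 * 2 ^ (q + 1) * (q + 1) ^ (r + 1) / c with hA
  have hA0 : 0 < A := by positivity
  refine ⟨c / (8 * q ^ r), by positivity, max (max y0 J1) (max 1 ⌈2 * A / Real.log 2⌉₊), ?_⟩
  intro J hJ
  have hJ1 : y0 ≤ J := ((le_max_left _ _).trans (le_max_left _ _)).trans hJ
  have hJ2 : J1 ≤ J := ((le_max_right _ _).trans (le_max_left _ _)).trans hJ
  have hJ3 : 1 ≤ J := ((le_max_left _ _).trans (le_max_right _ _)).trans hJ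
  have hJ4 : ⌈2 * A / Real.log 2⌉₊ ≤ J := ((le_max_right _ _).trans (le_max_right _ _)).trans hJ
  have hlow := good_lower r q hq y0 J hJ1 hJ3 hth
  have hes' := hes J hJ2
  set Y := 2 ^ J with hY
  have hY2 : 2 ≤ Y := by
    rw [hY]; calc 2 = 2 ^ 1 := by norm_num
      _ ≤ 2 ^ J := Nat.pow_le_pow_right (by norm_num) hJ3
  have hY2' : (2 : ℝ) ≤ Y := by exact_mod_cast hY2
  set X := Y ^ q with hX
  have hYX : Y ≤ X := Nat.le_self_pow (by omega) Y
  have hX2 : (2 : ℝ) ≤ X := by exact_mod_cast hY2.trans hYX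
  have hYr : Real.log (2 ^ J) = Real.log Y := by rw [hY]; push_cast; rfl
  rw [hYr] at hlow
  have hlYA : 2 * A ≤ Real.log Y := by
    rw [hY]; push_cast; rw [Real.log_pow]
    have h1 : 2 * A / Real.log 2 ≤ J := (Nat.le_ceil _).trans (by exact_mod_cast hJ4)
    rwa [div_le_iff₀ (Real.log_pos (by norm_num))] at h1
  have hlY : 0 < Real.log Y := by linarith
  have hlX : Real.log X = q * Real.log Y := by rw [hX]; push_cast; rw [Real.log_pow]
  have hl2X : Real.log (2 * X) ≤ (q + 1) * Real.log Y := by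
    rw [Real.log_mul (by norm_num) (by linarith), hlX]
    have := Real.log_le_log (by norm_num) hY2'
    linarith
  have hl2X0 : 0 ≤ Real.log (2 * X) := Real.log_nonneg (by linarith)
  set W : ℝ := 2 ^ (q + 1) * 2 * Real.log (2 * X) ^ (r + 1) with hW
  have hW0 : 0 ≤ W := by positivity
  -- pointwise
  have hpt : ∀ n ∈ Ioc X (2 * X), hE (EE Y r) n * (if Gd (r + 1) n then Lk (r + 1) n else 0) -
      (if (∃ s, Y < s ∧ s ^ 2 ∣ n) then W else 0) ≤ (-1) ^ (r + 1) * (hE (EE Y r) n * wt n * Lk (r + 1) n) := by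
    intro n hn
    rw [mem_Ioc] at hn
    by_cases hg : Gd (r + 1) n
    · rw [if_pos hg, wt_good hg]
      have e1 : ((-1 : ℝ)) ^ (r + 1) * (hE (EE Y r) n * (-1) ^ (r + 1) * Lk (r + 1) n) =
        hE (EE Y r) n * Lk (r + 1) n := by
        have : ((-1 : ℝ)) ^ (r + 1) * (-1) ^ (r + 1) = 1 := by rw [← mul_pow]; simp
        linear_combination hE (EE Y r) n * Lk (r + 1) n * this
      rw [e1]
      have : (0 : ℝ) ≤ (if (∃ s, Y < s ∧ s ^ 2 ∣ n) then W else 0) := by split_ifs <;> simp [hW0]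
      linarith
    · rw [if_neg hg, mul_zero, zero_sub]
      by_cases hz : hE (EE Y r) n * wt n * Lk (r + 1) n = 0
      · rw [hz, mul_zero]
        have : (0 : ℝ) ≤ (if (∃ s, Y < s ∧ s ^ 2 ∣ n) then W else 0) := by split_ifs <;> simp [hW0]
        linarith
      · have z1 : Lk (r + 1) n ≠ 0 := right_ne_zero_of_mul hz
        have z2 : hE (EE Y r) n ≠ 0 := left_ne_zero_of_mul (left_ne_zero_of_mul hz)
        have z3 : ∃ e ∈ EE Y r, e ∣ n := by
          unfold hE at z2
          have z4 : ((EE Y r).filter (· ∣ n)).card ≠ 0 := by exact_mod_cast z2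
          rw [Finset.card_ne_zero] at z4
          obtain ⟨e, he⟩ := z4
          rw [mem_filter] at he
          exact ⟨e, he⟩
        obtain ⟨e, he, hen⟩ := z3
        rcases classify Y q r n e hY2 hq he hen hn.1 (Lk_supp _ _ z1) with h | h
        · exact absurd h hg
        · rw [if_pos h]
          have b1 := hE_le Y q r n hY2 (by omega) hn.2
          have b2 := abs_wt n
          have b3 : Lk (r + 1) n ≤ Real.log (2 * X) ^ (r + 1) := by
            refine (Lk_le _ _ (by omega)).trans ?_
            have hn0 : (0 : ℝ) < n := by
              have : 0 < n := by omega
              exact_mod_cast this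
            have hn2 : (n : ℝ) ≤ 2 * X := by exact_mod_cast hn.2
            have := Real.log_natCast_nonneg n
            gcongr
          have b4 : |(-1) ^ (r + 1) * (hE (EE Y r) n * wt n * Lk (r + 1) n)| ≤ W := by
            rw [abs_mul, abs_mul, abs_mul, abs_pow, abs_neg, abs_one, one_pow, one_mul,
              abs_of_nonneg (hE_nonneg _ _), abs_of_nonneg (Lk_nonneg _ _), hW]
            have := hE_nonneg (EE Y r) n
            have := Lk_nonneg (r + 1) n
            gcongr
          exact (abs_le.1 b4).1
  have hsum := Finset.sum_le_sum hpt
  rw [← Finset.mul_sum, Finset.sum_sub_distrib, ← Finset.sum_filter, Finset.sum_const, nsmul_eq_mul] at hsum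
  have hbad := bad_count X Y (by omega) (by omega)
  refine le_trans ?_ hsum
  have hXr : (0 : ℝ) < X := by linarith
  have hm : Real.log Y ^ r * ((X : ℝ) / 4) * c ≤ Real.log Y ^ r * ((X : ℝ) / 4) *
      (∑ S ∈ powersetCard r (PP Y), ∏ p ∈ S, 1 / (p : ℝ)) := by gcongr
  have hb2 : (((Ioc X (2 * X)).filter (fun n => ∃ s, Y < s ∧ s ^ 2 ∣ n)).card : ℝ) * W ≤
      Real.log Y ^ r * ((X : ℝ) / 8) * c := by
    have hYp : (0 : ℝ) < Y := by linarith
    calc _ ≤ 2 * X / Y * W := by gcongr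
      _ ≤ 2 * X / Y * (2 ^ (q + 1) * 2 * ((q + 1) * Real.log Y) ^ (r + 1)) := by
          rw [hW]; gcongr
      _ = (A * Real.log Y / Y) * (Real.log Y ^ r * ((X : ℝ) / 8) * c) := by
          rw [hA, mul_pow, pow_succ (Real.log Y)]; field_simp; ring
      _ ≤ 1 * (Real.log Y ^ r * ((X : ℝ) / 8) * c) := by
          gcongr
          rw [div_le_one hYp]
          have := log_pow_le 2 (x := Y) (by linarith)
          norm_num [Nat.factorial] at this
          nlinarith
      _ = _ := one_mul _
  have hfin : c / (8 * q ^ r) * X * Real.log X ^ r = Real.log Y ^ r * ((X : ℝ) / 8) * c := by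
    rw [hlX, mul_pow]; field_simp
  rw [hfin]
  linarith


lemma restrict_sum (X : ℕ) (x : ℝ) (hx : (X : ℝ) ≤ x) (P : ℕ → Prop) [DecidablePred P] (g : ℕ → ℝ) :
    ∑ n ∈ (Icc 1 ⌊x⌋₊).filter P, (if n ∈ Ioc X (2 * X) then g n else 0) =
    ∑ n ∈ (Ioc X (min ⌊x⌋₊ (2 * X))).filter P, g n := by
  rw [← Finset.sum_filter]
  apply Finset.sum_congr _ (fun _ _ => rfl)
  ext n
  simp only [mem_filter, mem_Icc, mem_Ioc, le_min_iff]
  constructor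
  · rintro ⟨⟨⟨_, h2⟩, h3⟩, h4, h5⟩
    exact ⟨⟨h4, h2, h5⟩, h3⟩
  · rintro ⟨⟨h4, h2, h5⟩, h3⟩
    exact ⟨⟨⟨by omega, h2⟩, h3⟩, h4, h5⟩

lemma ev_log (m : ℕ) (s A : ℝ) (hs : 0 < s) : ∀ᶠ x : ℝ in atTop, A * Real.log x ^ m ≤ x ^ s := by
  have h := (isLittleO_log_rpow_rpow_atTop (m : ℝ) hs).bound (c := (|A| + 1)⁻¹) (by positivity)
  filter_upwards [h, eventually_ge_atTop 1] with x hx hx1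
  have hl := Real.log_nonneg hx1
  rw [Real.rpow_natCast, Real.norm_of_nonneg (by positivity), Real.norm_of_nonneg (by positivity),
    inv_mul_eq_div, le_div_iff₀ (by positivity)] at hx
  have : 0 ≤ Real.log x ^ m := by positivity
  nlinarith [le_abs_self A]

/-- generic R bound at one scale -/
lemma R_all (c ν : ℝ) (hc : 0 < c) (hc1 : c < 1) (hν0 : 0 < ν) (hν1 : ν < 1) (hcν : (1 + c) * ν + c ≤ 1 - c) (m : ℕ) :
    ∃ X0 : ℕ, ∀ X Z : ℕ, ∀ E : Finset ℕ, ∀ s : ℝ, X0 ≤ X → (Z : ℝ) ≤ (X : ℝ) ^ c → E ⊆ Icc 1 Z → |s| ≤ 1 →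
      (∀ n ∈ Ioc X (2 * X), |s * (hE E n * wt n)| ≤ 1) → ∀ x : ℝ, (X : ℝ) ≤ x →
      ∑ d ∈ Icc 1 ⌊x ^ ν⌋₊, |∑ n ∈ (Icc 1 ⌊x⌋₊).filter (fun n => d ∣ n),
        (if n ∈ Ioc X (2 * X) then s * (hE E n * wt n) else 0)| ≤ x / Real.log x ^ m := by
  obtain ⟨K, hK, hR⟩ := R_mid c hc hc1 (m + 1)
  have e1 := ev_log (m + 1) (c / (1 + c)) 4 (by positivity)
  obtain ⟨x1, hx1⟩ := eventually_atTop.1 e1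
  obtain ⟨x2, hx2⟩ := eventually_atTop.1 (Real.tendsto_log_atTop.eventually_ge_atTop (K * 2 ^ m))
  refine ⟨max 3 (max ⌈x1⌉₊ ⌈x2⌉₊), ?_⟩
  intro X Z E s hX hZ hE' hs hs1 x hx
  have hX3 : 3 ≤ X := (le_max_left _ _).trans hX
  have hXx1 : x1 ≤ X := (Nat.le_ceil _).trans (by exact_mod_cast (le_max_left _ _).trans ((le_max_right _ _).trans hX))
  have hXx2 : x2 ≤ X := (Nat.le_ceil _).trans (by exact_mod_cast (le_max_right _ _).trans ((le_max_right _ _).trans hX))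
  have hX3' : (3 : ℝ) ≤ X := by exact_mod_cast hX3
  have hX0 : (0 : ℝ) < X := by linarith
  have hx0 : 0 < x := by linarith
  have hlX := one_le_log hX3'
  have hlx := one_le_log (hX3'.trans hx)
  have hXN : X ≤ min ⌊x⌋₊ (2 * X) := le_min (Nat.le_floor hx) (by omega)
  simp_rw [restrict_sum X x hx]
  by_cases hcase : x ≤ (X : ℝ) ^ (1 + c)
  · have hD : (⌊x ^ ν⌋₊ : ℝ) ≤ (X : ℝ) ^ ((1 + c) * ν) := by
      refine (Nat.floor_le (by positivity)).trans ?_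
      rw [Real.rpow_mul hX0.le]
      exact Real.rpow_le_rpow hx0.le hcase hν0.le
    have hDZ : ((⌊x ^ ν⌋₊ * Z : ℕ) : ℝ) ≤ (X : ℝ) ^ (1 - c) := by
      push_cast
      calc _ ≤ (X : ℝ) ^ ((1 + c) * ν) * (X : ℝ) ^ c := by gcongr
        _ = (X : ℝ) ^ ((1 + c) * ν + c) := by rw [Real.rpow_add hX0]
        _ ≤ _ := Real.rpow_le_rpow_of_exponent_le (by linarith) hcν
    have h1 := hR X ⌊x ^ ν⌋₊ Z (min ⌊x⌋₊ (2 * X)) E hX3 hDZ hE' hXN (min_le_right _ _)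
    have hlog : Real.log x ≤ 2 * Real.log X := by
      have := Real.log_le_log hx0 hcase
      rw [Real.log_rpow hX0] at this
      nlinarith
    calc _ ≤ ∑ d ∈ Icc 1 ⌊x ^ ν⌋₊, |∑ n ∈ (Ioc X (min ⌊x⌋₊ (2 * X))).filter (fun n => d ∣ n), hE E n * wt n| := by
          apply Finset.sum_le_sum
          intro d _
          rw [← Finset.mul_sum, abs_mul]
          exact mul_le_of_le_one_left (abs_nonneg _) hs
      _ ≤ K * X / Real.log X ^ (m + 1) := h1
      _ ≤ x / Real.log x ^ m := by
          rw [div_le_div_iff₀ (by positivity) (by positivity)]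
          calc K * X * Real.log x ^ m ≤ K * X * (2 * Real.log X) ^ m := by gcongr
            _ = X * (K * 2 ^ m) * Real.log X ^ m := by rw [mul_pow]; ring
            _ ≤ x * Real.log X * Real.log X ^ m := by
                gcongr
                exact hx2 _ hXx2
            _ = _ := by ring
  · push Not at hcase
    have h0 : ∀ d ∈ Icc 1 ⌊x ^ ν⌋₊, |∑ n ∈ (Ioc X (min ⌊x⌋₊ (2 * X))).filter (fun n => d ∣ n), s * (hE E n * wt n)| ≤
        2 * X * (1 / (d : ℝ)) := by
      intro d hd
      rw [mem_Icc] at hd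
      refine (Finset.abs_sum_le_sum_abs _ _).trans ?_
      calc _ ≤ ∑ n ∈ (Ioc X (min ⌊x⌋₊ (2 * X))).filter (fun n => d ∣ n), (1 : ℝ) := by
            apply Finset.sum_le_sum
            intro n hn
            rw [mem_filter, mem_Ioc] at hn
            exact hs1 n (mem_Ioc.2 ⟨hn.1.1, hn.1.2.trans (min_le_right _ _)⟩)
        _ ≤ ∑ n ∈ (Icc 1 (2 * X)).filter (fun n => d ∣ n), (1 : ℝ) := by
            apply Finset.sum_le_sum_of_subset_of_nonneg
            · intro n hn
              rw [mem_filter, mem_Ioc] at hn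
              rw [mem_filter, mem_Icc]
              exact ⟨⟨by omega, hn.1.2.trans (min_le_right _ _)⟩, hn.2⟩
            · intros; norm_num
        _ = ((2 * X / d : ℕ) : ℝ) := by
            rw [sum_dvd_Icc _ _ _ hd.1]
            simp
        _ ≤ _ := by
            refine Nat.cast_div_le.trans ?_
            push_cast
            rw [div_eq_mul_one_div]
    have hD : (⌊x ^ ν⌋₊ : ℝ) ≤ x := by
      refine (Nat.floor_le (by positivity)).trans ?_
      calc x ^ ν ≤ x ^ (1 : ℝ) := Real.rpow_le_rpow_of_exponent_le (by linarith) hν1.le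
        _ = x := Real.rpow_one x
    have hlD : Real.log ⌊x ^ ν⌋₊ ≤ Real.log x := by
      rcases Nat.eq_zero_or_pos ⌊x ^ ν⌋₊ with h | h
      · rw [h]; simp; linarith
      · exact Real.log_le_log (by exact_mod_cast h) hD
    have hXle : (X : ℝ) ≤ x ^ (1 / (1 + c)) := by
      have := Real.rpow_le_rpow (by positivity) hcase.le (show 0 ≤ 1 / (1 + c) by positivity)
      rwa [← Real.rpow_mul hX0.le, mul_one_div_cancel (by linarith), Real.rpow_one] at this
    calc _ ≤ ∑ d ∈ Icc 1 ⌊x ^ ν⌋₊, 2 * X * (1 / (d : ℝ)) := Finset.sum_le_sum h0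
      _ ≤ 2 * X * (1 + Real.log ⌊x ^ ν⌋₊) := by
          rw [← Finset.mul_sum]
          gcongr
          exact harm_le _
      _ ≤ 2 * x ^ (1 / (1 + c)) * (2 * Real.log x) := by
          gcongr
          linarith
      _ ≤ x / Real.log x ^ m := by
          rw [le_div_iff₀ (by positivity)]
          calc _ = x ^ (1 / (1 + c)) * (4 * Real.log x ^ (m + 1)) := by ring
            _ ≤ x ^ (1 / (1 + c)) * x ^ (c / (1 + c)) := by
                gcongr
                exact hx1 _ (hXx1.trans hx)
            _ = x := by
                rw [← Real.rpow_add hx0, ← add_div, div_self (by linarith), Real.rpow_one]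

lemma par_all (c : ℝ) (hc4 : c ≤ 1 / 4) (m : ℕ) :
    ∃ X0 : ℕ, ∀ X Z : ℕ, ∀ E : Finset ℕ, ∀ s : ℝ, X0 ≤ X → (Z : ℝ) ≤ (X : ℝ) ^ c → E ⊆ Icc 1 Z → |s| ≤ 1 →
      (∀ e ∈ E, ¬ 2 ∣ e) → ∀ x : ℝ, (X : ℝ) ≤ x →
      |∑ n ∈ Icc 1 ⌊x⌋₊, (if n ∈ Ioc X (2 * X) then s * (hE E n * wt n) else 0) * (ArithmeticFunction.moebius n : ℝ)|
        ≤ x / Real.log x ^ m := by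
  obtain ⟨x1, hx1⟩ := eventually_atTop.1 (ev_log m (1 / 4) 4 (by norm_num))
  refine ⟨max 3 ⌈x1⌉₊, ?_⟩
  intro X Z E s hX hZ hE' hs hodd x hx
  have hX3 : 3 ≤ X := (le_max_left _ _).trans hX
  have hXx1 : x1 ≤ X := (Nat.le_ceil _).trans (by exact_mod_cast (le_max_right _ _).trans hX)
  have hX3' : (3 : ℝ) ≤ X := by exact_mod_cast hX3
  have hX0 : (0 : ℝ) < X := by linarith
  have hx0 : 0 < x := by linarith
  have hlx := one_le_log (hX3'.trans hx)
  have hXN : X ≤ min ⌊x⌋₊ (2 * X) := le_min (Nat.le_floor hx) (by omega)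
  have h1 := restrict_sum X x hx (fun _ => True) (fun n => s * (hE E n * wt n) * (ArithmeticFunction.moebius n : ℝ))
  simp only [Finset.filter_true] at h1
  simp_rw [ite_mul, zero_mul]
  rw [h1]
  have h2 := par_mid X Z (min ⌊x⌋₊ (2 * X)) E hXN (min_le_right _ _) hE' hodd
  simp_rw [mul_assoc s]
  rw [← Finset.mul_sum, abs_mul]
  have hsq : (Nat.sqrt (2 * X) : ℝ) ≤ 2 * (X : ℝ) ^ (1 / 2 : ℝ) := by
    rw [← Real.sqrt_eq_rpow]
    calc (Nat.sqrt (2 * X) : ℝ) ≤ √((2 * X : ℕ) : ℝ) := Real.nat_sqrt_le_real_sqrt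
      _ ≤ √(2 ^ 2 * (X : ℝ)) := by
          apply Real.sqrt_le_sqrt
          push_cast
          linarith
      _ = 2 * √(X : ℝ) := by
          rw [Real.sqrt_mul (by norm_num), Real.sqrt_sq (by norm_num)]
  calc _ ≤ 1 * (2 * (Z : ℝ) * Nat.sqrt (2 * X)) := by gcongr
    _ ≤ 1 * (2 * (X : ℝ) ^ c * (2 * (X : ℝ) ^ (1 / 2 : ℝ))) := by gcongr
    _ = 4 * ((X : ℝ) ^ c * (X : ℝ) ^ (1 / 2 : ℝ)) := by ring
    _ ≤ 4 * ((X : ℝ) ^ (1 / 4 : ℝ) * (X : ℝ) ^ (1 / 2 : ℝ)) := by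
        gcongr
        linarith
    _ ≤ 4 * x ^ (3 / 4 : ℝ) := by
        rw [← Real.rpow_add hX0]
        norm_num
        gcongr
    _ ≤ _ := by
        rw [le_div_iff₀ (by positivity)]
        calc _ = x ^ (3 / 4 : ℝ) * (4 * Real.log x ^ m) := by ring
          _ ≤ x ^ (3 / 4 : ℝ) * x ^ (1 / 4 : ℝ) := by
              gcongr
              exact hx1 _ (hXx1.trans hx)
          _ = x := by
              rw [← Real.rpow_add hx0]
              norm_num


lemma scale (ν : ℝ) (hν0 : 0 < ν) (hν1 : ν < 1) (k : ℕ) (hk : 2 ≤ k) : ∃ δ : ℝ, 0 < δ ∧ ∀ m M0 : ℕ, ∃ X : ℕ,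
    M0 ≤ X ∧ 3 ≤ X ∧ ∀ T : ℝ, ∃ f : ℕ → ℝ,
    (∀ n, |f n| ≤ 1) ∧ (∀ n, n ∉ Ioc X (2 * X) → f n = 0) ∧ (∀ p, p.Prime → f p = 0) ∧
    (∀ x : ℝ, (X : ℝ) ≤ x → ∑ d ∈ Icc 1 ⌊x ^ ν⌋₊, |∑ n ∈ (Icc 1 ⌊x⌋₊).filter (fun n => d ∣ n), f n| ≤ x / Real.log x ^ m) ∧
    (∀ x : ℝ, (X : ℝ) ≤ x → |∑ n ∈ Icc 1 ⌊x⌋₊, f n * (ArithmeticFunction.moebius n : ℝ)| ≤ x / Real.log x ^ m) ∧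
    δ * X * Real.log X ^ (k - 1) ≤ |T + ∑ n ∈ Ioc X (2 * X), f n * Lk k n| := by
  obtain ⟨r, rfl⟩ : ∃ r, k = r + 1 := ⟨k - 1, by omega⟩
  have hr : 1 ≤ r := by omega
  simp only [Nat.add_sub_cancel]
  set c := (1 - ν) / 4 with hc
  have hc0 : 0 < c := by rw [hc]; linarith
  have hc1 : c < 1 := by rw [hc]; linarith
  have hc4 : c ≤ 1 / 4 := by rw [hc]; linarith
  have hcν : (1 + c) * ν + c ≤ 1 - c := by rw [hc]; nlinarith
  set q := max (2 * r + 3) ⌈2 * r / c⌉₊ with hq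
  have hq3 : 2 * r + 3 ≤ q := le_max_left _ _
  have hqc : 2 * (r : ℝ) ≤ q * c := by
    rw [← div_le_iff₀ hc0]
    exact (Nat.le_ceil _).trans (Nat.cast_le.2 (le_max_right _ _))
  obtain ⟨δ, hδ, J0, hS⟩ := Sk_main r q hq3
  set A : ℝ := 2 * 2 ^ (q + 1) with hA
  have hA1 : 1 ≤ A := by
    rw [hA]; have : (1 : ℝ) ≤ 2 ^ (q + 1) := one_le_pow₀ (by norm_num)
    linarith
  refine ⟨δ / A, by positivity, ?_⟩
  intro m M0
  obtain ⟨X1, hX1⟩ := R_all c ν hc0 hc1 hν0 hν1 hcν m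
  obtain ⟨X2, hX2⟩ := par_all c hc4 m
  set J := max (max J0 (max M0 3)) (max X1 X2) with hJ
  set Y := 2 ^ J with hY
  have hJY : J < Y := Nat.lt_two_pow_self
  have hY2 : 2 ≤ Y := by omega
  set X := Y ^ q with hX
  have hYX : Y ≤ X := Nat.le_self_pow (by omega) _
  have hX0 : X ≠ 0 := by omega
  have hZ : ((Y ^ (2 * r) : ℕ) : ℝ) ≤ (X : ℝ) ^ c := by
    rw [hX]
    push_cast
    rw [← Real.rpow_natCast, ← Real.rpow_natCast, ← Real.rpow_mul (by positivity)]
    apply Real.rpow_le_rpow_of_exponent_le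
    · exact_mod_cast (by omega : 1 ≤ Y)
    · push_cast; exact hqc
  have hHn : ∀ n ∈ Ioc X (2 * X), |hE (EE Y r) n * wt n| ≤ A := by
    intro n hn
    rw [mem_Ioc] at hn
    have h1 := hE_le Y q r n hY2 (by omega) hn.2
    have h2 := hE_nonneg (EE Y r) n
    have h3 := abs_wt n
    rw [abs_mul, abs_of_nonneg h2, hA]
    nlinarith [abs_nonneg (wt n)]
  refine ⟨X, by omega, by omega, ?_⟩
  intro T
  set G := ∑ n ∈ Ioc X (2 * X), hE (EE Y r) n * wt n * Lk (r + 1) n with hG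
  have hGl : δ * X * Real.log X ^ r ≤ |G| := by
    have := hS J (by omega)
    refine this.trans ((le_abs_self _).trans ?_)
    rw [abs_mul, abs_pow, abs_neg, abs_one, one_pow, one_mul]
  obtain ⟨σ, hσ, hσG⟩ : ∃ σ : ℝ, |σ| = 1 ∧ 0 ≤ T * (σ * G) := by
    by_cases h : 0 ≤ T * G
    · exact ⟨1, by simp, by simpa using h⟩
    · exact ⟨-1, by simp, by push Not at h; nlinarith⟩
  set s := σ / A with hs
  have hsa : |s| = 1 / A := by
    rw [hs, abs_div, hσ, abs_of_pos (by linarith)]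
  have hs1 : |s| ≤ 1 := by
    rw [hsa, div_le_one (by linarith)]; exact hA1
  have hsn : ∀ n ∈ Ioc X (2 * X), |s * (hE (EE Y r) n * wt n)| ≤ 1 := by
    intro n hn
    rw [abs_mul, hsa, one_div_mul_eq_div, div_le_one (by linarith)]
    exact hHn n hn
  refine ⟨fun n => if n ∈ Ioc X (2 * X) then s * (hE (EE Y r) n * wt n) else 0, ?_, ?_, ?_, ?_, ?_, ?_⟩
  · intro n
    dsimp only
    split_ifs with h
    · exact hsn n h
    · simp
  · intro n hn
    dsimp only
    rw [if_neg hn]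
  · intro p hp
    dsimp only
    split_ifs with h
    · have h0 : hE (EE Y r) p = 0 := by
        unfold hE
        rw [Nat.cast_eq_zero, card_eq_zero, filter_eq_empty_iff]
        intro e he hep
        obtain ⟨hm1, hm2, hm3⟩ := EE_mem he
        rw [mem_Ioc] at h
        rcases (Nat.dvd_prime hp).1 hep with h1 | h1
        · rw [h1] at hm2
          simp at hm2
          omega
        · have h2 := EE_le he
          have h3 : Y ^ (2 * r) ≤ X := Nat.pow_le_pow_right (by omega) (by omega)
          omega
      rw [h0]; ring
    · rfl
  · intro x hx
    exact hX1 X (Y ^ (2 * r)) (EE Y r) s (by omega) hZ (EE_sub Y r) hs1 hsn x hx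
  · intro x hx
    exact hX2 X (Y ^ (2 * r)) (EE Y r) s (by omega) hZ (EE_sub Y r) hs1 (fun e he => EE_odd hY2 he) x hx
  · have h1 : ∑ n ∈ Ioc X (2 * X), (if n ∈ Ioc X (2 * X) then s * (hE (EE Y r) n * wt n) else 0) * Lk (r + 1) n = s * G := by
      rw [hG, Finset.mul_sum]
      apply Finset.sum_congr rfl
      intro n hn
      rw [if_pos hn]; ring
    dsimp only
    rw [h1]
    have h2 : δ / A * X * Real.log X ^ r ≤ |s * G| := by
      rw [abs_mul, hsa]
      calc _ = 1 / A * (δ * X * Real.log X ^ r) := by ring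
        _ ≤ _ := by gcongr
    have h3 : 0 ≤ T * (s * G) := by
      have : T * (s * G) = T * (σ * G) / A := by rw [hs]; ring
      rw [this]; exact div_nonneg hσG (by linarith)
    refine h2.trans ?_
    apply sq_le_sq.1
    nlinarith [sq_nonneg T]


lemma finish (g : ℝ → ℝ) (A : ℝ) (hA : 0 ≤ A) (hg : ∀ x : ℝ, 2 ≤ x → g x ≤ A * x ^ 2)
    (h : ∀ m : ℕ, ∃ K x0 : ℝ, 0 ≤ K ∧ ∀ x : ℝ, x0 ≤ x → g x ≤ K * x / Real.log x ^ m) (B : ℝ) (hB : 0 < B) :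
    ∃ C : ℝ, ∀ x : ℝ, 2 ≤ x → g x ≤ C * x * Real.log x ^ (-B) := by
  obtain ⟨K, x0, hK, h1⟩ := h ⌈B⌉₊
  set y := max x0 3 with hy
  have hy3 : 3 ≤ y := le_max_right _ _
  have hly := one_le_log hy3
  refine ⟨K + A * y * Real.log y ^ B, ?_⟩
  intro x hx
  have hlx : 0 < Real.log x := Real.log_pos (by linarith)
  have hp : 0 < Real.log x ^ (-B) := by positivity
  rcases le_total y x with hyx | hyx
  · have h2 := h1 x ((le_max_left _ _).trans hyx)
    have h3 := one_le_log (hy3.trans hyx)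
    have h4 : (Real.log x ^ ⌈B⌉₊)⁻¹ ≤ Real.log x ^ (-B) := by
      rw [Real.rpow_neg hlx.le, ← Real.rpow_natCast]
      gcongr
      exact Nat.le_ceil _
    calc g x ≤ K * x * (Real.log x ^ ⌈B⌉₊)⁻¹ := by rw [← div_eq_mul_inv]; exact h2
      _ ≤ K * x * Real.log x ^ (-B) := by gcongr
      _ ≤ _ := by
          gcongr
          have : 0 ≤ A * y * Real.log y ^ B := by positivity
          linarith
  · have h4 : (Real.log y ^ B)⁻¹ ≤ Real.log x ^ (-B) := by
      rw [Real.rpow_neg hlx.le]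
      gcongr
    calc g x ≤ A * x ^ 2 := hg x hx
      _ ≤ A * y * x := by
          have : x ^ 2 ≤ y * x := by nlinarith
          calc _ ≤ A * (y * x) := by gcongr
            _ = _ := by ring
      _ = A * y * Real.log y ^ B * x * (Real.log y ^ B)⁻¹ := by
          field_simp
      _ ≤ A * y * Real.log y ^ B * x * Real.log x ^ (-B) := by gcongr
      _ ≤ _ := by
          gcongr
          linarith

lemma find_scale (xs : ℕ → ℕ) (hm : StrictMono xs) (m : ℕ) (x : ℝ) (hx : (xs m : ℝ) ≤ x) :
    ∃ j, m ≤ j ∧ (xs j : ℝ) ≤ x ∧ x < xs (j + 1) := by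
  have hx0 : 0 ≤ x := le_trans (by positivity) hx
  have h1 : xs m ≤ ⌊x⌋₊ := Nat.le_floor hx
  set j := Nat.findGreatest (fun i => xs i ≤ ⌊x⌋₊) ⌊x⌋₊ with hj
  have hmle : m ≤ ⌊x⌋₊ := (hm.id_le m).trans h1
  have h2 : xs j ≤ ⌊x⌋₊ := Nat.findGreatest_spec (P := fun i => xs i ≤ ⌊x⌋₊) hmle h1
  refine ⟨j, Nat.le_findGreatest hmle h1, (Nat.le_floor_iff hx0).1 h2, ?_⟩
  by_contra hcon
  push Not at hcon
  have h3 : xs (j + 1) ≤ ⌊x⌋₊ := Nat.le_floor hcon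
  have h4 : j + 1 ≤ j := Nat.le_findGreatest ((hm.id_le _).trans h3) h3
  omega

open Classical in
noncomputable def FF (xs : ℕ → ℕ) (f : ℕ → ℕ → ℝ) (n : ℕ) : ℝ :=
  if h : ∃ j, n ∈ Ioc (xs j) (2 * xs j) then f h.choose n else 0

lemma FF_eq (xs : ℕ → ℕ) (f : ℕ → ℕ → ℝ) (hm : StrictMono xs) (hg : ∀ j, 2 * xs j ≤ xs (j + 1)) (j n : ℕ)
    (hn : n ∈ Ioc (xs j) (2 * xs j)) : FF xs f n = f j n := by
  have h : ∃ j, n ∈ Ioc (xs j) (2 * xs j) := ⟨j, hn⟩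
  unfold FF
  rw [dif_pos h]
  have h1 := h.choose_spec
  generalize h.choose = i at h1
  rw [mem_Ioc] at hn h1
  have : i = j := by
    rcases lt_trichotomy i j with hij | hij | hij
    · have := hm.monotone (Nat.succ_le_of_lt hij)
      have := hg i
      simp only [Nat.succ_eq_add_one] at *
      omega
    · exact hij
    · have := hm.monotone (Nat.succ_le_of_lt hij)
      have := hg j
      simp only [Nat.succ_eq_add_one] at *
      omega
  rw [this]

lemma FF_abs (xs : ℕ → ℕ) (f : ℕ → ℕ → ℝ) (hf : ∀ j n, |f j n| ≤ 1) (n : ℕ) : |FF xs f n| ≤ 1 := by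
  unfold FF
  split_ifs
  · exact hf _ _
  · simp

lemma FF_prime (xs : ℕ → ℕ) (f : ℕ → ℕ → ℝ) (hf : ∀ j p, Nat.Prime p → f j p = 0) (p : ℕ) (hp : p.Prime) :
    FF xs f p = 0 := by
  unfold FF
  split_ifs
  · exact hf _ _ hp
  · rfl

lemma FF_diff (xs : ℕ → ℕ) (f : ℕ → ℕ → ℝ) (hm : StrictMono xs) (hg : ∀ j, 2 * xs j ≤ xs (j + 1))
    (hf : ∀ j n, |f j n| ≤ 1) (hs : ∀ j n, n ∉ Ioc (xs j) (2 * xs j) → f j n = 0) (j n : ℕ)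
    (hn : n ≤ xs (j + 2)) : |FF xs f n - f (j + 1) n| ≤ if n ≤ 2 * xs j then 1 else 0 := by
  by_cases h1 : n ∈ Ioc (xs (j + 1)) (2 * xs (j + 1))
  · rw [FF_eq xs f hm hg _ _ h1, sub_self, abs_zero]
    split_ifs <;> norm_num
  · rw [hs _ _ h1, sub_zero]
    split_ifs with h2
    · exact FF_abs xs f hf n
    · have : FF xs f n = 0 := by
        unfold FF
        rw [dif_neg]
        rintro ⟨i, hi⟩
        by_cases hij : i = j + 1
        · exact h1 (hij ▸ hi)
        rw [mem_Ioc] at hi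
        have hi2 : i < j + 2 := hm.lt_iff_lt.1 (lt_of_lt_of_le hi.1 hn)
        have := hm.monotone (show i ≤ j by omega)
        omega
      rw [this]; simp

/-- earlier scales are negligible -/
lemma FF_R (ν : ℝ) (xs : ℕ → ℕ) (f : ℕ → ℕ → ℝ) (hm : StrictMono xs) (hg : ∀ j, 2 * xs j ≤ xs (j + 1))
    (hg4 : ∀ j, (2 * xs j) ^ 4 ≤ xs (j + 1)) (h3 : ∀ j, 3 ≤ xs j)
    (hf : ∀ j n, |f j n| ≤ 1) (hs : ∀ j n, n ∉ Ioc (xs j) (2 * xs j) → f j n = 0)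
    (hR : ∀ j, ∀ x : ℝ, (xs j : ℝ) ≤ x → ∑ d ∈ Icc 1 ⌊x ^ ν⌋₊, |∑ n ∈ (Icc 1 ⌊x⌋₊).filter (fun n => d ∣ n), f j n| ≤ x / Real.log x ^ j)
    (m : ℕ) (x : ℝ) (hx : (xs (m + 1) : ℝ) ≤ x) :
    ∑ d ∈ Icc 1 ⌊x ^ ν⌋₊, |∑ n ∈ (Icc 1 ⌊x⌋₊).filter (fun n => d ∣ n), FF xs f n| ≤ x / Real.log x ^ m + √x := by
  obtain ⟨i, hmi, hi1, hi2⟩ := find_scale xs hm (m + 1) x hx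
  obtain ⟨j, rfl⟩ : ∃ j, i = j + 1 := ⟨i - 1, by omega⟩
  have hx3 : 3 ≤ x := le_trans (by exact_mod_cast h3 (m + 1)) hx
  have hlx := one_le_log hx3
  set W := 2 * xs j with hW
  have hWx : ((W : ℝ) ^ 2) ≤ √x := by
    apply Real.le_sqrt_of_sq_le
    calc ((W : ℝ) ^ 2) ^ 2 = ((W ^ 4 : ℕ) : ℝ) := by push_cast; ring
      _ ≤ xs (j + 1) := by exact_mod_cast hg4 j
      _ ≤ x := hi1
  have h1 : ∑ d ∈ Icc 1 ⌊x ^ ν⌋₊, |∑ n ∈ (Icc 1 ⌊x⌋₊).filter (fun n => d ∣ n), (FF xs f n - f (j + 1) n)| ≤ √x := by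
    calc _ ≤ ∑ d ∈ Icc 1 ⌊x ^ ν⌋₊, ∑ n ∈ (Icc 1 ⌊x⌋₊), if d ∣ n ∧ n ≤ W then (1 : ℝ) else 0 := by
          apply Finset.sum_le_sum
          intro d _
          refine (Finset.abs_sum_le_sum_abs _ _).trans ?_
          rw [Finset.sum_filter]
          apply Finset.sum_le_sum
          intro n hn
          rw [mem_Icc] at hn
          have hn2 : n ≤ xs (j + 2) := by
            have : (n : ℝ) ≤ x := (Nat.le_floor_iff (by linarith)).1 hn.2
            exact_mod_cast (this.trans hi2.le)
          have := FF_diff xs f hm hg hf hs j n hn2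
          by_cases hd : d ∣ n
          · simpa [hd] using this
          · simp [hd]
      _ = ∑ n ∈ Icc 1 ⌊x⌋₊, ∑ d ∈ Icc 1 ⌊x ^ ν⌋₊, (if d ∣ n ∧ n ≤ W then (1 : ℝ) else 0) := Finset.sum_comm
      _ ≤ ∑ n ∈ Icc 1 ⌊x⌋₊, (if n ≤ W then (W : ℝ) else 0) := by
          apply Finset.sum_le_sum
          intro n hn
          rw [mem_Icc] at hn
          split_ifs with hnW
          · rw [← Finset.sum_filter, Finset.sum_const, nsmul_eq_mul, mul_one]
            have : ((Icc 1 ⌊x ^ ν⌋₊).filter (fun d => d ∣ n ∧ n ≤ W)) ⊆ Icc 1 W := by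
              intro d hd
              rw [mem_filter, mem_Icc] at hd
              rw [mem_Icc]
              exact ⟨hd.1.1, (Nat.le_of_dvd (by omega) hd.2.1).trans hnW⟩
            have := card_le_card this
            rw [Nat.card_Icc] at this
            exact_mod_cast (by omega)
          · simp [hnW]
      _ ≤ (W : ℝ) ^ 2 := by
          rw [← Finset.sum_filter, Finset.sum_const, nsmul_eq_mul, sq]
          gcongr
          have : (Icc 1 ⌊x⌋₊).filter (fun n => n ≤ W) ⊆ Icc 1 W := by
            intro n hn
            rw [mem_filter, mem_Icc] at hn
            rw [mem_Icc]; exact ⟨hn.1.1, hn.2⟩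
          have := card_le_card this
          rw [Nat.card_Icc] at this
          omega
      _ ≤ √x := hWx
  calc _ ≤ ∑ d ∈ Icc 1 ⌊x ^ ν⌋₊, (|∑ n ∈ (Icc 1 ⌊x⌋₊).filter (fun n => d ∣ n), f (j + 1) n| +
        |∑ n ∈ (Icc 1 ⌊x⌋₊).filter (fun n => d ∣ n), (FF xs f n - f (j + 1) n)|) := by
        apply Finset.sum_le_sum
        intro d _
        refine le_trans (le_of_eq ?_) (abs_add_le _ _)
        rw [← Finset.sum_add_distrib]
        congr 1
        apply Finset.sum_congr rfl
        intros; ring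
    _ ≤ x / Real.log x ^ (j + 1) + √x := by
        rw [Finset.sum_add_distrib]
        exact add_le_add (hR (j + 1) x hi1) h1
    _ ≤ _ := by
        gcongr
        omega

lemma FF_par (xs : ℕ → ℕ) (f : ℕ → ℕ → ℝ) (hm : StrictMono xs) (hg : ∀ j, 2 * xs j ≤ xs (j + 1))
    (hg4 : ∀ j, (2 * xs j) ^ 4 ≤ xs (j + 1)) (h3 : ∀ j, 3 ≤ xs j)
    (hf : ∀ j n, |f j n| ≤ 1) (hs : ∀ j n, n ∉ Ioc (xs j) (2 * xs j) → f j n = 0)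
    (hP : ∀ j, ∀ x : ℝ, (xs j : ℝ) ≤ x → |∑ n ∈ Icc 1 ⌊x⌋₊, f j n * (ArithmeticFunction.moebius n : ℝ)| ≤ x / Real.log x ^ j)
    (m : ℕ) (x : ℝ) (hx : (xs (m + 1) : ℝ) ≤ x) :
    |∑ n ∈ Icc 1 ⌊x⌋₊, FF xs f n * (ArithmeticFunction.moebius n : ℝ)| ≤ x / Real.log x ^ m + √x := by
  obtain ⟨i, hmi, hi1, hi2⟩ := find_scale xs hm (m + 1) x hx
  obtain ⟨j, rfl⟩ : ∃ j, i = j + 1 := ⟨i - 1, by omega⟩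
  have hx3 : 3 ≤ x := le_trans (by exact_mod_cast h3 (m + 1)) hx
  have hlx := one_le_log hx3
  set W := 2 * xs j with hW
  have hWx : (W : ℝ) ≤ √x := by
    apply Real.le_sqrt_of_sq_le
    calc (W : ℝ) ^ 2 = ((W ^ 2 : ℕ) : ℝ) := by push_cast; ring
      _ ≤ ((W ^ 4 : ℕ) : ℝ) := by
        have : 0 < W := by have := h3 j; omega
        exact_mod_cast Nat.pow_le_pow_right this (by norm_num)
      _ ≤ xs (j + 1) := by exact_mod_cast hg4 j
      _ ≤ x := hi1
  have h1 : |∑ n ∈ Icc 1 ⌊x⌋₊, (FF xs f n - f (j + 1) n) * (ArithmeticFunction.moebius n : ℝ)| ≤ √x := by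
    refine (Finset.abs_sum_le_sum_abs _ _).trans ?_
    calc _ ≤ ∑ n ∈ Icc 1 ⌊x⌋₊, (if n ≤ W then (1 : ℝ) else 0) := by
          apply Finset.sum_le_sum
          intro n hn
          rw [mem_Icc] at hn
          have hn2 : n ≤ xs (j + 2) := by
            have : (n : ℝ) ≤ x := (Nat.le_floor_iff (by linarith)).1 hn.2
            exact_mod_cast (this.trans hi2.le)
          have h5 := FF_diff xs f hm hg hf hs j n hn2
          rw [abs_mul]
          have h6 : |(ArithmeticFunction.moebius n : ℝ)| ≤ 1 := by
            exact_mod_cast ArithmeticFunction.abs_moebius_le_one (n := n)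
          exact (mul_le_of_le_one_right (abs_nonneg _) h6).trans h5
      _ ≤ W := by
          rw [← Finset.sum_filter, Finset.sum_const, nsmul_eq_mul, mul_one]
          have : (Icc 1 ⌊x⌋₊).filter (fun n => n ≤ W) ⊆ Icc 1 W := by
            intro n hn
            rw [mem_filter, mem_Icc] at hn
            rw [mem_Icc]; exact ⟨hn.1.1, hn.2⟩
          have := card_le_card this
          rw [Nat.card_Icc] at this
          exact_mod_cast (by omega)
      _ ≤ √x := hWx
  calc _ = |∑ n ∈ Icc 1 ⌊x⌋₊, f (j + 1) n * (ArithmeticFunction.moebius n : ℝ) +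
        ∑ n ∈ Icc 1 ⌊x⌋₊, (FF xs f n - f (j + 1) n) * (ArithmeticFunction.moebius n : ℝ)| := by
        rw [← Finset.sum_add_distrib]
        congr 1
        apply Finset.sum_congr rfl
        intros; ring
    _ ≤ _ := abs_add_le _ _
    _ ≤ x / Real.log x ^ (j + 1) + √x := add_le_add (hP (j + 1) x hi1) h1
    _ ≤ _ := by
        gcongr
        omega


lemma Rcond_of (ν : ℝ) (hν0 : 0 < ν) (hν1 : ν < 1) (F : ℕ → ℝ) (hF : ∀ n, |F n| ≤ 1)
    (hR : ∀ m : ℕ, ∃ x0 : ℝ, ∀ x : ℝ, x0 ≤ x →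
      ∑ d ∈ Icc 1 ⌊x ^ ν⌋₊, |∑ n ∈ (Icc 1 ⌊x⌋₊).filter (fun n => d ∣ n), F n| ≤ x / Real.log x ^ m + √x) :
    Rcond ν (fun n => 1 + F n) := by
  have key : ∀ x : ℝ, 2 ≤ x → ∑ d ∈ Finset.Icc 1 ⌊x ^ ν⌋₊,
      |(∑ n ∈ (Finset.Icc 1 ⌊x⌋₊).filter (fun n => d ∣ n), (1 + F n)) - x / d| ≤
      x ^ ν + ∑ d ∈ Icc 1 ⌊x ^ ν⌋₊, |∑ n ∈ (Icc 1 ⌊x⌋₊).filter (fun n => d ∣ n), F n| := by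
    intro x hx
    calc _ ≤ ∑ d ∈ Icc 1 ⌊x ^ ν⌋₊, (1 + |∑ n ∈ (Icc 1 ⌊x⌋₊).filter (fun n => d ∣ n), F n|) := by
          apply Finset.sum_le_sum
          intro d hd
          rw [mem_Icc] at hd
          rw [Finset.sum_add_distrib, add_sub_right_comm]
          refine (abs_add_le _ _).trans ?_
          gcongr
          rw [sum_dvd_Icc _ _ _ hd.1]
          simp only [sum_const, Nat.card_Icc, Nat.add_sub_cancel, nsmul_eq_mul, mul_one]
          rw [← Nat.floor_div_natCast]
          have h1 := Nat.floor_le (show 0 ≤ x / d by positivity)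
          have h2 := Nat.lt_floor_add_one (x / d)
          rw [abs_le]
          constructor <;> linarith
      _ = (⌊x ^ ν⌋₊ : ℝ) + ∑ d ∈ Icc 1 ⌊x ^ ν⌋₊, |∑ n ∈ (Icc 1 ⌊x⌋₊).filter (fun n => d ∣ n), F n| := by
          rw [Finset.sum_add_distrib]; simp
      _ ≤ _ := by
          gcongr
          exact Nat.floor_le (by positivity)
  intro B hB
  refine finish _ 2 (by norm_num) ?_ ?_ B hB
  · intro x hx
    refine (key x hx).trans ?_
    have hxν : x ^ ν ≤ x := by
      calc x ^ ν ≤ x ^ (1 : ℝ) := Real.rpow_le_rpow_of_exponent_le (by linarith) hν1.le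
        _ = x := Real.rpow_one x
    have h1 : ∑ d ∈ Icc 1 ⌊x ^ ν⌋₊, |∑ n ∈ (Icc 1 ⌊x⌋₊).filter (fun n => d ∣ n), F n| ≤ ∑ d ∈ Icc 1 ⌊x ^ ν⌋₊, x := by
      apply Finset.sum_le_sum
      intro d _
      refine (Finset.abs_sum_le_sum_abs _ _).trans ?_
      calc _ ≤ ∑ n ∈ Icc 1 ⌊x⌋₊, |F n| :=
            Finset.sum_le_sum_of_subset_of_nonneg (filter_subset _ _) (fun _ _ _ => abs_nonneg _)
        _ ≤ ∑ n ∈ Icc 1 ⌊x⌋₊, (1 : ℝ) := Finset.sum_le_sum (fun n _ => hF n)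
        _ = (⌊x⌋₊ : ℝ) := by simp
        _ ≤ x := Nat.floor_le (by linarith)
    have h2 : ∑ d ∈ Icc 1 ⌊x ^ ν⌋₊, x ≤ x * x := by
      rw [Finset.sum_const, nsmul_eq_mul, Nat.card_Icc, Nat.add_sub_cancel]
      gcongr
      exact (Nat.floor_le (by positivity)).trans hxν
    nlinarith
  · intro m
    obtain ⟨x0, h0⟩ := hR m
    obtain ⟨x1, h1⟩ := eventually_atTop.1 (ev_log m (1 - ν) 1 (by linarith))
    obtain ⟨x2, h2⟩ := eventually_atTop.1 (ev_log m (1 / 2) 1 (by norm_num))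
    refine ⟨3, max (max x0 3) (max x1 x2), by norm_num, ?_⟩
    intro x hx
    have hx0 : x0 ≤ x := (le_max_left _ _).trans ((le_max_left _ _).trans hx)
    have hx3 : 3 ≤ x := (le_max_right _ _).trans ((le_max_left _ _).trans hx)
    have hx1 : x1 ≤ x := (le_max_left _ _).trans ((le_max_right _ _).trans hx)
    have hx2 : x2 ≤ x := (le_max_right _ _).trans ((le_max_right _ _).trans hx)
    have hlx := one_le_log hx3
    have hxp : 0 < x := by linarith
    have e1 : x ^ ν ≤ x / Real.log x ^ m := by
      rw [le_div_iff₀ (by positivity)]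
      calc _ = x ^ ν * (1 * Real.log x ^ m) := by ring
        _ ≤ x ^ ν * x ^ (1 - ν) := by gcongr; exact h1 x hx1
        _ = x := by rw [← Real.rpow_add hxp]; simp
    have e2 : √x ≤ x / Real.log x ^ m := by
      rw [le_div_iff₀ (by positivity)]
      calc _ = √x * (1 * Real.log x ^ m) := by ring
        _ ≤ √x * x ^ (1 / 2 : ℝ) := by gcongr; exact h2 x hx2
        _ = x := by rw [← Real.sqrt_eq_rpow]; exact Real.mul_self_sqrt hxp.le
    refine (key x (by linarith)).trans ?_
    have := h0 x hx0
    rw [mul_div_assoc]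
    linarith

lemma par_of (F : ℕ → ℝ) (hF : ∀ n, |F n| ≤ 1)
    (hP : ∀ m : ℕ, ∃ x0 : ℝ, ∀ x : ℝ, x0 ≤ x →
      |∑ n ∈ Icc 1 ⌊x⌋₊, F n * (ArithmeticFunction.moebius n : ℝ)| ≤ x / Real.log x ^ m + √x) :
    ∀ B : ℝ, 0 < B → ∃ C : ℝ, ∀ x : ℝ, 2 ≤ x →
        |∑ n ∈ Finset.Icc 1 ⌊x⌋₊, (1 + F n) * (ArithmeticFunction.moebius n : ℝ)| ≤ C * x * Real.log x ^ (-B) := by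
  intro B hB
  refine finish _ 1 (by norm_num) ?_ ?_ B hB
  · intro x hx
    refine (Finset.abs_sum_le_sum_abs _ _).trans ?_
    calc _ ≤ ∑ n ∈ Icc 1 ⌊x⌋₊, (2 : ℝ) := by
          apply Finset.sum_le_sum
          intro n _
          rw [abs_mul]
          have h6 : |(ArithmeticFunction.moebius n : ℝ)| ≤ 1 := by
            exact_mod_cast ArithmeticFunction.abs_moebius_le_one (n := n)
          refine (mul_le_of_le_one_right (abs_nonneg _) h6).trans ?_
          have := abs_add_le 1 (F n)
          have := hF n
          rw [abs_one] at *
          linarith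
      _ = 2 * (⌊x⌋₊ : ℝ) := by simp [mul_comm]
      _ ≤ 2 * x := by gcongr; exact Nat.floor_le (by linarith)
      _ ≤ _ := by nlinarith
  · intro m
    obtain ⟨x0, h0⟩ := hP m
    obtain ⟨K, hK, hM⟩ := M_bound m
    obtain ⟨x2, h2⟩ := eventually_atTop.1 (ev_log m (1 / 2) 1 (by norm_num))
    refine ⟨K + 2, max (max x0 3) x2, by positivity, ?_⟩
    intro x hx
    have hx0 : x0 ≤ x := (le_max_left _ _).trans ((le_max_left _ _).trans hx)
    have hx3 : 3 ≤ x := (le_max_right _ _).trans ((le_max_left _ _).trans hx)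
    have hx2 : x2 ≤ x := (le_max_right _ _).trans hx
    have hlx := one_le_log hx3
    have hxp : 0 < x := by linarith
    have e2 : √x ≤ x / Real.log x ^ m := by
      rw [le_div_iff₀ (by positivity)]
      calc _ = √x * (1 * Real.log x ^ m) := by ring
        _ ≤ √x * x ^ (1 / 2 : ℝ) := by gcongr; exact h2 x hx2
        _ = x := by rw [← Real.sqrt_eq_rpow]; exact Real.mul_self_sqrt hxp.le
    have e1 := hM x (by linarith)
    have e3 := h0 x hx0
    simp_rw [add_mul, one_mul]
    rw [Finset.sum_add_distrib, add_div]
    rw [mul_div_assoc] at e1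
    refine (abs_add_le _ _).trans ?_
    rw [mul_div_assoc, mul_div_assoc]
    linarith

open ArithmeticFunction in
lemma S1_of (F : ℕ → ℝ) (hF : ∀ n, |F n| ≤ 1) (hp : ∀ p, p.Prime → F p = 0) :
    Tendsto (fun x : ℝ => Ssum (fun n => 1 + F n) 1 x / x) atTop (nhds 1) := by
  obtain ⟨K, hK, hψ⟩ := psi_bound 1
  have hbd : ∀ x : ℝ, 3 ≤ x → |Ssum (fun n => 1 + F n) 1 x / x - 1| ≤ K / Real.log x + 1 / x + 2 * √x * Real.log x / x := by
    intro x hx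
    have hlx := one_le_log hx
    have hx0 : 0 < x := by linarith
    have h1 : Ssum (fun n => 1 + F n) 1 x - x = ∑ n ∈ Icc 1 ⌊x⌋₊, (vonMangoldt n - 1) + ((⌊x⌋₊ : ℝ) - x) +
        ∑ n ∈ Icc 1 ⌊x⌋₊, F n * vonMangoldt n := by
      unfold Ssum
      simp_rw [Lambdak_eq, Lk_one]
      rw [Finset.sum_sub_distrib]
      simp_rw [add_mul, one_mul]
      rw [Finset.sum_add_distrib]
      simp
      ring
    have h2 : |∑ n ∈ Icc 1 ⌊x⌋₊, F n * vonMangoldt n| ≤ 2 * √x * Real.log x := by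
      have h3 := Chebyshev.psi_sub_theta_le (x := x) (by linarith)
      refine le_trans ?_ h3
      unfold Chebyshev.psi Chebyshev.theta
      refine (Finset.abs_sum_le_sum_abs _ _).trans ?_
      rw [Finset.sum_filter, ← Finset.sum_sub_distrib]
      apply Finset.sum_le_sum
      intro n hn
      by_cases hpn : n.Prime
      · rw [hp n hpn, if_pos hpn, vonMangoldt_apply_prime hpn]; simp
      · rw [if_neg hpn, abs_mul, abs_of_nonneg vonMangoldt_nonneg, sub_zero]
        exact mul_le_of_le_one_left vonMangoldt_nonneg (hF n)
    have h3 := hψ x (by linarith)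
    rw [pow_one] at h3
    have h4 : |(⌊x⌋₊ : ℝ) - x| ≤ 1 := by
      have h1 := Nat.floor_le hx0.le
      have h2 := Nat.lt_floor_add_one x
      rw [abs_le]
      constructor <;> linarith
    have h5 : Ssum (fun n => 1 + F n) 1 x / x - 1 = (Ssum (fun n => 1 + F n) 1 x - x) / x := by
      field_simp
    rw [h5, abs_div, abs_of_pos hx0, div_le_iff₀ hx0, h1]
    have h6 : (K / Real.log x + 1 / x + 2 * √x * Real.log x / x) * x = K * x / Real.log x + 1 + 2 * √x * Real.log x := by
      field_simp
    rw [h6]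
    refine (abs_add_le _ _).trans (add_le_add ((abs_add_le _ _).trans (add_le_add h3 h4)) h2)
  have t1 : Tendsto (fun x : ℝ => K / Real.log x) atTop (nhds 0) := Real.tendsto_log_atTop.const_div_atTop K
  have t2 : Tendsto (fun x : ℝ => 1 / x) atTop (nhds 0) := tendsto_id.const_div_atTop 1
  have t3 : Tendsto (fun x : ℝ => 2 * √x * Real.log x / x) atTop (nhds 0) := by
    have h := ((isLittleO_log_rpow_atTop (show (0 : ℝ) < 1 / 2 by norm_num)).tendsto_div_nhds_zero).const_mul 2
    rw [mul_zero] at h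
    refine h.congr' ?_
    filter_upwards [eventually_gt_atTop 0] with x hx
    rw [← Real.sqrt_eq_rpow]
    have h1 : 0 < √x := Real.sqrt_pos.2 hx
    have h2 : √x * √x = x := Real.mul_self_sqrt hx.le
    rw [eq_div_iff hx.ne']
    calc 2 * (Real.log x / √x) * x = 2 * (Real.log x / √x) * (√x * √x) := by rw [h2]
      _ = _ := by field_simp
  have t4 := (t1.add t2).add t3
  simp only [add_zero] at t4
  rw [tendsto_iff_norm_sub_tendsto_zero]
  refine squeeze_zero' (Eventually.of_forall (fun _ => norm_nonneg _)) ?_ t4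
  filter_upwards [eventually_ge_atTop 3] with x hx
  exact hbd x hx


lemma not_tendsto_of (a : ℕ → ℝ) (k : ℕ) (hk : 2 ≤ k) (δ : ℝ) (hδ : 0 < δ)
    (h : ∀ N : ℕ, ∃ X : ℕ, N ≤ X ∧ δ * X * Real.log X ^ (k - 1) ≤
      |∑ n ∈ Ioc X (2 * X), a n * Lk k n - (k * (2 * X) * Real.log (2 * X) ^ (k - 1) - k * X * Real.log X ^ (k - 1))|) :
    ¬ Tendsto (fun x : ℝ => Ssum a k x / (k * x * Real.log x ^ (k - 1))) atTop (nhds 1) := by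
  intro ht
  have hk0 : (0 : ℝ) < k := by exact_mod_cast (by omega : 0 < k)
  set ε : ℝ := δ / (2 * (k * (2 * 2 ^ (k - 1) + 1))) with hε
  have hε0 : 0 < ε := by positivity
  have h1 := (Metric.tendsto_atTop.1 ht) ε hε0
  obtain ⟨x0, hx0⟩ := h1
  have hD : ∀ x : ℝ, max x0 3 ≤ x → |Ssum a k x - k * x * Real.log x ^ (k - 1)| ≤ ε * (k * x * Real.log x ^ (k - 1)) := by
    intro x hx
    have hx3 : 3 ≤ x := (le_max_right _ _).trans hx
    have hlx := one_le_log hx3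
    have h2 := hx0 x ((le_max_left _ _).trans hx)
    rw [Real.dist_eq] at h2
    have hp : 0 < k * x * Real.log x ^ (k - 1) := by positivity
    have h3 : Ssum a k x - k * x * Real.log x ^ (k - 1) =
        (Ssum a k x / (k * x * Real.log x ^ (k - 1)) - 1) * (k * x * Real.log x ^ (k - 1)) := by
      field_simp
    rw [h3, abs_mul, abs_of_pos hp]
    gcongr
  obtain ⟨X, hX, hXb⟩ := h (max 3 ⌈x0⌉₊)
  have hX3 : (3 : ℝ) ≤ X := by exact_mod_cast (le_max_left _ _).trans hX
  have hXx : x0 ≤ X := (Nat.le_ceil _).trans (by exact_mod_cast (le_max_right _ _).trans hX)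
  have d1 := hD X (max_le hXx hX3)
  have d2 := hD (2 * X) (max_le (by linarith) (by linarith))
  have hlX := one_le_log hX3
  have hX0 : (0 : ℝ) < X := by linarith
  have hl2 : Real.log (2 * X) ≤ 2 * Real.log X := by
    have : Real.log (2 * X) ≤ Real.log ((X : ℝ) ^ 2) := by
      apply Real.log_le_log (by positivity)
      nlinarith
    rwa [Real.log_pow] at this
  have hl0 : 0 ≤ Real.log (2 * X) := Real.log_nonneg (by linarith)
  have hdiff : Ssum a k (2 * X) - Ssum a k X = ∑ n ∈ Ioc X (2 * X), a n * Lk k n := by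
    unfold Ssum
    have e1 : ⌊(2 * X : ℝ)⌋₊ = 2 * X := by
      have : (2 * X : ℝ) = ((2 * X : ℕ) : ℝ) := by push_cast; rfl
      rw [this, Nat.floor_natCast]
    rw [e1, Nat.floor_natCast]
    simp_rw [Lambdak_eq]
    have e2 : Icc 1 (2 * X) = Icc 1 X ∪ Ioc X (2 * X) := by
      ext n; simp only [mem_Icc, mem_union, mem_Ioc]; omega
    rw [e2, Finset.sum_union]
    · ring
    · rw [Finset.disjoint_left]
      intro n h1 h2
      rw [mem_Icc] at h1
      rw [mem_Ioc] at h2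
      omega
  have hb2 : k * (2 * X) * Real.log (2 * X) ^ (k - 1) ≤ k * (2 * X) * (2 ^ (k - 1) * Real.log X ^ (k - 1)) := by
    rw [← mul_pow]; gcongr
  have hfin : |∑ n ∈ Ioc X (2 * X), a n * Lk k n - (k * (2 * X) * Real.log (2 * X) ^ (k - 1) - k * X * Real.log X ^ (k - 1))| ≤
      δ / 2 * X * Real.log X ^ (k - 1) := by
    rw [← hdiff]
    calc _ = |(Ssum a k (2 * X) - k * (2 * X) * Real.log (2 * X) ^ (k - 1)) - (Ssum a k X - k * X * Real.log X ^ (k - 1))| := by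
          congr 1; ring
      _ ≤ _ := abs_sub _ _
      _ ≤ ε * (k * (2 * X) * (2 ^ (k - 1) * Real.log X ^ (k - 1))) + ε * (k * X * Real.log X ^ (k - 1)) := by
          refine add_le_add (d2.trans ?_) d1
          gcongr
      _ = ε * (k * (2 * 2 ^ (k - 1) + 1)) * (X * Real.log X ^ (k - 1)) := by ring
      _ = _ := by
          have : ε * (k * (2 * 2 ^ (k - 1) + 1)) = δ / 2 := by
            rw [hε]; field_simp
          rw [this]; ring
  have hpos : 0 < δ / 2 * X * Real.log X ^ (k - 1) := by positivity
  have : δ * X * Real.log X ^ (k - 1) = 2 * (δ / 2 * X * Real.log X ^ (k - 1)) := by ring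
  linarith


theorem bombieri_sieve_stmt4 (ν : ℝ) (hν : ν ∈ Set.Ioo (0 : ℝ) 1) :
    ∃ a : ℕ → ℝ, (∀ n, 0 ≤ a n ∧ a n ≤ 2) ∧ Rcond ν a ∧
      (∀ B : ℝ, 0 < B → ∃ C : ℝ, ∀ x : ℝ, 2 ≤ x →
        |∑ n ∈ Finset.Icc 1 ⌊x⌋₊, a n * (ArithmeticFunction.moebius n : ℝ)| ≤ C * x * Real.log x ^ (-B)) ∧
      Tendsto (fun x : ℝ => Ssum a 1 x / x) atTop (nhds 1) ∧
      ∀ k : ℕ, 2 ≤ k → ¬ Tendsto (fun x : ℝ => Ssum a k x / (k * x * Real.log x ^ (k - 1))) atTop (nhds 1) := by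
  obtain ⟨hν0, hν1⟩ := hν
  have hsc := fun i : ℕ => scale ν hν0 hν1 (i + 2) (by omega)
  choose δ hδ hsc2 using hsc
  choose X hXM hX3 f hfb hfs hfp hfR hfP hfm using hsc2
  let κ : ℕ → ℕ := fun j => (Nat.unpair j).1
  obtain ⟨xs, M, hM, hM4⟩ : ∃ xs M : ℕ → ℕ, (∀ j, xs j = X (κ j) j (M j)) ∧ ∀ j, M (j + 1) = (2 * xs j) ^ 4 := by
    let xs : ℕ → ℕ := fun j => Nat.rec (X (κ 0) 0 0) (fun j y => X (κ (j + 1)) (j + 1) ((2 * y) ^ 4)) j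
    refine ⟨xs, fun j => match j with
      | 0 => 0
      | j + 1 => (2 * xs j) ^ 4, ?_, fun j => rfl⟩
    intro j
    cases j with
    | zero => rfl
    | succ j => rfl
  have h3 : ∀ j, 3 ≤ xs j := fun j => by rw [hM]; exact hX3 _ _ _
  have hg4 : ∀ j, (2 * xs j) ^ 4 ≤ xs (j + 1) := fun j => by
    rw [hM (j + 1), ← hM4]; exact hXM _ _ _
  have hg : ∀ j, 2 * xs j ≤ xs (j + 1) := fun j => (Nat.le_self_pow (by norm_num) _).trans (hg4 j)
  have hm : StrictMono xs := strictMono_nat_of_lt_succ (fun j => by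
    have := hg j; have := h3 j; omega)
  let T : ℕ → ℝ := fun j => ∑ n ∈ Ioc (xs j) (2 * xs j), Lk (κ j + 2) n -
    (((κ j + 2 : ℕ) : ℝ) * (2 * (xs j : ℝ)) * Real.log (2 * (xs j : ℝ)) ^ (κ j + 2 - 1) - ((κ j + 2 : ℕ) : ℝ) * (xs j : ℝ) * Real.log (xs j : ℝ) ^ (κ j + 2 - 1))
  let g : ℕ → ℕ → ℝ := fun j => f (κ j) j (M j) (T j)
  have gb : ∀ j n, |g j n| ≤ 1 := fun j n => hfb _ _ _ _ n
  have gs : ∀ j n, n ∉ Ioc (xs j) (2 * xs j) → g j n = 0 := fun j n hn => hfs _ _ _ _ n (by rwa [hM] at hn)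
  have gp : ∀ j p, Nat.Prime p → g j p = 0 := fun j p hp => hfp _ _ _ _ p hp
  have gR : ∀ j, ∀ x : ℝ, (xs j : ℝ) ≤ x → ∑ d ∈ Icc 1 ⌊x ^ ν⌋₊, |∑ n ∈ (Icc 1 ⌊x⌋₊).filter (fun n => d ∣ n), g j n| ≤ x / Real.log x ^ j :=
    fun j x hx => hfR _ _ _ _ x (by rwa [hM] at hx)
  have gP : ∀ j, ∀ x : ℝ, (xs j : ℝ) ≤ x → |∑ n ∈ Icc 1 ⌊x⌋₊, g j n * (ArithmeticFunction.moebius n : ℝ)| ≤ x / Real.log x ^ j :=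
    fun j x hx => hfP _ _ _ _ x (by rwa [hM] at hx)
  have gm : ∀ j, δ (κ j) * xs j * Real.log (xs j) ^ (κ j + 2 - 1) ≤ |T j + ∑ n ∈ Ioc (xs j) (2 * xs j), g j n * Lk (κ j + 2) n| := by
    intro j
    have := hfm (κ j) j (M j) (T j)
    rw [← hM] at this
    exact this
  have hFb := FF_abs xs g gb
  refine ⟨fun n => 1 + FF xs g n, ?_, ?_, ?_, ?_, ?_⟩
  · intro n
    have := abs_le.1 (hFb n)
    constructor <;> simp only <;> linarith
  · exact Rcond_of ν hν0 hν1 _ hFb (fun m => ⟨xs (m + 1), fun x hx => FF_R ν xs g hm hg hg4 h3 gb gs gR m x hx⟩)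
  · exact par_of _ hFb (fun m => ⟨xs (m + 1), fun x hx => FF_par xs g hm hg hg4 h3 gb gs gP m x hx⟩)
  · exact S1_of _ hFb (FF_prime xs g gp)
  · intro k hk
    obtain ⟨i, rfl⟩ : ∃ i, k = i + 2 := ⟨k - 2, by omega⟩
    refine not_tendsto_of _ (i + 2) hk (δ i) (hδ i) ?_
    intro N
    have hκ : κ (Nat.pair i N) = i := by simp [κ]
    refine ⟨xs (Nat.pair i N), (Nat.right_le_pair i N).trans (hm.id_le _), ?_⟩
    have h := gm (Nat.pair i N)
    simp only [T] at h
    rw [hκ] at h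
    refine h.trans (le_of_eq ?_)
    congr 1
    rw [sub_add_eq_add_sub, ← Finset.sum_add_distrib]
    congr 1
    apply Finset.sum_congr rfl
    intro n hn
    rw [FF_eq xs g hm hg _ n hn]
    ring
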